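/- The second Čech cohomology group H²(𝔐(H^∞(𝔻 × ℕ)), ℤ) is trivial, where 𝔻 × ℕ is the disjoint union of countably many copies of the open unit disk 𝔻 ⊂ ℂ. -/

import Mathlib

open Set Metric WeakDual BoundedContinuousFunction Manifold Topology Complex

set_option synthInstance.maxHeartbeats 1000000
set_option maxHeartbeats 2000000

noncomputable section

/-- The covering dimension of a topological space `X` is at most `n`: every open cover
has an open refinement of order at most `n + 1`. -/
def CovDimLE (X : Type) [TopologicalSpace X] (n : ℕ) : Prop :=
  ∀ 𝒰 : Set (Set X), (∀ U ∈ 𝒰, IsOpen U) → ⋃₀ 𝒰 = Set.univ →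
    ∃ 𝒱 : Set (Set X), (∀ V ∈ 𝒱, IsOpen V) ∧ ⋃₀ 𝒱 = Set.univ ∧
      (∀ V ∈ 𝒱, ∃ U ∈ 𝒰, V ⊆ U) ∧
      ∀ x : X, {V ∈ 𝒱 | x ∈ V}.Finite ∧ {V ∈ 𝒱 | x ∈ V}.ncard ≤ n + 1

/-- `dim X = n`: the covering dimension of `X` is at most `n` but not at most `n - 1`. -/
def CovDimEq (X : Type) [TopologicalSpace X] (n : ℕ) : Prop :=
  CovDimLE X n ∧ ¬ CovDimLE X (n - 1)

/-- A Čech 2-cocycle (with coefficients in `ℤ`) on the open cover `U` of `X`. -/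
def IsCechTwoCocycle {X : Type} [TopologicalSpace X] {ι : Type}
    (U : ι → Set X) (c : ι → ι → ι → ℤ) : Prop :=
  ∀ i j k l : ι, (U i ∩ U j ∩ U k ∩ U l).Nonempty →
    c j k l - c i k l + c i j l - c i j k = 0

/-- Triviality of the second Čech cohomology group `H²(X, ℤ)`: every integral 2-cocycle on
every open cover of `X` becomes a coboundary after passing to a suitable open refinement. -/
def CechH2Trivial (X : Type) [TopologicalSpace X] : Prop :=
  ∀ (ι : Type) (U : ι → Set X), (∀ i, IsOpen (U i)) → (⋃ i, U i) = Set.univ →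
    ∀ c : ι → ι → ι → ℤ, IsCechTwoCocycle U c →
      ∃ (κ : Type) (V : κ → Set X) (τ : κ → ι),
        (∀ j, IsOpen (V j)) ∧ (⋃ j, V j) = Set.univ ∧ (∀ j, V j ⊆ U (τ j)) ∧
        ∃ b : κ → κ → ℤ, ∀ i j k : κ, (V i ∩ V j ∩ V k).Nonempty →
          c (τ i) (τ j) (τ k) = b j k - b i k + b i j

/-- The open unit disk in `ℂ`. -/
abbrev unitDisk : Set ℂ := ball (0 : ℂ) 1

/-- `𝔻 × ℕ`: the disjoint union of countably many copies of the open unit disk. -/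
abbrev DiskNat := unitDisk × ℕ

/-- The Banach algebra `H^∞(𝔻 × ℕ)` of bounded functions on `𝔻 × ℕ` that are holomorphic on
each copy of `𝔻`, realized as a subalgebra of the bounded continuous functions on `𝔻 × ℕ`. -/
def HinfDiskNat : Subalgebra ℂ (DiskNat →ᵇ ℂ) where
  carrier := {f | ∀ n : ℕ, ∃ g : ℂ → ℂ, DifferentiableOn ℂ g unitDisk ∧
    ∀ z : unitDisk, f (z, n) = g z}
  add_mem' := by
    rintro f g hf hg n
    obtain ⟨F, hF, hfF⟩ := hf n
    obtain ⟨G, hG, hgG⟩ := hg n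
    exact ⟨F + G, hF.add hG, fun z => by simp [hfF z, hgG z]⟩
  mul_mem' := by
    rintro f g hf hg n
    obtain ⟨F, hF, hfF⟩ := hf n
    obtain ⟨G, hG, hgG⟩ := hg n
    exact ⟨F * G, hF.mul hG, fun z => by simp [hfF z, hgG z]⟩
  algebraMap_mem' := fun c n =>
    ⟨fun _ => c, differentiableOn_const c, fun _ => rfl⟩

/-- The maximal ideal space `𝔐(H^∞(𝔻 × ℕ))`. -/
abbrev MaxIdealSpaceDiskNat := characterSpace ℂ HinfDiskNat

set_option linter.unusedSectionVars false
set_option linter.unusedSimpArgs false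
set_option linter.unnecessarySeqFocus false
set_option linter.style.refine false

section Wirtinger

variable {E F H : Type*}
  [NormedAddCommGroup E] [NormedSpace ℂ E] [NormedSpace ℝ E] [IsScalarTower ℝ ℂ E]
  [NormedAddCommGroup F] [NormedSpace ℂ F] [NormedSpace ℝ F] [IsScalarTower ℝ ℂ F]
  [NormedAddCommGroup H] [NormedSpace ℂ H] [NormedSpace ℝ H] [IsScalarTower ℝ ℂ H]

/-- The Wirtinger derivative `∂f/∂z`. -/
def dz (f : ℂ → E) (z : ℂ) : E := (1 / 2 : ℂ) • (fderiv ℝ f z 1 - I • fderiv ℝ f z I)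

/-- The Wirtinger derivative `∂f/∂z̄`. -/
def dbar (f : ℂ → E) (z : ℂ) : E := (1 / 2 : ℂ) • (fderiv ℝ f z 1 + I • fderiv ℝ f z I)

theorem fderiv_eq_dz_dbar (f : ℂ → E) (z v : ℂ) :
    fderiv ℝ f z v = v • dz f z + (starRingEnd ℂ v) • dbar f z := by
  have h : fderiv ℝ f z v = (v.re : ℂ) • fderiv ℝ f z 1 + (v.im : ℂ) • fderiv ℝ f z I := by
    have : v = v.re • (1 : ℂ) + v.im • I := by
      apply Complex.ext <;> simp
    conv_lhs => rw [this]
    rw [map_add, map_smul, map_smul, ← algebraMap_smul ℂ v.re, ← algebraMap_smul ℂ v.im]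
    simp
  rw [h, dz, dbar]
  have hv : v = v.re + v.im * I := (Complex.re_add_im v).symm
  have hc : (starRingEnd ℂ) v = v.re - v.im * I := by
    apply Complex.ext <;> simp
  rw [hc]
  nth_rw 3 [hv]
  simp only [smul_sub, smul_add, smul_smul]
  match_scalars <;> ring_nf <;> simp [Complex.I_sq]

theorem Filter.EventuallyEq.dz_eq {f g : ℂ → E} {z : ℂ} (h : f =ᶠ[𝓝 z] g) : dz f z = dz g z := by
  rw [dz, dz, h.fderiv_eq]

theorem Filter.EventuallyEq.dbar_eq {f g : ℂ → E} {z : ℂ} (h : f =ᶠ[𝓝 z] g) :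
    dbar f z = dbar g z := by
  rw [dbar, dbar, h.fderiv_eq]

theorem ContDiff.dz {f : ℂ → E} (hf : ContDiff ℝ (⊤ : ℕ∞) f) : ContDiff ℝ (⊤ : ℕ∞) (dz f) := by
  have h1 := hf.fderiv_right (m := (⊤ : ℕ∞)) (by norm_cast)
  unfold _root_.dz
  have h2 : ∀ v : ℂ, ContDiff ℝ (⊤ : ℕ∞) fun z => fderiv ℝ f z v := fun v =>
    h1.clm_apply contDiff_const
  exact ((h2 1).sub ((h2 I).const_smul I)).const_smul _

theorem ContDiff.dbar {f : ℂ → E} (hf : ContDiff ℝ (⊤ : ℕ∞) f) :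
    ContDiff ℝ (⊤ : ℕ∞) (dbar f) := by
  have h1 := hf.fderiv_right (m := (⊤ : ℕ∞)) (by norm_cast)
  unfold _root_.dbar
  have h2 : ∀ v : ℂ, ContDiff ℝ (⊤ : ℕ∞) fun z => fderiv ℝ f z v := fun v =>
    h1.clm_apply contDiff_const
  exact ((h2 1).add ((h2 I).const_smul I)).const_smul _

theorem dz_const (c : E) (z : ℂ) : dz (fun _ => c) z = 0 := by simp [dz]

theorem dbar_const (c : E) (z : ℂ) : dbar (fun _ => c) z = 0 := by simp [dbar]

theorem dz_add {f g : ℂ → E} {z : ℂ} (hf : DifferentiableAt ℝ f z) (hg : DifferentiableAt ℝ g z) :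
    dz (fun z => f z + g z) z = dz f z + dz g z := by
  simp only [dz, fderiv_fun_add hf hg, _root_.add_apply]
  module

theorem dbar_add {f g : ℂ → E} {z : ℂ} (hf : DifferentiableAt ℝ f z)
    (hg : DifferentiableAt ℝ g z) :
    dbar (fun z => f z + g z) z = dbar f z + dbar g z := by
  simp only [dbar, fderiv_fun_add hf hg, _root_.add_apply]
  module

theorem dz_sub {f g : ℂ → E} {z : ℂ} (hf : DifferentiableAt ℝ f z) (hg : DifferentiableAt ℝ g z) :
    dz (fun z => f z - g z) z = dz f z - dz g z := by
  simp only [dz, fderiv_fun_sub hf hg, _root_.sub_apply]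
  module

theorem dbar_sub {f g : ℂ → E} {z : ℂ} (hf : DifferentiableAt ℝ f z)
    (hg : DifferentiableAt ℝ g z) :
    dbar (fun z => f z - g z) z = dbar f z - dbar g z := by
  simp only [dbar, fderiv_fun_sub hf hg, _root_.sub_apply]
  module

theorem dbar_sum {ι : Type*} (s : Finset ι) {f : ι → ℂ → E} {z : ℂ}
    (hf : ∀ i ∈ s, DifferentiableAt ℝ (f i) z) :
    dbar (fun z => ∑ i ∈ s, f i z) z = ∑ i ∈ s, dbar (f i) z := by
  simp only [dbar, fderiv_fun_sum hf, _root_.sum_apply, ← Finset.smul_sum,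
    Finset.sum_add_distrib]

theorem hasFDerivAt_bilin (B : E →L[ℂ] F →L[ℂ] H) {f : ℂ → E} {g : ℂ → F} {z : ℂ}
    (hf : DifferentiableAt ℝ f z) (hg : DifferentiableAt ℝ g z) (v : ℂ) :
    fderiv ℝ (fun z => B (f z) (g z)) z v =
      B (f z) (fderiv ℝ g z v) + B (fderiv ℝ f z v) (g z) := by
  have h1 : HasFDerivAt (fun z => (B.bilinearRestrictScalars ℝ) (f z) (g z)) _ z :=
    (B.bilinearRestrictScalars ℝ).hasFDerivAt_of_bilinear hf.hasFDerivAt hg.hasFDerivAt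
  have h2 := h1.fderiv
  simp only [ContinuousLinearMap.bilinearRestrictScalars_apply_apply] at h2
  rw [h2]
  simp

theorem dz_bilin (B : E →L[ℂ] F →L[ℂ] H) {f : ℂ → E} {g : ℂ → F} {z : ℂ}
    (hf : DifferentiableAt ℝ f z) (hg : DifferentiableAt ℝ g z) :
    dz (fun z => B (f z) (g z)) z = B (dz f z) (g z) + B (f z) (dz g z) := by
  simp only [dz, hasFDerivAt_bilin B hf hg, map_smul, map_sub, _root_.smul_apply,
    _root_.sub_apply]
  module

theorem dbar_bilin (B : E →L[ℂ] F →L[ℂ] H) {f : ℂ → E} {g : ℂ → F} {z : ℂ}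
    (hf : DifferentiableAt ℝ f z) (hg : DifferentiableAt ℝ g z) :
    dbar (fun z => B (f z) (g z)) z = B (dbar f z) (g z) + B (f z) (dbar g z) := by
  simp only [dbar, hasFDerivAt_bilin B hf hg, map_smul, map_add, _root_.smul_apply,
    _root_.add_apply]
  module

theorem dz_clm (L : E →L[ℂ] F) {f : ℂ → E} {z : ℂ} (hf : DifferentiableAt ℝ f z) :
    dz (fun z => L (f z)) z = L (dz f z) := by
  have h : fderiv ℝ (fun z => L (f z)) z = (L.restrictScalars ℝ) ∘L fderiv ℝ f z :=
    ((L.restrictScalars ℝ).hasFDerivAt.comp z hf.hasFDerivAt).fderiv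
  simp [dz, h]

theorem dbar_clm (L : E →L[ℂ] F) {f : ℂ → E} {z : ℂ} (hf : DifferentiableAt ℝ f z) :
    dbar (fun z => L (f z)) z = L (dbar f z) := by
  have h : fderiv ℝ (fun z => L (f z)) z = (L.restrictScalars ℝ) ∘L fderiv ℝ f z :=
    ((L.restrictScalars ℝ).hasFDerivAt.comp z hf.hasFDerivAt).fderiv
  simp [dbar, h]

theorem dz_mul {f g : ℂ → ℂ} {z : ℂ} (hf : DifferentiableAt ℝ f z)
    (hg : DifferentiableAt ℝ g z) :
    dz (fun z => f z * g z) z = dz f z * g z + f z * dz g z :=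
  dz_bilin (ContinuousLinearMap.mul ℂ ℂ) hf hg

theorem dbar_mul {f g : ℂ → ℂ} {z : ℂ} (hf : DifferentiableAt ℝ f z)
    (hg : DifferentiableAt ℝ g z) :
    dbar (fun z => f z * g z) z = dbar f z * g z + f z * dbar g z :=
  dbar_bilin (ContinuousLinearMap.mul ℂ ℂ) hf hg

theorem dz_smul {f : ℂ → ℂ} {g : ℂ → E} {z : ℂ} (hf : DifferentiableAt ℝ f z)
    (hg : DifferentiableAt ℝ g z) :
    dz (fun z => f z • g z) z = dz f z • g z + f z • dz g z :=
  dz_bilin (ContinuousLinearMap.lsmul ℂ ℂ) hf hg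

theorem dbar_smul {f : ℂ → ℂ} {g : ℂ → E} {z : ℂ} (hf : DifferentiableAt ℝ f z)
    (hg : DifferentiableAt ℝ g z) :
    dbar (fun z => f z • g z) z = dbar f z • g z + f z • dbar g z :=
  dbar_bilin (ContinuousLinearMap.lsmul ℂ ℂ) hf hg

theorem dz_const_smul (c : ℂ) {f : ℂ → E} {z : ℂ} (hf : DifferentiableAt ℝ f z) :
    dz (fun z => c • f z) z = c • dz f z :=
  dz_clm (c • ContinuousLinearMap.id ℂ E) hf

theorem dbar_const_smul (c : ℂ) {f : ℂ → E} {z : ℂ} (hf : DifferentiableAt ℝ f z) :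
    dbar (fun z => c • f z) z = c • dbar f z :=
  dbar_clm (c • ContinuousLinearMap.id ℂ E) hf

theorem dz_const_mul (c : ℂ) {f : ℂ → ℂ} {z : ℂ} (hf : DifferentiableAt ℝ f z) :
    dz (fun z => c * f z) z = c * dz f z := dz_const_smul c hf

theorem dbar_const_mul (c : ℂ) {f : ℂ → ℂ} {z : ℂ} (hf : DifferentiableAt ℝ f z) :
    dbar (fun z => c * f z) z = c * dbar f z := dbar_const_smul c hf

theorem dz_conj {f : ℂ → ℂ} {z : ℂ} (hf : DifferentiableAt ℝ f z) :
    dz (fun z => starRingEnd ℂ (f z)) z = starRingEnd ℂ (dbar f z) := by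
  have h : fderiv ℝ (fun z => starRingEnd ℂ (f z)) z =
      (Complex.conjCLE : ℂ →L[ℝ] ℂ) ∘L fderiv ℝ f z :=
    ((Complex.conjCLE : ℂ →L[ℝ] ℂ).hasFDerivAt.comp z hf.hasFDerivAt).fderiv
  have h2 : (starRingEnd ℂ) 2 = 2 := map_ofNat _ 2
  simp [dz, dbar, h, h2]
  ring

theorem dbar_conj {f : ℂ → ℂ} {z : ℂ} (hf : DifferentiableAt ℝ f z) :
    dbar (fun z => starRingEnd ℂ (f z)) z = starRingEnd ℂ (dz f z) := by
  have h : fderiv ℝ (fun z => starRingEnd ℂ (f z)) z =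
      (Complex.conjCLE : ℂ →L[ℝ] ℂ) ∘L fderiv ℝ f z :=
    ((Complex.conjCLE : ℂ →L[ℝ] ℂ).hasFDerivAt.comp z hf.hasFDerivAt).fderiv
  have h2 : (starRingEnd ℂ) 2 = 2 := map_ofNat _ 2
  simp [dz, dbar, h, h2]

theorem dz_eq_deriv {f : ℂ → E} {z : ℂ} (hf : DifferentiableAt ℂ f z) : dz f z = deriv f z := by
  have h : fderiv ℝ f z = (fderiv ℂ f z).restrictScalars ℝ := hf.fderiv_restrictScalars ℝ
  have h2 : fderiv ℂ f z I = I • fderiv ℂ f z 1 := by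
    rw [← map_smul]; simp
  simp only [dz, h, ContinuousLinearMap.coe_restrictScalars', h2, fderiv_apply_one_eq_deriv,
    smul_smul, Complex.I_mul_I]
  module

theorem dbar_eq_zero {f : ℂ → E} {z : ℂ} (hf : DifferentiableAt ℂ f z) : dbar f z = 0 := by
  have h : fderiv ℝ f z = (fderiv ℂ f z).restrictScalars ℝ := hf.fderiv_restrictScalars ℝ
  have h2 : fderiv ℂ f z I = I • fderiv ℂ f z 1 := by
    rw [← map_smul]; simp
  simp only [dbar, h, ContinuousLinearMap.coe_restrictScalars', h2, fderiv_apply_one_eq_deriv,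
    smul_smul, Complex.I_mul_I]
  module

theorem differentiableAt_of_dbar_eq_zero {f : ℂ → E} {z : ℂ} (hf : DifferentiableAt ℝ f z)
    (h : dbar f z = 0) : DifferentiableAt ℂ f z := by
  refine (hasFDerivAt_of_restrictScalars ℝ hf.hasFDerivAt
    (f' := (ContinuousLinearMap.id ℂ ℂ).smulRight (dz f z)) ?_).differentiableAt
  ext
  · simp [fderiv_eq_dz_dbar, h]

theorem dz_dbar_comm {f : ℂ → E} {z : ℂ} (hf : ContDiffAt ℝ 2 f z) :
    dz (dbar f) z = dbar (dz f) z := by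
  have hs : IsSymmSndFDerivAt ℝ f z := hf.isSymmSndFDerivAt (by simp)
  have hd : DifferentiableAt ℝ (fderiv ℝ f) z :=
    (hf.fderiv_right (m := 1) (by norm_num)).differentiableAt (by norm_num)
  have h2 : ∀ v w : ℂ, fderiv ℝ (fun z => fderiv ℝ f z v) z w = fderiv ℝ (fderiv ℝ f) z w v := by
    intro v w
    rw [fderiv_clm_apply hd (differentiableAt_const v)]
    simp
  have h3 : ∀ v : ℂ, DifferentiableAt ℝ (fun z => fderiv ℝ f z v) z := fun v =>
    hd.clm_apply (differentiableAt_const v)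
  have e1 : dbar f = fun z => (1 / 2 : ℂ) • (fderiv ℝ f z 1 + I • fderiv ℝ f z I) := rfl
  have e2 : dz f = fun z => (1 / 2 : ℂ) • (fderiv ℝ f z 1 - I • fderiv ℝ f z I) := rfl
  have h4 : DifferentiableAt ℝ (fun z => I • fderiv ℝ f z I) z := (h3 I).const_smul I
  rw [e1, e2, dz_const_smul _ ((h3 1).fun_add h4), dbar_const_smul _ ((h3 1).fun_sub h4),
    dz_add (h3 1) h4, dbar_sub (h3 1) h4, dz_const_smul _ (h3 I), dbar_const_smul _ (h3 I)]
  simp only [dz, dbar, h2]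
  rw [hs.eq 1 I]
  module

theorem ContDiffAt.differentiableAt_dbar {f : ℂ → E} {z : ℂ} (hf : ContDiffAt ℝ 2 f z) :
    DifferentiableAt ℝ (_root_.dbar f) z := by
  have hd : DifferentiableAt ℝ (fderiv ℝ f) z :=
    (hf.fderiv_right (m := 1) (by norm_num)).differentiableAt (by norm_num)
  have h3 : ∀ v : ℂ, DifferentiableAt ℝ (fun z => fderiv ℝ f z v) z := fun v =>
    hd.clm_apply (differentiableAt_const v)
  exact ((h3 1).fun_add ((h3 I).fun_const_smul I)).fun_const_smul (1 / 2 : ℂ)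

theorem ContDiffAt.differentiableAt_dz {f : ℂ → E} {z : ℂ} (hf : ContDiffAt ℝ 2 f z) :
    DifferentiableAt ℝ (_root_.dz f) z := by
  have hd : DifferentiableAt ℝ (fderiv ℝ f) z :=
    (hf.fderiv_right (m := 1) (by norm_num)).differentiableAt (by norm_num)
  have h3 : ∀ v : ℂ, DifferentiableAt ℝ (fun z => fderiv ℝ f z v) z := fun v =>
    hd.clm_apply (differentiableAt_const v)
  exact ((h3 1).fun_sub ((h3 I).fun_const_smul I)).fun_const_smul (1 / 2 : ℂ)

theorem dz_id' (z : ℂ) : dz (fun w : ℂ => w) z = 1 :=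
  (dz_eq_deriv differentiableAt_id).trans (deriv_id z)

theorem dbar_id' (z : ℂ) : dbar (fun w : ℂ => w) z = 0 :=
  dbar_eq_zero differentiableAt_id

end Wirtinger

section MaximumPrinciple

theorem deriv_deriv_nonpos_of_isLocalMax {φ : ℝ → ℝ} {t : ℝ} (hc : ContinuousAt φ t)
    (h : IsLocalMax φ t) : deriv (deriv φ) t ≤ 0 := by
  by_contra hpos
  push Not at hpos
  have h1 : IsLocalMin φ t := isLocalMin_of_deriv_deriv_pos hpos h.deriv_eq_zero hc
  have h2 : φ =ᶠ[𝓝 t] fun _ => φ t := by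
    filter_upwards [h, h1] with s hs hs' using le_antisymm hs hs'
  have h3 : deriv φ =ᶠ[𝓝 t] deriv fun _ => φ t := h2.deriv
  have h4 := h3.deriv_eq
  simp at h4
  linarith

theorem fderiv_fderiv_nonpos_of_isLocalMax {g : ℂ → ℝ} {z : ℂ} (hg : ContDiffAt ℝ 2 g z)
    (h : IsLocalMax g z) (v : ℂ) : fderiv ℝ (fun w => fderiv ℝ g w v) z v ≤ 0 := by
  set φ : ℝ → ℝ := fun t => g (z + t * v) with hφ
  have hl : ∀ t : ℝ, HasDerivAt (fun t : ℝ => z + t * v) v t := by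
    intro t
    simpa using ((Complex.ofRealCLM.hasDerivAt (x := t)).mul_const v).const_add z
  have hl0 : Filter.Tendsto (fun t : ℝ => z + t * v) (𝓝 0) (𝓝 z) := by
    have := (hl 0).continuousAt.tendsto
    simpa using this
  have hloc : IsLocalMax φ 0 := by
    have := hl0.eventually h
    simpa [IsLocalMax, IsMaxFilter, hφ] using this
  have hd1 : ∀ᶠ w in 𝓝 z, DifferentiableAt ℝ g w := by
    filter_upwards [hg.eventually (by simp)] with w hw using hw.differentiableAt (by norm_num)
  have hd : deriv φ =ᶠ[𝓝 0] fun t : ℝ => fderiv ℝ g (z + t * v) v := by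
    filter_upwards [hl0.eventually hd1] with t ht
    exact (ht.hasFDerivAt.comp_hasDerivAt t (hl t)).deriv
  have hdd : DifferentiableAt ℝ (fun w => fderiv ℝ g w v) z := by
    have : DifferentiableAt ℝ (fderiv ℝ g) z :=
      (hg.fderiv_right (m := 1) (by norm_num)).differentiableAt (by norm_num)
    exact this.clm_apply (differentiableAt_const v)
  have h2 : deriv (deriv φ) 0 = fderiv ℝ (fun w => fderiv ℝ g w v) z v := by
    rw [hd.deriv_eq]
    have hz : z = z + ((0 : ℝ) : ℂ) * v := by simp
    have hdd' := hdd.hasFDerivAt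
    rw [hz] at hdd'
    conv_rhs => rw [hz]
    exact (hdd'.comp_hasDerivAt (0 : ℝ) (hl 0)).deriv
  rw [← h2]
  refine deriv_deriv_nonpos_of_isLocalMax ?_ hloc
  have : ContinuousAt g (z + ((0 : ℝ) : ℂ) * v) := by simpa using hg.continuousAt
  exact ContinuousAt.comp (f := fun t : ℝ => z + t * v) this (hl 0).continuousAt

theorem dz_dbar_eq_fderiv {f : ℂ → ℂ} {z : ℂ} (hf : ContDiffAt ℝ 2 f z) :
    dz (dbar f) z = (1 / 4 : ℂ) * (fderiv ℝ (fun w => fderiv ℝ f w 1) z 1 +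
      fderiv ℝ (fun w => fderiv ℝ f w I) z I) := by
  have hs : IsSymmSndFDerivAt ℝ f z := hf.isSymmSndFDerivAt (by simp)
  have hd : DifferentiableAt ℝ (fderiv ℝ f) z :=
    (hf.fderiv_right (m := 1) (by norm_num)).differentiableAt (by norm_num)
  have h2 : ∀ v w : ℂ, fderiv ℝ (fun z => fderiv ℝ f z v) z w = fderiv ℝ (fderiv ℝ f) z w v := by
    intro v w
    rw [fderiv_clm_apply hd (differentiableAt_const v)]
    simp
  have h3 : ∀ v : ℂ, DifferentiableAt ℝ (fun z => fderiv ℝ f z v) z := fun v =>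
    hd.clm_apply (differentiableAt_const v)
  have e1 : dbar f = fun z => (1 / 2 : ℂ) • (fderiv ℝ f z 1 + I • fderiv ℝ f z I) := rfl
  have h4 : DifferentiableAt ℝ (fun z => I • fderiv ℝ f z I) z := (h3 I).const_smul I
  rw [e1, dz_const_smul _ ((h3 1).fun_add h4), dz_add (h3 1) h4, dz_const_smul _ (h3 I)]
  simp only [dz, h2]
  rw [hs.eq 1 I]
  simp only [smul_eq_mul]
  linear_combination (-(1/4) * fderiv ℝ (fderiv ℝ f) z I I) * Complex.I_sq

theorem re_dz_dbar_nonpos_of_isLocalMax {f : ℂ → ℂ} {z : ℂ} (hf : ContDiffAt ℝ 2 f z)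
    (h : IsLocalMax (fun w => (f w).re) z) : (dz (dbar f) z).re ≤ 0 := by
  have hre : ∀ {k : ℂ → ℂ} {w : ℂ} (v : ℂ), DifferentiableAt ℝ k w →
      fderiv ℝ (fun w => (k w).re) w v = (fderiv ℝ k w v).re := by
    intro k w v hk
    have : HasFDerivAt (fun w => (k w).re) (Complex.reCLM ∘L fderiv ℝ k w) w :=
      Complex.reCLM.hasFDerivAt.comp w hk.hasFDerivAt
    rw [this.fderiv]; rfl
  have hg : ContDiffAt ℝ 2 (fun w => (f w).re) z := Complex.reCLM.contDiff.contDiffAt.comp z hf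
  have hd1 : ∀ᶠ w in 𝓝 z, DifferentiableAt ℝ f w := by
    filter_upwards [hf.eventually (by simp)] with w hw using hw.differentiableAt (by norm_num)
  have hd : DifferentiableAt ℝ (fderiv ℝ f) z :=
    (hf.fderiv_right (m := 1) (by norm_num)).differentiableAt (by norm_num)
  have key : ∀ v : ℂ, (fderiv ℝ (fun w => fderiv ℝ f w v) z v).re ≤ 0 := by
    intro v
    have h1 := fderiv_fderiv_nonpos_of_isLocalMax hg h v
    have h2 : (fun w => fderiv ℝ (fun w => (f w).re) w v) =ᶠ[𝓝 z] fun w => (fderiv ℝ f w v).re := by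
      filter_upwards [hd1] with w hw using hre v hw
    rw [h2.fderiv_eq, hre v (hd.clm_apply (differentiableAt_const v))] at h1
    exact h1
  rw [dz_dbar_eq_fderiv hf]
  have e : (1 / 4 : ℂ) = ((1 / 4 : ℝ) : ℂ) := by norm_num
  rw [e, Complex.re_ofReal_mul, Complex.add_re]
  linarith [key 1, key I]

theorem dz_dbar_normSq (z : ℂ) : dz (dbar fun w => w * starRingEnd ℂ w) z = 1 := by
  have hid : ∀ w : ℂ, DifferentiableAt ℝ (fun w : ℂ => w) w := fun w => differentiableAt_id
  have hc : ∀ w : ℂ, DifferentiableAt ℝ (fun w : ℂ => starRingEnd ℂ w) w := fun w =>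
    Complex.conjCLE.differentiableAt
  have : (dbar fun w => w * starRingEnd ℂ w) = fun w => w := by
    funext w
    rw [dbar_mul (hid w) (hc w), dbar_id', dbar_conj (hid w), dz_id']; simp
  rw [this, dz_id']

theorem re_le_of_subharmonic {f : ℂ → ℂ} (hc : ContinuousOn f (closedBall 0 1))
    (hs : ∀ z ∈ ball (0 : ℂ) 1, ContDiffAt ℝ 2 f z)
    (hL : ∀ z ∈ ball (0 : ℂ) 1, 0 ≤ (dz (dbar f) z).re) {M : ℝ}
    (hM : ∀ z ∈ sphere (0 : ℂ) 1, (f z).re ≤ M) : ∀ z ∈ ball (0 : ℂ) 1, (f z).re ≤ M := by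
  intro z hz
  refine le_of_forall_pos_le_add fun ε hε => ?_
  set q : ℂ → ℂ := fun w => w * starRingEnd ℂ w with hq
  set g : ℂ → ℂ := fun w => f w + (ε : ℂ) * q w with hg
  have hqs : ContDiff ℝ 2 q := contDiff_id.mul Complex.conjCLE.contDiff
  have hqre : ∀ w, ((ε : ℂ) * q w).re = ε * ‖w‖ ^ 2 := by
    intro w
    rw [Complex.re_ofReal_mul, hq]
    simp only [Complex.mul_conj, Complex.ofReal_re, Complex.normSq_eq_norm_sq]
  have hgc : ContinuousOn g (closedBall 0 1) :=
    hc.add (continuousOn_const.mul hqs.continuous.continuousOn)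
  obtain ⟨x, hx, hmax⟩ := (isCompact_closedBall (0 : ℂ) 1).exists_isMaxOn
    ⟨0, by simp⟩ (Complex.continuous_re.comp_continuousOn hgc)
  have hxs : x ∈ sphere (0 : ℂ) 1 := by
    by_contra hns
    have hxb : x ∈ ball (0 : ℂ) 1 := by
      simp only [mem_closedBall, mem_sphere, mem_ball] at *
      exact lt_of_le_of_ne hx hns
    have hloc : IsLocalMax (fun w => (g w).re) x :=
      hmax.isLocalMax (Filter.mem_of_superset (isOpen_ball.mem_nhds hxb) ball_subset_closedBall)
    have hgs : ContDiffAt ℝ 2 g x := (hs x hxb).add (contDiffAt_const.mul hqs.contDiffAt)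
    have h1 := re_dz_dbar_nonpos_of_isLocalMax hgs hloc
    have hd : dbar g =ᶠ[𝓝 x] fun w => dbar f w + (ε : ℂ) * dbar q w := by
      filter_upwards [isOpen_ball.mem_nhds hxb] with w hw
      have hqd : DifferentiableAt ℝ q w := hqs.contDiffAt.differentiableAt (by norm_num)
      rw [hg, dbar_add ((hs w hw).differentiableAt (by norm_num)) (hqd.const_mul _),
        dbar_const_mul _ hqd]
    have hdf : DifferentiableAt ℝ (dbar f) x := (hs x hxb).differentiableAt_dbar
    have hdq : DifferentiableAt ℝ (dbar q) x := hqs.contDiffAt.differentiableAt_dbar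
    rw [hd.dz_eq, dz_add hdf (hdq.const_mul _), dz_const_mul _ hdq, dz_dbar_normSq] at h1
    have h2 := hL x hxb
    simp at h1
    linarith
  have h1 : (g z).re ≤ (g x).re := hmax (ball_subset_closedBall hz)
  simp only [hg, Complex.add_re, hqre] at h1
  have h2 := hM x hxs
  have h3 : ‖x‖ = 1 := by simpa using hxs
  rw [h3] at h1
  nlinarith [sq_nonneg ‖z‖]

end MaximumPrinciple

section Poisson

open MeasureTheory AddCircle

theorem norm_fourier_one (t : UnitAddCircle) : ‖fourier 1 t‖ = 1 := by
  rw [fourier_one]; exact Circle.norm_coe _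

theorem exists_fourier_one_eq {z : ℂ} (hz : ‖z‖ = 1) : ∃ t : UnitAddCircle, fourier 1 t = z := by
  obtain ⟨t, ht⟩ := (AddCircle.homeomorphCircle (T := 1) one_ne_zero).surjective
    ⟨z, by simpa [Submonoid.unitSphere] using hz⟩
  refine ⟨t, ?_⟩
  rw [AddCircle.homeomorphCircle_apply] at ht
  rw [fourier_one, ht]

theorem fourier_natCast (n : ℕ) (t : UnitAddCircle) : fourier (n : ℤ) t = (fourier 1 t) ^ n := by
  rw [fourier_apply, fourier_one]
  induction n with
  | zero => simp
  | succ k ih =>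
    rw [pow_succ, ← ih]
    push_cast
    rw [add_zsmul, one_zsmul, AddCircle.toCircle_add]
    simp

/-- Integration of a continuous function on the circle against a continuous density. -/
def circlePairing (v : C(UnitAddCircle, ℂ)) : C(UnitAddCircle, ℂ) →L[ℂ] ℂ :=
  LinearMap.mkContinuous
    { toFun := fun f => ∫ t, v t * f t ∂haarAddCircle
      map_add' := by
        intro f g
        have hi : ∀ h : C(UnitAddCircle, ℂ), Integrable (fun t => v t * h t) haarAddCircle :=
          fun h => (v * h).continuous.integrable_of_hasCompactSupport
            (HasCompactSupport.of_compactSpace _)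
        rw [← integral_add (hi f) (hi g)]
        simp [mul_add]
      map_smul' := by
        intro c f
        simp only [ContinuousMap.smul_apply, smul_eq_mul, RingHom.id_apply]
        rw [← integral_const_mul]
        congr 1; ext t; ring } ‖v‖ (by
      intro f
      have h := norm_integral_le_of_norm_le_const (μ := haarAddCircle (T := 1))
        (f := fun t => v t * f t) (C := ‖v‖ * ‖f‖) (Filter.Eventually.of_forall fun t => by
          rw [norm_mul]
          exact mul_le_mul (v.norm_coe_le_norm t) (f.norm_coe_le_norm t) (norm_nonneg _)
            (norm_nonneg _))
      simpa using h)

theorem circlePairing_apply (v f : C(UnitAddCircle, ℂ)) :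
    circlePairing v f = ∫ t, v t * f t ∂haarAddCircle := rfl

/-- The Szegő kernel `ζ ↦ (1 - z ζ̄)⁻¹` as a continuous function on the circle. -/
def szego (z : ℂ) : C(UnitAddCircle, ℂ) := Ring.inverse (1 - z • fourier (-1))

theorem norm_smul_fourier_lt {z : ℂ} (hz : z ∈ ball (0 : ℂ) 1) :
    ‖z • (fourier (-1) : C(UnitAddCircle, ℂ))‖ < 1 := by
  rw [norm_smul, fourier_norm]; simpa using hz

theorem szego_apply {z : ℂ} (hz : z ∈ ball (0 : ℂ) 1) (t : UnitAddCircle) :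
    szego z t = (1 - z * starRingEnd ℂ (fourier 1 t))⁻¹ := by
  have h1 := Ring.inverse_mul_cancel _ (isUnit_one_sub_of_norm_lt_one (norm_smul_fourier_lt hz))
  have h2 := congrArg (fun f : C(UnitAddCircle, ℂ) => f t) h1
  simp only [ContinuousMap.mul_apply, ContinuousMap.sub_apply, ContinuousMap.one_apply,
    ContinuousMap.smul_apply, smul_eq_mul, fourier_neg] at h2
  exact eq_inv_of_mul_eq_one_left h2

theorem hasSum_szego {z : ℂ} (hz : z ∈ ball (0 : ℂ) 1) :
    HasSum (fun k : ℕ => z ^ k • (fourier (-(k : ℤ)) : C(UnitAddCircle, ℂ))) (szego z) := by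
  have h := hasSum_geom_series_inverse _ (norm_smul_fourier_lt hz)
  have e : (fun k : ℕ => (z • (fourier (-1) : C(UnitAddCircle, ℂ))) ^ k) =
      fun k : ℕ => z ^ k • (fourier (-(k : ℤ)) : C(UnitAddCircle, ℂ)) := by
    ext k t
    simp only [ContinuousMap.smul_apply, ContinuousMap.pow_apply, smul_eq_mul, mul_pow, fourier_neg,
      ← map_pow, fourier_natCast]
  rw [e] at h
  exact h

theorem differentiableOn_clm_szego (ℓ : C(UnitAddCircle, ℂ) →L[ℂ] ℂ) :
    DifferentiableOn ℂ (fun z => ℓ (szego z)) (ball 0 1) := by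
  intro z hz
  refine DifferentiableAt.differentiableWithinAt ?_
  refine ℓ.differentiableAt.comp z ?_
  have h1 : DifferentiableAt ℂ
      (fun z : ℂ => (1 : C(UnitAddCircle, ℂ)) - z • fourier (-1)) z :=
    (differentiableAt_const _).sub (differentiableAt_id.smul_const _)
  exact (differentiableAt_inverse
    (isUnit_one_sub_of_norm_lt_one (norm_smul_fourier_lt hz))).comp z h1

/-- The Poisson kernel as a continuous function on the circle. -/
def poissonCircle (z : ℂ) : C(UnitAddCircle, ℂ) := szego z + star (szego z) - 1

/-- The Poisson kernel as a real function. -/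
def poissonReal (z : ℂ) (t : UnitAddCircle) : ℝ :=
  (1 - ‖z‖ ^ 2) / ‖1 - z * starRingEnd ℂ (fourier 1 t)‖ ^ 2

theorem one_sub_mul_conj_ne_zero {z : ℂ} (hz : z ∈ ball (0 : ℂ) 1) (t : UnitAddCircle) :
    1 - z * starRingEnd ℂ (fourier 1 t) ≠ 0 := by
  intro h
  have h2 : ‖z * starRingEnd ℂ (fourier 1 t)‖ = 1 := by
    rw [← sub_eq_zero.mp h]; simp
  rw [norm_mul, RCLike.norm_conj, norm_fourier_one, mul_one] at h2
  simp [h2] at hz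

theorem poissonCircle_apply {z : ℂ} (hz : z ∈ ball (0 : ℂ) 1) (t : UnitAddCircle) :
    poissonCircle z t = (poissonReal z t : ℂ) := by
  have h0 := one_sub_mul_conj_ne_zero hz t
  have hζ : fourier 1 t * starRingEnd ℂ (fourier 1 t) = 1 := by
    rw [Complex.mul_conj, Complex.normSq_eq_norm_sq, norm_fourier_one]; simp
  have h1 : starRingEnd ℂ (1 - z * starRingEnd ℂ (fourier 1 t)) ≠ 0 := by
    simpa only [ne_eq, map_eq_zero] using h0
  simp only [poissonCircle, ContinuousMap.sub_apply, ContinuousMap.add_apply,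
    ContinuousMap.star_apply, ContinuousMap.one_apply, szego_apply hz, poissonReal]
  push_cast
  rw [← Complex.ofReal_pow, ← Complex.ofReal_pow, ← Complex.normSq_eq_norm_sq,
    ← Complex.normSq_eq_norm_sq, ← Complex.mul_conj, ← Complex.mul_conj]
  rw [RCLike.star_def, map_inv₀]
  rw [map_sub, map_one, map_mul, Complex.conj_conj] at h1 ⊢
  field_simp
  linear_combination (-z * starRingEnd ℂ z) * hζ

theorem poissonReal_nonneg {z : ℂ} (hz : z ∈ ball (0 : ℂ) 1) (t : UnitAddCircle) :
    0 ≤ poissonReal z t := by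
  have : ‖z‖ < 1 := by simpa using hz
  unfold poissonReal
  have h : 0 ≤ 1 - ‖z‖ ^ 2 := by nlinarith [norm_nonneg z]
  positivity

theorem continuous_poissonReal {z : ℂ} (hz : z ∈ ball (0 : ℂ) 1) :
    Continuous (poissonReal z) := by
  unfold poissonReal
  refine continuous_const.div ?_ fun t => ?_
  · have : Continuous fun t : UnitAddCircle => fourier 1 t := (fourier 1).continuous
    fun_prop
  · have := one_sub_mul_conj_ne_zero hz t
    positivity

theorem integral_fourier (n : ℤ) :
    ∫ t : UnitAddCircle, fourier n t ∂haarAddCircle = if n = 0 then 1 else 0 := by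
  have h := fourierCoeff_fourier (T := 1) n
  have h2 := congrFun h 0
  simp only [fourierCoeff, neg_zero, fourier_zero, one_smul, Pi.single_apply] at h2
  rw [h2]
  simp [eq_comm]

theorem clm_poissonCircle {ℓ : C(UnitAddCircle, ℂ) →L[ℂ] ℂ}
    (h : ∀ n : ℕ, ℓ (fourier ((n : ℤ) + 1)) = 0) {z : ℂ} (hz : z ∈ ball (0 : ℂ) 1) :
    ℓ (poissonCircle z) = ℓ (szego z) := by
  have h1 : HasSum (fun k : ℕ => (starRingEnd ℂ z) ^ k • (fourier (k : ℤ) : C(UnitAddCircle, ℂ)))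
      (star (szego z)) := by
    have := (hasSum_szego hz).star
    convert this using 2 with k
    ext t
    simp only [ContinuousMap.smul_apply, ContinuousMap.star_apply, fourier_neg, smul_eq_mul,
      RCLike.star_def, map_mul, map_pow, Complex.conj_conj]
  have h2 := h1.mapL ℓ
  have h3 : ℓ (star (szego z)) = ℓ (fourier 0) := by
    rw [h2.tsum_eq.symm, tsum_eq_single 0]
    · simp
    · intro k hk
      obtain ⟨m, rfl⟩ := Nat.exists_eq_succ_of_ne_zero hk
      have := h m
      simp only [Nat.succ_eq_add_one, Nat.cast_add, Nat.cast_one, map_smul, this, smul_zero]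
  have h4 : (1 : C(UnitAddCircle, ℂ)) = fourier 0 := by ext t; simp
  rw [poissonCircle, map_sub, map_add, h3, h4]
  ring

theorem integral_poissonReal_mul_pow {z : ℂ} (hz : z ∈ ball (0 : ℂ) 1) (n : ℕ) :
    ∫ t, (poissonReal z t : ℂ) * (fourier 1 t) ^ n ∂haarAddCircle = z ^ n := by
  have h0 : ∀ k m : ℤ, circlePairing (fourier k) (fourier m) = if k + m = 0 then 1 else 0 := by
    intro k m
    rw [circlePairing_apply, ← integral_fourier]
    congr 1; ext t; rw [fourier_add]
  have h := clm_poissonCircle (ℓ := circlePairing (fourier (n : ℤ))) (fun m => by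
    rw [h0]; split_ifs with h
    · omega
    · rfl) hz
  have h2 : circlePairing (fourier (n : ℤ)) (szego z) = z ^ n := by
    have h3 := (hasSum_szego hz).mapL (circlePairing (fourier (n : ℤ)))
    rw [← h3.tsum_eq, tsum_eq_single n]
    · rw [map_smul, h0]; simp
    · intro k hk
      rw [map_smul, h0, if_neg (by omega), smul_zero]
  rw [← h2, ← h, circlePairing_apply]
  congr 1; ext t
  rw [poissonCircle_apply hz, fourier_natCast, mul_comm]

theorem integral_poissonReal {z : ℂ} (hz : z ∈ ball (0 : ℂ) 1) :
    ∫ t, poissonReal z t ∂haarAddCircle = 1 := by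
  have h := integral_poissonReal_mul_pow hz 0
  simp only [pow_zero, mul_one] at h
  rw [integral_complex_ofReal] at h
  exact_mod_cast h

theorem integrable_circle {E : Type*} [NormedAddCommGroup E] {f : UnitAddCircle → E}
    (hf : Continuous f) : Integrable f haarAddCircle :=
  hf.integrable_of_hasCompactSupport (HasCompactSupport.of_compactSpace _)

theorem integral_poissonReal_mul_polynomial {z : ℂ} (hz : z ∈ ball (0 : ℂ) 1)
    (p : Polynomial ℂ) :
    ∫ t, poissonReal z t * (p.eval (fourier 1 t)).re ∂haarAddCircle = (p.eval z).re := by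
  have hc : Continuous fun t : UnitAddCircle => fourier 1 t := (fourier 1).continuous
  have hp := continuous_poissonReal hz
  have h : ∫ t, (poissonReal z t : ℂ) * p.eval (fourier 1 t) ∂haarAddCircle = p.eval z := by
    simp only [Polynomial.eval_eq_sum_range, Finset.mul_sum]
    rw [integral_finsetSum]
    · refine Finset.sum_congr rfl fun i _ => ?_
      rw [← integral_poissonReal_mul_pow hz i, ← integral_const_mul]
      congr 1; ext t; ring
    · intro i _
      exact integrable_circle (by fun_prop)
  have hi : Integrable (fun t => (poissonReal z t : ℂ) * p.eval (fourier 1 t)) haarAddCircle :=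
    integrable_circle ((by fun_prop : Continuous fun t => (poissonReal z t : ℂ)).mul
      (p.continuous.comp hc))
  rw [← h]
  have := integral_re hi
  simp only [RCLike.re_to_complex, Complex.re_ofReal_mul] at this
  exact this

theorem exists_polynomial_re_close {u : ℂ → ℝ} (hu : ContinuousOn u (sphere 0 1)) {ε : ℝ}
    (hε : 0 < ε) : ∃ p : Polynomial ℂ, ∀ z ∈ sphere (0 : ℂ) 1, |u z - (p.eval z).re| < ε := by
  have hc : Continuous fun t : UnitAddCircle => fourier 1 t := (fourier 1).continuous
  let U : C(UnitAddCircle, ℂ) := ⟨fun t => (u (fourier 1 t) : ℂ), by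
    refine Complex.continuous_ofReal.comp ?_
    exact hu.comp_continuous hc fun t => by simpa using norm_fourier_one t⟩
  have hU : U ∈ (Submodule.span ℂ (range <| fourier (T := 1))).topologicalClosure := by
    rw [span_fourier_closure_eq_top]; trivial
  obtain ⟨g, hg, hUg⟩ := Metric.mem_closure_iff.mp hU ε hε
  have key : ∃ p q : Polynomial ℂ, ∀ t : UnitAddCircle,
      g t = p.eval (fourier 1 t) + starRingEnd ℂ (q.eval (fourier 1 t)) := by
    clear hUg
    induction hg using Submodule.span_induction with
    | mem x hx =>
      obtain ⟨n, rfl⟩ := hx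
      obtain ⟨m, rfl | rfl⟩ := n.eq_nat_or_neg
      · exact ⟨Polynomial.X ^ m, 0, fun t => by rw [fourier_natCast]; simp⟩
      · exact ⟨0, Polynomial.X ^ m, fun t => by
          rw [fourier_neg, fourier_natCast]; simp⟩
    | zero => exact ⟨0, 0, fun t => by simp⟩
    | add x y _ _ hx hy =>
      obtain ⟨p, q, h⟩ := hx
      obtain ⟨p', q', h'⟩ := hy
      exact ⟨p + p', q + q', fun t => by simp [h, h']; ring⟩
    | smul c x _ hx =>
      obtain ⟨p, q, h⟩ := hx
      exact ⟨Polynomial.C c * p, Polynomial.C (starRingEnd ℂ c) * q, fun t => by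
        simp [h]; ring⟩
  obtain ⟨p, q, hpq⟩ := key
  refine ⟨p + q, fun z hz => ?_⟩
  obtain ⟨t, rfl⟩ := exists_fourier_one_eq (by simpa using hz : ‖z‖ = 1)
  have h1 : ‖U t - g t‖ < ε := lt_of_le_of_lt ((U - g).norm_coe_le_norm t) (by
    rwa [dist_eq_norm] at hUg)
  have h2 : (U t - g t).re = u (fourier 1 t) - ((p + q).eval (fourier 1 t)).re := by
    rw [hpq]; simp [U]
  rw [← h2]
  exact lt_of_le_of_lt (Complex.abs_re_le_norm _) h1

theorem re_le_integral_poisson {f : ℂ → ℂ} (hc : ContinuousOn f (closedBall 0 1))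
    (hs : ∀ z ∈ ball (0 : ℂ) 1, ContDiffAt ℝ 2 f z)
    (hL : ∀ z ∈ ball (0 : ℂ) 1, 0 ≤ (dz (dbar f) z).re) {z : ℂ} (hz : z ∈ ball (0 : ℂ) 1) :
    (f z).re ≤ ∫ t, poissonReal z t * (f (fourier 1 t)).re ∂haarAddCircle := by
  refine le_of_forall_pos_le_add fun ε hε => ?_
  have hcs : ContinuousOn (fun z => (f z).re) (sphere 0 1) :=
    Complex.continuous_re.comp_continuousOn (hc.mono sphere_subset_closedBall)
  obtain ⟨p, hp⟩ := exists_polynomial_re_close hcs (half_pos hε)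
  have hpd : ∀ w, DifferentiableAt ℂ (fun z => p.eval z) w := fun w => p.differentiable w
  have hps : ContDiff ℝ 2 fun z => p.eval z := p.contDiff_aeval (𝕜 := ℂ) 2 |>.restrict_scalars ℝ
  have h1 := re_le_of_subharmonic (f := fun z => f z - p.eval z) (M := ε / 2)
    (hc.sub p.continuous.continuousOn)
    (fun z hz => (hs z hz).sub hps.contDiffAt) (fun w hw => by
      have : (dbar fun z => f z - p.eval z) =ᶠ[𝓝 w] dbar f := by
        filter_upwards [isOpen_ball.mem_nhds hw] with x hx
        rw [dbar_sub ((hs x hx).differentiableAt (by norm_num))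
          (hps.contDiffAt.differentiableAt (by norm_num)), dbar_eq_zero (hpd x), sub_zero]
      rw [this.dz_eq]
      exact hL w hw) (fun w hw => by
      have := (abs_lt.mp (hp w hw)).2
      simpa using this.le) z hz
  have hcont : Continuous fun t : UnitAddCircle => (f (fourier 1 t)).re :=
    hcs.comp_continuous (fourier 1).continuous fun t => by simpa using norm_fourier_one t
  have hcp : Continuous fun t : UnitAddCircle => (p.eval (fourier 1 t)).re :=
    Complex.continuous_re.comp (p.continuous.comp (fourier 1).continuous)
  have hpk := continuous_poissonReal hz
  have h2 : (p.eval z).re ≤ (∫ t, poissonReal z t * (f (fourier 1 t)).re ∂haarAddCircle) + ε / 2 := by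
    calc (p.eval z).re = ∫ t, poissonReal z t * (p.eval (fourier 1 t)).re ∂haarAddCircle :=
          (integral_poissonReal_mul_polynomial hz p).symm
      _ ≤ ∫ t, (poissonReal z t * (f (fourier 1 t)).re + poissonReal z t * (ε / 2))
            ∂haarAddCircle := by
          refine integral_mono (integrable_circle (hpk.mul hcp))
            (integrable_circle ((hpk.mul hcont).add (hpk.mul continuous_const))) fun t => ?_
          have := (abs_lt.mp (hp (fourier 1 t) (by simpa using norm_fourier_one t))).1
          have h3 := poissonReal_nonneg hz t
          simp only
          nlinarith
      _ = _ := by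
          rw [integral_add (f := fun t => poissonReal z t * (f (fourier 1 t)).re)
            (g := fun t => poissonReal z t * (ε / 2)) (integrable_circle (hpk.mul hcont))
            (integrable_circle (hpk.mul continuous_const)), integral_mul_const,
            integral_poissonReal hz, one_mul]
  simp only [Complex.sub_re] at h1
  linarith

end Poisson

section CauchyTransform

open MeasureTheory

theorem locallyIntegrable_inv_complex : LocallyIntegrable (fun ζ : ℂ => ζ⁻¹) volume := by
  rw [locallyIntegrable_iff]
  intro K hK
  obtain ⟨R, hR⟩ := hK.isBounded.subset_closedBall 0
  refine IntegrableOn.mono_set (t := closedBall 0 R) ?_ hR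
  refine ⟨(by fun_prop : Measurable fun ζ : ℂ => ζ⁻¹).aestronglyMeasurable, ?_⟩
  rw [hasFiniteIntegral_iff_enorm, ← lintegral_indicator measurableSet_closedBall,
    ← Complex.lintegral_comp_polarCoord_symm]
  calc _ ≤ ∫⁻ p in polarCoord.target,
        ((Ioc (0 : ℝ) R) ×ˢ (Ioo (-Real.pi) Real.pi)).indicator (fun _ => (1 : ENNReal)) p := by
        refine setLIntegral_mono' polarCoord.open_target.measurableSet fun p hp => ?_
        rw [polarCoord_target] at hp
        obtain ⟨hp1, hp2⟩ := hp
        have hp1' : 0 < p.1 := hp1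
        by_cases h : p.1 ≤ R
        · have h3 : p ∈ (Ioc (0 : ℝ) R) ×ˢ (Ioo (-Real.pi) Real.pi) := ⟨⟨hp1', h⟩, hp2⟩
          rw [indicator_of_mem h3]
          refine (mul_le_mul_right (indicator_le_self _ _ _) _).trans ?_
          rw [← ofReal_norm, norm_inv, Complex.norm_polarCoord_symm, abs_of_pos hp1',
            ← ENNReal.ofReal_mul hp1'.le, mul_inv_cancel₀ hp1'.ne', ENNReal.ofReal_one]
        · rw [indicator_of_notMem (s := closedBall (0 : ℂ) R)]
          · simp
          · rw [mem_closedBall_zero_iff, Complex.norm_polarCoord_symm, abs_of_pos hp1']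
            exact h
    _ ≤ ∫⁻ p, ((Ioc (0 : ℝ) R) ×ˢ (Ioo (-Real.pi) Real.pi)).indicator
          (fun _ => (1 : ENNReal)) p := setLIntegral_le_lintegral _ _
    _ = volume ((Ioc (0 : ℝ) R) ×ˢ (Ioo (-Real.pi) Real.pi)) := by
        rw [lintegral_indicator (measurableSet_Ioc.prod measurableSet_Ioo)]
        simp
    _ < ⊤ := by
        rw [Measure.volume_eq_prod, Measure.prod_prod]
        simp [ENNReal.mul_lt_top]

theorem integral_dbar_div {h : ℂ → ℂ} (hs : ContDiff ℝ 1 h) (hc : HasCompactSupport h) :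
    ∫ ζ, ζ⁻¹ * dbar h ζ = -(Real.pi : ℂ) * h 0 := by
  set P : ℝ → ℝ → ℂ := fun r θ => r * Complex.exp (θ * I) with hP
  have hPs : ∀ p : ℝ × ℝ, Complex.polarCoord.symm p = P p.1 p.2 := by
    intro p
    rw [Complex.polarCoord_symm_apply, hP]
    simp only
    rw [Complex.exp_mul_I]
    push_cast
    rfl
  have hfc : Continuous (fderiv ℝ h) := hs.continuous_fderiv (by norm_num)
  have hPc : Continuous fun p : ℝ × ℝ => P p.1 p.2 := by
    simp only [hP]; fun_prop
  set A : ℝ × ℝ → ℂ := fun p => fderiv ℝ h (P p.1 p.2) (Complex.exp (p.2 * I)) with hA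
  set B : ℝ × ℝ → ℂ := fun p => fderiv ℝ h (P p.1 p.2) (I * Complex.exp (p.2 * I)) with hB
  have hAc : Continuous A := (hfc.comp hPc).clm_apply (by fun_prop)
  have hBc : Continuous B := (hfc.comp hPc).clm_apply (by fun_prop)
  obtain ⟨R, hR0, hR⟩ : ∃ R : ℝ, 0 < R ∧ ∀ ζ : ℂ, R < ‖ζ‖ → h ζ = 0 ∧ fderiv ℝ h ζ = 0 := by
    obtain ⟨R, hR⟩ := hc.isBounded.subset_closedBall 0
    refine ⟨max R 1, by positivity, fun ζ hζ => ?_⟩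
    have hζ' : ζ ∉ tsupport h := fun hm => by
      have := hR hm
      rw [mem_closedBall_zero_iff] at this
      exact absurd hζ (not_lt.mpr (this.trans (le_max_left _ _)))
    refine ⟨image_eq_zero_of_notMem_tsupport hζ', ?_⟩
    have := (tsupport_fderiv_subset ℝ (f := h))
    exact image_eq_zero_of_notMem_tsupport fun hm => hζ' (this hm)
  have hnP : ∀ r θ : ℝ, ‖P r θ‖ = |r| := by
    intro r θ; simp [hP]
  have hinteg : ∀ C : ℝ × ℝ → ℂ, Continuous C → (∀ p : ℝ × ℝ, R < p.1 → C p = 0) →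
      IntegrableOn C (Ioi (0 : ℝ) ×ˢ Ioo (-Real.pi) Real.pi) (volume.prod volume) := by
    intro C hC hC0
    have h1 : IntegrableOn C (Icc (0 : ℝ) R ×ˢ Icc (-Real.pi) Real.pi) (volume.prod volume) :=
      hC.continuousOn.integrableOn_compact (isCompact_Icc.prod isCompact_Icc)
    refine IntegrableOn.of_forall_sdiff_eq_zero h1
      (measurableSet_Ioi.prod measurableSet_Ioo) fun p hp => hC0 p ?_
    by_contra hle
    exact hp.2 ⟨⟨(mem_Ioi.mp hp.1.1).le, not_lt.mp hle⟩, Ioo_subset_Icc_self hp.1.2⟩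
  have hAi := hinteg A hAc fun p hp => by
    simp only [hA]
    rw [(hR _ (by rw [hnP]; exact hp.trans_le (le_abs_self _))).2]; rfl
  have hBi := hinteg B hBc fun p hp => by
    simp only [hB]
    rw [(hR _ (by rw [hnP]; exact hp.trans_le (le_abs_self _))).2]; rfl
  have hAint : ∫ p in Ioi (0 : ℝ) ×ˢ Ioo (-Real.pi) Real.pi, A p ∂(volume.prod volume) =
      -(2 * Real.pi : ℂ) * h 0 := by
    rw [← setIntegral_prod_swap, setIntegral_prod]
    · have : ∀ θ : ℝ, ∫ r in Ioi (0 : ℝ), A (r, θ) = - h 0 := by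
        intro θ
        have hd : ∀ r : ℝ, HasDerivAt (fun r : ℝ => h (P r θ)) (A (r, θ)) r := by
          intro r
          have h1 : HasDerivAt (fun r : ℝ => P r θ) (Complex.exp (θ * I)) r := by
            simpa [hP] using (Complex.ofRealCLM.hasDerivAt (x := r)).mul_const
              (Complex.exp (θ * I))
          exact ((hs.differentiable (by norm_num) _).hasFDerivAt).comp_hasDerivAt r h1
        have h1 : ContDiff ℝ 1 fun r : ℝ => h (P r θ) := by
          refine hs.comp ?_
          simp only [hP]
          exact Complex.ofRealCLM.contDiff.mul contDiff_const
        have h2 : HasCompactSupport fun r : ℝ => h (P r θ) := by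
          refine HasCompactSupport.intro (isCompact_Icc (a := -R) (b := R)) fun r hr => ?_
          refine (hR _ ?_).1
          rw [hnP]
          by_contra hle
          exact hr (abs_le.mp (not_lt.mp hle))
        have h3 := h2.integral_Ioi_deriv_eq h1 0
        have h4 : deriv (fun r : ℝ => h (P r θ)) = fun r => A (r, θ) := by
          funext r; exact (hd r).deriv
        rw [h4] at h3
        rw [h3]; simp [hP]
      simp only [Prod.swap_prod_mk, this]
      rw [setIntegral_const]
      simp only [measureReal_def, Real.volume_Ioo, sub_neg_eq_add]
      rw [ENNReal.toReal_ofReal (by positivity), Complex.real_smul]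
      push_cast; ring
    · exact hAi.swap
  have hBint : ∫ p in Ioi (0 : ℝ) ×ˢ Ioo (-Real.pi) Real.pi, B p ∂(volume.prod volume) = 0 := by
    rw [setIntegral_prod _ hBi]
    refine setIntegral_eq_zero_of_forall_eq_zero fun r hr => ?_
    have hr0 : (r : ℂ) ≠ 0 := by
      exact_mod_cast (mem_Ioi.mp hr).ne'
    have hd : ∀ θ : ℝ, HasDerivAt (fun θ : ℝ => (r : ℂ)⁻¹ * h (P r θ)) (B (r, θ)) θ := by
      intro θ
      have h1 : HasDerivAt (fun θ : ℝ => P r θ) (r * (Complex.exp (θ * I) * I)) θ := by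
        have : HasDerivAt (fun θ : ℝ => (θ : ℂ) * I) I θ := by
          simpa using (Complex.ofRealCLM.hasDerivAt (x := θ)).mul_const I
        exact (this.cexp).const_mul (r : ℂ)
      have h2 := (((hs.differentiable (by norm_num) (P r θ)).hasFDerivAt).comp_hasDerivAt θ
        h1).const_mul (r : ℂ)⁻¹
      refine h2.congr_deriv ?_
      change _ = fderiv ℝ h (P r θ) (I * Complex.exp (θ * I))
      have : (r : ℂ) * (Complex.exp (θ * I) * I) = r • (I * Complex.exp (θ * I)) := by
        rw [Complex.real_smul]; ring
      rw [this, map_smul, Complex.real_smul, ← mul_assoc, inv_mul_cancel₀ hr0, one_mul]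
    rw [← integral_Ioc_eq_integral_Ioo, ← intervalIntegral.integral_of_le
      (by linarith [Real.pi_pos]), intervalIntegral.integral_eq_sub_of_hasDerivAt
        (fun θ _ => hd θ)
        (((hBc.comp (by fun_prop : Continuous fun θ : ℝ => (r, θ)))).intervalIntegrable _ _)]
    have : P r Real.pi = P r (-Real.pi) := by
      simp only [hP, Complex.ofReal_neg]
      rw [Complex.exp_pi_mul_I, neg_mul, Complex.exp_neg, Complex.exp_pi_mul_I]
      norm_num
    rw [this, sub_self]
  rw [← Complex.integral_comp_polarCoord_symm, polarCoord_target]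
  have e : ∀ p ∈ Ioi (0 : ℝ) ×ˢ Ioo (-Real.pi) Real.pi,
      p.1 • ((Complex.polarCoord.symm p)⁻¹ * dbar h (Complex.polarCoord.symm p)) =
        (1 / 2 : ℂ) * (A p + I * B p) := by
    intro p hp
    have hr0 : (p.1 : ℂ) ≠ 0 := by exact_mod_cast (mem_Ioi.mp hp.1).ne'
    rw [hPs]
    simp only [hA, hB, fderiv_eq_dz_dbar, smul_eq_mul, hP, Complex.real_smul]
    have hcc : Complex.exp (p.2 * I) * starRingEnd ℂ (Complex.exp (p.2 * I)) = 1 := by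
      rw [Complex.mul_conj, Complex.normSq_eq_norm_sq, Complex.norm_exp_ofReal_mul_I]; simp
    have he : (Complex.exp (p.2 * I))⁻¹ = starRingEnd ℂ (Complex.exp (p.2 * I)) :=
      inv_eq_of_mul_eq_one_right hcc
    rw [mul_inv, he]
    simp only [map_mul, Complex.conj_I]
    field_simp
    rw [Complex.I_sq]
    ring
  rw [setIntegral_congr_fun (measurableSet_Ioi.prod measurableSet_Ioo) e,
    Measure.volume_eq_prod, integral_const_mul, integral_add hAi (hBi.const_mul I),
    integral_const_mul, hAint, hBint]
  ring

theorem exists_dbar_eq {G : ℂ → ℂ} (hG : ContDiff ℝ (⊤ : ℕ∞) G) :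
    ∃ v : ℂ → ℂ, ContDiff ℝ (⊤ : ℕ∞) v ∧ ∀ z ∈ ball (0 : ℂ) 2, dbar v z = G z := by
  let χ : ContDiffBump (0 : ℂ) := ⟨2, 3, by norm_num, by norm_num⟩
  set g : ℂ → ℂ := fun z => (χ z : ℂ) * G z with hg
  have hgs : ContDiff ℝ (⊤ : ℕ∞) g :=
    (Complex.ofRealCLM.contDiff.comp χ.contDiff).mul hG
  have hgc : HasCompactSupport g := by
    have : HasCompactSupport fun z => (χ z : ℂ) := χ.hasCompactSupport.comp_left (g := fun x : ℝ => (x : ℂ)) rfl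
    exact this.mul_right
  have hgz : ∀ z ∈ ball (0 : ℂ) 2, g z = G z := by
    intro z hz
    rw [hg]
    simp only [χ.one_of_mem_closedBall (ball_subset_closedBall hz), Complex.ofReal_one, one_mul]
  set L := ContinuousLinearMap.mul ℝ ℂ with hL
  set k : ℂ → ℂ := fun ζ => ζ⁻¹ with hk
  refine ⟨fun z => (Real.pi : ℂ)⁻¹ * (convolution k g L volume) z,
    contDiff_const.mul (hgc.contDiff_convolution_right L locallyIntegrable_inv_complex hgs), ?_⟩
  intro z hz
  have hg1 : ContDiff ℝ 1 g := hgs.of_le (by norm_cast)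
  have hd := hgc.hasFDerivAt_convolution_right L locallyIntegrable_inv_complex hg1 z
  rw [dbar_const_mul _ hd.differentiableAt]
  have hpi : (Real.pi : ℂ) ≠ 0 := by exact_mod_cast Real.pi_ne_zero
  have key : dbar (convolution k g L volume) z = Real.pi * g z := by
    have hv : ∀ v : ℂ, fderiv ℝ (convolution k g L volume) z v =
        ∫ ζ, ζ⁻¹ * fderiv ℝ g (z - ζ) v := by
      intro v
      rw [hd.fderiv, convolution_precompR_apply L locallyIntegrable_inv_complex (hgc.fderiv ℝ)
        (hg1.continuous_fderiv one_ne_zero)]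
      rfl
    have hi : ∀ v : ℂ, Integrable fun ζ => ζ⁻¹ * fderiv ℝ g (z - ζ) v := by
      intro v
      have h1 : HasCompactSupport fun x => fderiv ℝ g x v := by
        exact (hgc.fderiv ℝ).comp_left (g := fun T : ℂ →L[ℝ] ℂ => T v) rfl
      have h2 : Continuous fun x => fderiv ℝ g x v :=
        (hg1.continuous_fderiv one_ne_zero).clm_apply continuous_const
      exact (h1.convolutionExists_right L locallyIntegrable_inv_complex h2 z)
    have h0 := integral_dbar_div (h := fun ζ => g (z - ζ))
      (hg1.comp (contDiff_const.sub contDiff_id))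
      (hgc.comp_homeomorph (Homeomorph.subLeft z))
    have hdg : ∀ ζ, dbar (fun ζ => g (z - ζ)) ζ = - dbar g (z - ζ) := by
      intro ζ
      have : HasFDerivAt (fun ζ => g (z - ζ)) ((fderiv ℝ g (z - ζ)) ∘L
          (-ContinuousLinearMap.id ℝ ℂ)) ζ := by
        refine ((hg1.differentiable one_ne_zero (z - ζ)).hasFDerivAt).comp ζ ?_
        exact (hasFDerivAt_id ζ).const_sub z
      rw [dbar, this.fderiv, dbar]
      simp
      ring
    simp only [hdg, sub_zero, mul_neg, integral_neg] at h0
    have h1 : ∫ ζ, ζ⁻¹ * dbar g (z - ζ) = Real.pi * g z := by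
      linear_combination -h0
    rw [← h1, dbar, hv, hv]
    simp only [smul_eq_mul]
    rw [← integral_const_mul, ← integral_add (hi 1) ((hi I).const_mul I), ← integral_const_mul]
    congr 1; ext ζ
    rw [dbar]
    simp only [smul_eq_mul]
    ring
  rw [key, ← hgz z hz, ← mul_assoc, inv_mul_cancel₀ hpi, one_mul]

end CauchyTransform

section RealFunctions

theorem ContDiffAt.ofReal_comp {N : ℂ → ℝ} {z : ℂ} {n : WithTop ℕ∞} (hN : ContDiffAt ℝ n N z) :
    ContDiffAt ℝ n (fun w => (N w : ℂ)) z :=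
  Complex.ofRealCLM.contDiff.contDiffAt.comp z hN

theorem DifferentiableAt.ofReal_comp' {N : ℂ → ℝ} {z : ℂ} (hN : DifferentiableAt ℝ N z) :
    DifferentiableAt ℝ (fun w => (N w : ℂ)) z :=
  Complex.ofRealCLM.differentiableAt.comp z hN

theorem fderiv_ofReal {N : ℂ → ℝ} {z : ℂ} (hN : DifferentiableAt ℝ N z) (v : ℂ) :
    fderiv ℝ (fun w => (N w : ℂ)) z v = (fderiv ℝ N z v : ℂ) := by
  have : HasFDerivAt (fun w => (N w : ℂ)) (Complex.ofRealCLM ∘L fderiv ℝ N z) z :=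
    Complex.ofRealCLM.hasFDerivAt.comp z hN.hasFDerivAt
  rw [this.fderiv]; rfl

theorem dbar_ofReal {N : ℂ → ℝ} {z : ℂ} (hN : DifferentiableAt ℝ N z) :
    dbar (fun w => (N w : ℂ)) z = starRingEnd ℂ (dz (fun w => (N w : ℂ)) z) := by
  have h := dbar_conj hN.ofReal_comp'
  simpa only [Complex.conj_ofReal] using h

theorem dz_comp_real {N : ℂ → ℝ} {φ : ℝ → ℝ} {z : ℂ} (hN : DifferentiableAt ℝ N z)
    (hφ : DifferentiableAt ℝ φ (N z)) :
    dz (fun w => (φ (N w) : ℂ)) z = ((deriv φ (N z) : ℝ) : ℂ) * dz (fun w => (N w : ℂ)) z := by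
  have h1 : HasFDerivAt (fun w => φ (N w)) (deriv φ (N z) • fderiv ℝ N z) z :=
    hφ.hasDerivAt.comp_hasFDerivAt z hN.hasFDerivAt
  simp only [dz, fderiv_ofReal h1.differentiableAt, fderiv_ofReal hN, h1.fderiv,
    _root_.smul_apply, smul_eq_mul]
  push_cast; ring

theorem dbar_comp_real {N : ℂ → ℝ} {φ : ℝ → ℝ} {z : ℂ} (hN : DifferentiableAt ℝ N z)
    (hφ : DifferentiableAt ℝ φ (N z)) :
    dbar (fun w => (φ (N w) : ℂ)) z = ((deriv φ (N z) : ℝ) : ℂ) * dbar (fun w => (N w : ℂ)) z := by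
  have h1 : HasFDerivAt (fun w => φ (N w)) (deriv φ (N z) • fderiv ℝ N z) z :=
    hφ.hasDerivAt.comp_hasFDerivAt z hN.hasFDerivAt
  simp only [dbar, fderiv_ofReal h1.differentiableAt, fderiv_ofReal hN, h1.fderiv,
    _root_.smul_apply, smul_eq_mul]
  push_cast; ring

theorem dz_dbar_comp_real {N : ℂ → ℝ} {φ : ℝ → ℝ} {z : ℂ} (hN : ContDiffAt ℝ 2 N z)
    (hφ : ContDiffAt ℝ 2 φ (N z)) :
    dz (dbar fun w => (φ (N w) : ℂ)) z =
      ((deriv (deriv φ) (N z) : ℝ) : ℂ) * (dz (fun w => (N w : ℂ)) z * dbar (fun w => (N w : ℂ)) z) +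
        ((deriv φ (N z) : ℝ) : ℂ) * dz (dbar fun w => (N w : ℂ)) z := by
  have hd : DifferentiableAt ℝ N z := hN.differentiableAt (by norm_num)
  have h1 : (dbar fun w => (φ (N w) : ℂ)) =ᶠ[𝓝 z]
      fun w => ((deriv φ (N w) : ℝ) : ℂ) * dbar (fun w => (N w : ℂ)) w := by
    filter_upwards [hN.eventually (by simp),
      hN.continuousAt.eventually (hφ.eventually (by simp))] with w hw hw'
    exact dbar_comp_real (hw.differentiableAt (by norm_num)) (hw'.differentiableAt (by norm_num))
  have hφ' : DifferentiableAt ℝ (deriv φ) (N z) := by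
    have : DifferentiableAt ℝ (fderiv ℝ φ) (N z) :=
      (hφ.fderiv_right (m := 1) (by norm_num)).differentiableAt (by norm_num)
    exact this.clm_apply (differentiableAt_const 1)
  have h2 : DifferentiableAt ℝ (fun w => ((deriv φ (N w) : ℝ) : ℂ)) z :=
    DifferentiableAt.ofReal_comp' (hφ'.comp z hd)
  rw [h1.dz_eq, dz_mul h2 hN.ofReal_comp.differentiableAt_dbar, dz_comp_real hd hφ']
  ring

theorem dz_sqrt {N : ℂ → ℝ} {z : ℂ} (hN : DifferentiableAt ℝ N z) (h0 : 0 < N z) :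
    dz (fun w => (√(N w) : ℂ)) z = dz (fun w => (N w : ℂ)) z / (2 * √(N z) : ℝ) := by
  rw [dz_comp_real hN (Real.hasDerivAt_sqrt h0.ne').differentiableAt,
    (Real.hasDerivAt_sqrt h0.ne').deriv]
  push_cast; ring

theorem dz_dbar_sqrt {N : ℂ → ℝ} {z : ℂ} (hN : ContDiffAt ℝ 2 N z) (h0 : 0 < N z) :
    (dz (dbar fun w => (√(N w) : ℂ)) z).re =
      ((dz (dbar fun w => (N w : ℂ)) z).re - ‖dz (fun w => (N w : ℂ)) z‖ ^ 2 / (2 * N z)) /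
        (2 * √(N z)) := by
  have hs : 0 < √(N z) := Real.sqrt_pos.mpr h0
  have hsq : √(N z) ^ 2 = N z := Real.sq_sqrt h0.le
  have h1 : deriv Real.sqrt =ᶠ[𝓝 (N z)] fun x => (1 / 2) * (√x)⁻¹ := by
    filter_upwards [lt_mem_nhds h0] with x hx
    rw [(Real.hasDerivAt_sqrt hx.ne').deriv]
    field_simp
  have h2 : deriv (deriv Real.sqrt) (N z) = -1 / (4 * N z * √(N z)) := by
    rw [h1.deriv_eq]
    have := (((Real.hasDerivAt_sqrt h0.ne').inv hs.ne').const_mul (1 / 2 : ℝ)).deriv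
    refine this.trans ?_
    rw [hsq]; field_simp; norm_num
  rw [dz_dbar_comp_real hN (Real.contDiffAt_sqrt h0.ne'), h2,
    (Real.hasDerivAt_sqrt h0.ne').deriv, dbar_ofReal (hN.differentiableAt (by norm_num)),
    Complex.mul_conj, Complex.normSq_eq_norm_sq, Complex.add_re, ← Complex.ofReal_mul,
    Complex.ofReal_re, Complex.re_ofReal_mul]
  field_simp
  ring

theorem dz_dbar_log {N : ℂ → ℝ} {z : ℂ} (hN : ContDiffAt ℝ 2 N z) (h0 : 0 < N z) :
    dz (dbar fun w => (Real.log (N w) : ℂ)) z =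
      dz (dbar fun w => (N w : ℂ)) z / N z -
        dz (fun w => (N w : ℂ)) z * dbar (fun w => (N w : ℂ)) z / (N z : ℂ) ^ 2 := by
  have h1 : deriv Real.log = fun x => x⁻¹ := Real.deriv_log'
  rw [dz_dbar_comp_real hN (Real.contDiffAt_log.mpr h0.ne'), h1]
  have h2 : deriv (fun x : ℝ => x⁻¹) (N z) = -(N z ^ 2)⁻¹ := deriv_inv
  rw [h2]
  have : (N z : ℂ) ≠ 0 := by exact_mod_cast h0.ne'
  push_cast
  field_simp
  ring

end RealFunctions

section BoundedSolution

open MeasureTheory AddCircle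

theorem exists_linear_extension_of_seminorm {E : Type*} [AddCommGroup E] [Module ℂ E]
    (p : Seminorm ℂ E) (S : Submodule ℂ E) (f : E →ₗ[ℂ] ℂ) (hf : ∀ x ∈ S, ‖f x‖ ≤ p x) :
    ∃ g : E →ₗ[ℂ] ℂ, (∀ x ∈ S, g x = f x) ∧ ∀ x, ‖g x‖ ≤ p x := by
  let : SeminormedAddCommGroup E := p.toAddGroupSeminorm.toSeminormedAddCommGroup
  have hn : ∀ x : E, ‖x‖ = p x := fun x => rfl
  let : NormedSpace ℂ E := { norm_smul_le := fun a b => by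
                                rw [hn, hn, map_smul_eq_mul] }
  let f' : StrongDual ℂ S := LinearMap.mkContinuous (f.comp S.subtype) 1 fun x => by
    rw [one_mul]; exact hf x x.2
  obtain ⟨g, hg, hgn⟩ := exists_extension_norm_eq S f'
  refine ⟨g.toLinearMap, fun x hx => hg ⟨x, hx⟩, fun x => ?_⟩
  have h1 : ‖f'‖ ≤ 1 := LinearMap.mkContinuous_norm_le _ zero_le_one _
  calc ‖g x‖ ≤ ‖g‖ * ‖x‖ := g.le_opNorm x
    _ ≤ 1 * ‖x‖ := by gcongr; rw [hgn]; exact h1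
    _ = p x := by rw [one_mul, hn]

/-- The `L¹` seminorm on continuous functions on the circle, scaled by `K`. -/
def circleL1Seminorm (K : ℝ) (hK : 0 ≤ K) : Seminorm ℂ C(UnitAddCircle, ℂ) :=
  Seminorm.of (fun f => K * ∫ t, ‖f t‖ ∂haarAddCircle)
    (fun f g => by
      rw [← mul_add, ← integral_add (integrable_circle f.continuous.norm)
        (integrable_circle g.continuous.norm)]
      refine mul_le_mul_of_nonneg_left ?_ hK
      refine integral_mono (integrable_circle (f + g).continuous.norm)
        (integrable_circle (f.continuous.norm.add g.continuous.norm)) fun t => norm_add_le _ _)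
    (fun c f => by
      simp only [ContinuousMap.smul_apply, norm_smul]
      rw [integral_const_mul]; ring)

theorem circleL1Seminorm_apply (K : ℝ) (hK : 0 ≤ K) (f : C(UnitAddCircle, ℂ)) :
    circleL1Seminorm K hK f = K * ∫ t, ‖f t‖ ∂haarAddCircle := rfl

theorem exists_polynomial_of_mem_span {f : C(UnitAddCircle, ℂ)}
    (hf : f ∈ Submodule.span ℂ (range fun n : ℕ => (fourier ((n : ℤ) + 1) : C(UnitAddCircle, ℂ)))) :
    ∃ k : Polynomial ℂ, k.eval 0 = 0 ∧ ∀ t, f t = k.eval (fourier 1 t) := by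
  induction hf using Submodule.span_induction with
  | mem x hx =>
    obtain ⟨n, rfl⟩ := hx
    refine ⟨Polynomial.X ^ (n + 1), by simp, fun t => ?_⟩
    change fourier ((n : ℤ) + 1) t = _
    rw [show ((n : ℤ) + 1) = ((n + 1 : ℕ) : ℤ) by push_cast; rfl]
    simp only [fourier_natCast]
    simp
  | zero => exact ⟨0, by simp, fun t => by simp⟩
  | add x y _ _ hx hy =>
    obtain ⟨p, h0, h⟩ := hx
    obtain ⟨p', h0', h'⟩ := hy
    exact ⟨p + p', by simp [h0, h0'], fun t => by simp [h, h']⟩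
  | smul c x _ hx =>
    obtain ⟨p, h0, h⟩ := hx
    exact ⟨Polynomial.C c * p, by simp [h0], fun t => by simp [h]⟩

theorem exists_norm_eq_one_mul_eq (w : ℂ) : ∃ θ : ℂ, ‖θ‖ = 1 ∧ θ * w = ‖w‖ := by
  by_cases h : w = 0
  · exact ⟨1, by simp, by simp [h]⟩
  · have hn : (‖w‖ : ℂ) ≠ 0 := by exact_mod_cast (norm_pos_iff.mpr h).ne'
    refine ⟨starRingEnd ℂ w / ‖w‖, ?_, ?_⟩
    · rw [norm_div, RCLike.norm_conj, Complex.norm_real, norm_norm,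
        div_self (norm_pos_iff.mpr h).ne']
    · rw [div_mul_eq_mul_div, mul_comm, Complex.mul_conj, Complex.normSq_eq_norm_sq]
      push_cast; field_simp

theorem poissonReal_zero (t : UnitAddCircle) : poissonReal 0 t = 1 := by simp [poissonReal]

end BoundedSolution

section SecondOrder

variable {E F H : Type*} [NormedAddCommGroup E] [NormedSpace ℂ E] [NormedSpace ℝ E]
  [IsScalarTower ℝ ℂ E] [NormedAddCommGroup F] [NormedSpace ℂ F] [NormedSpace ℝ F]
  [IsScalarTower ℝ ℂ F] [NormedAddCommGroup H] [NormedSpace ℂ H] [NormedSpace ℝ H]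
  [IsScalarTower ℝ ℂ H]

theorem dz_dbar_add {f g : ℂ → E} {z : ℂ} (hf : ContDiffAt ℝ 2 f z) (hg : ContDiffAt ℝ 2 g z) :
    dz (dbar fun w => f w + g w) z = dz (dbar f) z + dz (dbar g) z := by
  have h : (dbar fun w => f w + g w) =ᶠ[𝓝 z] fun w => dbar f w + dbar g w := by
    filter_upwards [hf.eventually (by simp), hg.eventually (by simp)] with w h1 h2
    exact dbar_add (h1.differentiableAt (by norm_num)) (h2.differentiableAt (by norm_num))
  rw [h.dz_eq, dz_add hf.differentiableAt_dbar hg.differentiableAt_dbar]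

theorem dz_dbar_bilin (B : E →L[ℂ] F →L[ℂ] H) {f : ℂ → E} {g : ℂ → F} {z : ℂ}
    (hf : ContDiffAt ℝ 2 f z) (hg : ContDiffAt ℝ 2 g z) :
    dz (dbar fun w => B (f w) (g w)) z =
      B (dz (dbar f) z) (g z) + B (dbar f z) (dz g z) +
        (B (dz f z) (dbar g z) + B (f z) (dz (dbar g) z)) := by
  have h : (dbar fun w => B (f w) (g w)) =ᶠ[𝓝 z]
      fun w => B (dbar f w) (g w) + B (f w) (dbar g w) := by
    filter_upwards [hf.eventually (by simp), hg.eventually (by simp)] with w h1 h2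
    exact dbar_bilin B (h1.differentiableAt (by norm_num)) (h2.differentiableAt (by norm_num))
  have hf1 := hf.differentiableAt (n := 2) (by norm_num)
  have hg1 := hg.differentiableAt (n := 2) (by norm_num)
  have hB : ∀ {a : ℂ → E} {b : ℂ → F}, DifferentiableAt ℝ a z → DifferentiableAt ℝ b z →
      DifferentiableAt ℝ (fun w => B (a w) (b w)) z := fun {a b} ha hb => by
    have h2 := (B.isBoundedBilinearMap.hasFDerivAt (a z, b z)).restrictScalars ℝ
    exact (h2.comp z (ha.prodMk hb).hasFDerivAt).differentiableAt
  rw [h.dz_eq, dz_add (hB hf.differentiableAt_dbar hg1) (hB hf1 hg.differentiableAt_dbar),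
    dz_bilin B hf.differentiableAt_dbar hg1, dz_bilin B hf1 hg.differentiableAt_dbar]

theorem dz_dbar_mul {f g : ℂ → ℂ} {z : ℂ}
    (hf : ContDiffAt ℝ 2 f z) (hg : ContDiffAt ℝ 2 g z) :
    dz (dbar fun w => f w * g w) z =
      dz (dbar f) z * g z + dbar f z * dz g z + (dz f z * dbar g z + f z * dz (dbar g) z) :=
  dz_dbar_bilin (ContinuousLinearMap.mul ℂ ℂ) hf hg

theorem dz_dbar_const_mul (c : ℂ) {f : ℂ → ℂ} {z : ℂ} (hf : ContDiffAt ℝ 2 f z) :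
    dz (dbar fun w => c * f w) z = c * dz (dbar f) z := by
  have h : dbar (fun _ : ℂ => c) = fun _ => 0 := funext fun w => dbar_const c w
  rw [dz_dbar_mul contDiffAt_const hf, h, dz_const, dz_const]
  ring

theorem dz_dbar_eq_zero {f : ℂ → E} {z : ℂ} (hf : ∀ᶠ w in 𝓝 z, DifferentiableAt ℂ f w) :
    dz (dbar f) z = 0 := by
  have h : dbar f =ᶠ[𝓝 z] fun _ => 0 := by
    filter_upwards [hf] with w hw using dbar_eq_zero hw
  rw [h.dz_eq, dz_const]

end SecondOrder

section BoundedSolution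

open MeasureTheory AddCircle

/-- The regularized modulus of a polynomial. -/
def polyModulus (k : Polynomial ℂ) (η : ℝ) (z : ℂ) : ℝ := √(Complex.normSq (k.eval z) + η ^ 2)

theorem polyModulus_arg_pos (k : Polynomial ℂ) {η : ℝ} (hη : 0 < η) (z : ℂ) :
    0 < Complex.normSq (k.eval z) + η ^ 2 := by
  have := Complex.normSq_nonneg (k.eval z); positivity

theorem polyModulus_pos (k : Polynomial ℂ) {η : ℝ} (hη : 0 < η) (z : ℂ) :
    0 < polyModulus k η z := Real.sqrt_pos.mpr (polyModulus_arg_pos k hη z)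

theorem norm_le_polyModulus (k : Polynomial ℂ) {η : ℝ} (z : ℂ) :
    ‖k.eval z‖ ≤ polyModulus k η z := by
  refine Real.le_sqrt_of_sq_le ?_
  rw [Complex.normSq_eq_norm_sq]; nlinarith [sq_nonneg η]

theorem polyModulus_le (k : Polynomial ℂ) {η : ℝ} (hη : 0 < η) (z : ℂ) :
    polyModulus k η z ≤ ‖k.eval z‖ + η := by
  refine Real.sqrt_le_iff.mpr ⟨by positivity, ?_⟩
  rw [Complex.normSq_eq_norm_sq]; nlinarith [mul_nonneg (norm_nonneg (k.eval z)) hη.le]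

theorem contDiff_polynomial_eval (k : Polynomial ℂ) {n : WithTop ℕ∞} :
    ContDiff ℝ n fun z => k.eval z := (Polynomial.contDiff_aeval k n).restrict_scalars ℝ

theorem contDiff_normSq_polynomial (k : Polynomial ℂ) (η : ℝ) {n : WithTop ℕ∞} :
    ContDiff ℝ n fun z => Complex.normSq (k.eval z) + η ^ 2 := by
  have h : (fun z => Complex.normSq (k.eval z) + η ^ 2) =
      fun z => (k.eval z).re * (k.eval z).re + (k.eval z).im * (k.eval z).im + η ^ 2 := rfl
  have h1 : ContDiff ℝ n fun z => (k.eval z).re :=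
    Complex.reCLM.contDiff.comp (contDiff_polynomial_eval k)
  have h2 : ContDiff ℝ n fun z => (k.eval z).im :=
    Complex.imCLM.contDiff.comp (contDiff_polynomial_eval k)
  rw [h]
  exact ((h1.mul h1).add (h2.mul h2)).add contDiff_const

theorem contDiff_polyModulus (k : Polynomial ℂ) {η : ℝ} (hη : 0 < η) {n : WithTop ℕ∞} :
    ContDiff ℝ n (polyModulus k η) :=
  (contDiff_normSq_polynomial k η).sqrt fun z => (polyModulus_arg_pos k hη z).ne'

theorem ofReal_normSq_polynomial (k : Polynomial ℂ) (η : ℝ) :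
    (fun w => ((Complex.normSq (k.eval w) + η ^ 2 : ℝ) : ℂ)) =
      fun w => k.eval w * starRingEnd ℂ (k.eval w) + (η ^ 2 : ℂ) := by
  funext w; rw [Complex.mul_conj]; push_cast; rfl

theorem dbar_normSq_polynomial (k : Polynomial ℂ) (η : ℝ) :
    dbar (fun w => ((Complex.normSq (k.eval w) + η ^ 2 : ℝ) : ℂ)) =
      fun z => k.eval z * starRingEnd ℂ (k.derivative.eval z) := by
  funext z
  have hd : DifferentiableAt ℝ (fun w => k.eval w) z :=
    (contDiff_polynomial_eval k (n := 1)).differentiable (by norm_num) z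
  have hc : DifferentiableAt ℝ (fun w => starRingEnd ℂ (k.eval w)) z :=
    Complex.conjCLE.differentiableAt.comp z hd
  rw [ofReal_normSq_polynomial, dbar_add (hd.fun_mul hc) (differentiableAt_const _), dbar_const,
    dbar_mul hd hc, dbar_conj hd, dbar_eq_zero k.differentiableAt, dz_eq_deriv k.differentiableAt,
    k.deriv]
  simp

theorem dz_dbar_normSq_polynomial (k : Polynomial ℂ) (η : ℝ) (z : ℂ) :
    dz (dbar (fun w => ((Complex.normSq (k.eval w) + η ^ 2 : ℝ) : ℂ))) z =
      (Complex.normSq (k.derivative.eval z) : ℂ) := by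
  have hd : ∀ k : Polynomial ℂ, DifferentiableAt ℝ (fun w => k.eval w) z := fun k =>
    (contDiff_polynomial_eval k (n := 1)).differentiable (by norm_num) z
  have hc : DifferentiableAt ℝ (fun w => starRingEnd ℂ (k.derivative.eval w)) z :=
    Complex.conjCLE.differentiableAt.comp z (hd _)
  rw [dbar_normSq_polynomial, dz_mul (hd k) hc, dz_conj (hd _),
    dbar_eq_zero k.derivative.differentiableAt, dz_eq_deriv k.differentiableAt, k.deriv,
    Complex.mul_conj]
  simp

theorem norm_dz_normSq_polynomial (k : Polynomial ℂ) (η : ℝ) (z : ℂ) :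
    ‖dz (fun w => ((Complex.normSq (k.eval w) + η ^ 2 : ℝ) : ℂ)) z‖ =
      ‖k.eval z‖ * ‖k.derivative.eval z‖ := by
  have h := dbar_ofReal ((contDiff_normSq_polynomial k η (n := 1)).differentiable (by norm_num) z)
  rw [← RCLike.norm_conj, ← h, dbar_normSq_polynomial, norm_mul, RCLike.norm_conj]

theorem norm_dz_polyModulus_le (k : Polynomial ℂ) {η : ℝ} (hη : 0 < η) (z : ℂ) :
    ‖dz (fun w => (polyModulus k η w : ℂ)) z‖ ≤ ‖k.derivative.eval z‖ / 2 := by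
  have h := dz_sqrt ((contDiff_normSq_polynomial k η (n := 1)).differentiable (by norm_num) z)
    (polyModulus_arg_pos k hη z)
  have hκ := polyModulus_pos k hη z
  have h2 := norm_le_polyModulus k (η := η) z
  unfold polyModulus at hκ h2 ⊢
  rw [h, norm_div, norm_dz_normSq_polynomial, Complex.norm_real, Real.norm_of_nonneg (by positivity),
    div_le_div_iff₀ (by positivity) (by norm_num)]
  nlinarith [mul_le_mul_of_nonneg_right h2 (norm_nonneg (k.derivative.eval z))]

theorem le_dz_dbar_polyModulus (k : Polynomial ℂ) {η : ℝ} (hη : 0 < η) (z : ℂ) :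
    ‖k.derivative.eval z‖ ^ 2 / (4 * polyModulus k η z) ≤
      (dz (dbar fun w => (polyModulus k η w : ℂ)) z).re := by
  have h := dz_dbar_sqrt (contDiff_normSq_polynomial k η).contDiffAt (polyModulus_arg_pos k hη z)
  have hκ := polyModulus_pos k hη z
  have hN := polyModulus_arg_pos k hη z
  unfold polyModulus at hκ ⊢
  rw [h, dz_dbar_normSq_polynomial, norm_dz_normSq_polynomial, Complex.ofReal_re,
    Complex.normSq_eq_norm_sq (k.derivative.eval z),
    div_le_div_iff₀ (by positivity) (by positivity)]
  have h2 : (‖k.eval z‖ * ‖k.derivative.eval z‖) ^ 2 / (2 * (Complex.normSq (k.eval z) + η ^ 2)) ≤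
      ‖k.derivative.eval z‖ ^ 2 / 2 := by
    rw [div_le_div_iff₀ (by positivity) (by norm_num), Complex.normSq_eq_norm_sq]
    nlinarith [mul_nonneg (sq_nonneg η) (sq_nonneg ‖k.derivative.eval z‖)]
  nlinarith [mul_le_mul_of_nonneg_right h2 hκ.le]

end BoundedSolution

section BoundedSolution

open MeasureTheory AddCircle

/-- Data for which `∂̄v = G` has a bounded solution on the unit disc. -/
structure CarlesonData (A B C : ℝ) (G : ℂ → ℂ) (Φ e : ℂ → ℝ) : Prop where
  hA : 0 ≤ A
  hB : 0 ≤ B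
  hC : 0 ≤ C
  smooth_rhs : ContDiff ℝ (⊤ : ℕ∞) G
  smooth_weight : ContDiff ℝ (⊤ : ℕ∞) Φ
  nonneg : ∀ z ∈ ball (0 : ℂ) 1, 0 ≤ e z
  rhs_le : ∀ z ∈ ball (0 : ℂ) 1, ‖G z‖ ≤ A * e z
  dz_rhs_le : ∀ z ∈ ball (0 : ℂ) 1, ‖dz G z‖ ≤ A * e z ^ 2
  weight_nonneg : ∀ z ∈ ball (0 : ℂ) 1, 0 ≤ Φ z
  weight_le : ∀ z ∈ ball (0 : ℂ) 1, Φ z ≤ B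
  dz_weight_le : ∀ z ∈ ball (0 : ℂ) 1, ‖dz (fun w => (Φ w : ℂ)) z‖ ≤ C * e z
  le_dz_dbar_weight : ∀ z ∈ ball (0 : ℂ) 1, e z ^ 2 ≤ (dz (dbar fun w => (Φ w : ℂ)) z).re

theorem le_on_closedBall {Φ : ℂ → ℝ} (hΦ : Continuous Φ) {B : ℝ}
    (h : ∀ z ∈ ball (0 : ℂ) 1, Φ z ≤ B) : ∀ z ∈ closedBall (0 : ℂ) 1, Φ z ≤ B := by
  intro z hz
  rw [← closure_ball (0 : ℂ) one_ne_zero] at hz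
  exact closure_minimal (fun w hw => h w hw) (isClosed_Iic.preimage hΦ) hz

variable {A B C : ℝ} {G v₀ : ℂ → ℂ} {Φ e : ℂ → ℝ}

theorem CarlesonData.subharmonic_polynomial (h : CarlesonData A B C G Φ e)
    (hv : ContDiff ℝ (⊤ : ℕ∞) v₀) (hv' : ∀ z ∈ ball (0 : ℂ) 2, dbar v₀ z = G z)
    (k : Polynomial ℂ) {η : ℝ} (hη : 0 < η) {θ : ℂ} (hθ : ‖θ‖ = 1)
    {z : ℂ} (hz : z ∈ ball (0 : ℂ) 1) :
    0 ≤ (dz (dbar fun w => θ * (v₀ w * k.eval w) +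
      (A : ℂ) * ((polyModulus k η w : ℂ) * (((2 * C + 1) ^ 2 : ℝ) + 2 * (Φ w : ℂ)))) z).re := by
  have hz2 : ball (0 : ℂ) 2 ∈ 𝓝 z :=
    isOpen_ball.mem_nhds (ball_subset_ball (by norm_num) hz)
  have hv2 : ContDiffAt ℝ 2 v₀ z := (hv.of_le (by norm_cast)).contDiffAt
  have hk2 : ContDiffAt ℝ 2 (fun w => k.eval w) z := (contDiff_polynomial_eval k).contDiffAt
  have hκ2 : ContDiffAt ℝ 2 (fun w => (polyModulus k η w : ℂ)) z :=
    (contDiff_polyModulus k hη).contDiffAt.ofReal_comp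
  have hΦ2' : ContDiffAt ℝ 2 Φ z := (h.smooth_weight.of_le (by norm_cast)).contDiffAt
  have hΦ2 : ContDiffAt ℝ 2 (fun w => (Φ w : ℂ)) z := hΦ2'.ofReal_comp
  have hΦ3 : ContDiffAt ℝ 2 (fun w => (2 : ℂ) * (Φ w : ℂ)) z := contDiffAt_const.mul hΦ2
  have hΦ4 : ContDiffAt ℝ 2 (fun w => (((2 * C + 1) ^ 2 : ℝ) : ℂ) + (2 : ℂ) * (Φ w : ℂ)) z :=
    contDiffAt_const.add hΦ3
  have hd : ∀ {f : ℂ → ℂ}, ContDiffAt ℝ 2 f z → DifferentiableAt ℝ f z := fun hf =>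
    hf.differentiableAt (by norm_num)
  have e1 : dz (dbar v₀) z = dz G z := by
    refine Filter.EventuallyEq.dz_eq ?_
    filter_upwards [hz2] with w hw using hv' w hw
  have e2 : dbar v₀ z = G z := hv' z (mem_of_mem_nhds hz2)
  have e3 : dz (dbar fun w => k.eval w) z = 0 :=
    dz_dbar_eq_zero (Filter.Eventually.of_forall fun w => k.differentiableAt)
  have e4 : dz (fun w => (((2 * C + 1) ^ 2 : ℝ) : ℂ) + (2 : ℂ) * (Φ w : ℂ)) z =
      2 * dz (fun w => (Φ w : ℂ)) z := by
    rw [dz_add (differentiableAt_const _) (hd hΦ3), dz_const, dz_const_mul _ (hd hΦ2), zero_add]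
  have e5 : dbar (fun w => (((2 * C + 1) ^ 2 : ℝ) : ℂ) + (2 : ℂ) * (Φ w : ℂ)) z =
      2 * dbar (fun w => (Φ w : ℂ)) z := by
    rw [dbar_add (differentiableAt_const _) (hd hΦ3), dbar_const, dbar_const_mul _ (hd hΦ2),
      zero_add]
  have e6 : dz (dbar fun w => (((2 * C + 1) ^ 2 : ℝ) : ℂ) + (2 : ℂ) * (Φ w : ℂ)) z =
      2 * dz (dbar fun w => (Φ w : ℂ)) z := by
    rw [dz_dbar_add contDiffAt_const hΦ3, dz_dbar_const_mul _ hΦ2,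
      dz_dbar_eq_zero (Filter.Eventually.of_forall fun w => differentiableAt_const _), zero_add]
  have hΦd : dbar (fun w => (Φ w : ℂ)) z = starRingEnd ℂ (dz (fun w => (Φ w : ℂ)) z) :=
    dbar_ofReal (hΦ2'.differentiableAt (by norm_num))
  have hκd : dbar (fun w => (polyModulus k η w : ℂ)) z =
      starRingEnd ℂ (dz (fun w => (polyModulus k η w : ℂ)) z) :=
    dbar_ofReal ((contDiff_polyModulus k hη (n := 1)).differentiable (by norm_num) z)
  rw [dz_dbar_add (contDiffAt_const.mul (hv2.mul hk2))
      (contDiffAt_const.mul (hκ2.mul hΦ4)), dz_dbar_const_mul _ (hv2.mul hk2),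
    dz_dbar_const_mul _ (hκ2.mul hΦ4), dz_dbar_mul hv2 hk2, dz_dbar_mul hκ2 hΦ4, e1, e2, e3, e4,
    e5, e6, dbar_eq_zero k.differentiableAt, dz_eq_deriv k.differentiableAt, k.deriv, hΦd, hκd]
  have i1 := h.rhs_le z hz
  have i2 := h.dz_rhs_le z hz
  have i3 := h.dz_weight_le z hz
  have i4 := h.le_dz_dbar_weight z hz
  have i5 := h.weight_nonneg z hz
  have i6 := norm_dz_polyModulus_le k hη z
  have i7 := le_dz_dbar_polyModulus k hη z
  have i8 := polyModulus_pos k hη z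
  have i9 := norm_le_polyModulus k (η := η) z
  have i0 := h.nonneg z hz
  set ez := e z
  set κ := polyModulus k η z
  set k' := k.derivative.eval z
  set dκ := dz (fun w => (polyModulus k η w : ℂ)) z
  set dΦ := dz (fun w => (Φ w : ℂ)) z
  have hA := h.hA
  have hC := h.hC
  have j1 : -(A * (ez ^ 2 * κ + ez * ‖k'‖)) ≤
      (θ * (dz G z * k.eval z + G z * k' + (dz v₀ z * 0 + v₀ z * 0))).re := by
    refine neg_le_of_abs_le ((Complex.abs_re_le_norm _).trans ?_)
    rw [norm_mul, hθ, one_mul, mul_zero, mul_zero, add_zero, add_zero]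
    refine (norm_add_le _ _).trans ?_
    rw [norm_mul, norm_mul, mul_add]
    refine add_le_add ?_ ?_
    · calc _ ≤ (A * ez ^ 2) * κ := by gcongr
        _ = _ := by ring
    · calc _ ≤ (A * ez) * ‖k'‖ := by gcongr
        _ = _ := by ring
  have j2 : (dκ * (2 * starRingEnd ℂ dΦ)).re = 2 * (dκ * starRingEnd ℂ dΦ).re := by
    rw [mul_left_comm, Complex.mul_re]; simp
  have j3 : (starRingEnd ℂ dκ * (2 * dΦ)).re = 2 * (dκ * starRingEnd ℂ dΦ).re := by
    simp only [Complex.mul_re, Complex.conj_re, Complex.conj_im, Complex.re_ofNat,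
      Complex.im_ofNat, Complex.mul_im]; ring
  have j4 : -(‖k'‖ / 2 * (C * ez)) ≤ (dκ * starRingEnd ℂ dΦ).re := by
    refine neg_le_of_abs_le ((Complex.abs_re_le_norm _).trans ?_)
    rw [norm_mul, RCLike.norm_conj]
    gcongr
  have j5 : ((κ : ℂ) * (2 * dz (dbar fun w => (Φ w : ℂ)) z)).re =
      2 * κ * (dz (dbar fun w => (Φ w : ℂ)) z).re := by
    rw [Complex.re_ofReal_mul, Complex.mul_re]; simp; ring
  have j6 : (dz (dbar fun w => (polyModulus k η w : ℂ)) z *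
      (((2 * C + 1) ^ 2 : ℝ) + 2 * (Φ z : ℂ))).re =
      (dz (dbar fun w => (polyModulus k η w : ℂ)) z).re * ((2 * C + 1) ^ 2 + 2 * Φ z) := by
    rw [← Complex.re_mul_ofReal]; push_cast; rfl
  rw [Complex.add_re, Complex.re_ofReal_mul, Complex.add_re, Complex.add_re, Complex.add_re, j2,
    j3, j5, j6]
  have j7 : ‖k'‖ ^ 2 / (4 * κ) * (2 * C + 1) ^ 2 ≤
      (dz (dbar fun w => (polyModulus k η w : ℂ)) z).re * ((2 * C + 1) ^ 2 + 2 * Φ z) := by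
    refine mul_le_mul i7 (by linarith) (by positivity) (le_trans (by positivity) i7)
  have j8 : (2 * C + 1) * ez * ‖k'‖ ≤ ‖k'‖ ^ 2 / (4 * κ) * (2 * C + 1) ^ 2 + κ * ez ^ 2 := by
    rw [div_mul_eq_mul_div, ← sub_le_iff_le_add, le_div_iff₀ (by positivity)]
    nlinarith [sq_nonneg ((2 * C + 1) * ‖k'‖ - 2 * κ * ez)]
  have j9 : κ * ez ^ 2 ≤ κ * (dz (dbar fun w => (Φ w : ℂ)) z).re := by gcongr
  have : 0 ≤ A * ((dz (dbar fun w => (polyModulus k η w : ℂ)) z).re * ((2 * C + 1) ^ 2 + 2 * Φ z) +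
      2 * (dκ * starRingEnd ℂ dΦ).re + (2 * (dκ * starRingEnd ℂ dΦ).re +
        2 * κ * (dz (dbar fun w => (Φ w : ℂ)) z).re) - (ez ^ 2 * κ + ez * ‖k'‖)) := by
    refine mul_nonneg hA ?_
    nlinarith
  linarith

theorem CarlesonData.norm_integral_polynomial_le (h : CarlesonData A B C G Φ e)
    (hv : ContDiff ℝ (⊤ : ℕ∞) v₀) (hv' : ∀ z ∈ ball (0 : ℂ) 2, dbar v₀ z = G z)
    (k : Polynomial ℂ) (hk : k.eval 0 = 0) :
    ‖∫ t : UnitAddCircle, v₀ (fourier 1 t) * k.eval (fourier 1 t) ∂haarAddCircle‖ ≤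
      A * ((2 * C + 1) ^ 2 + 2 * B) * ∫ t : UnitAddCircle, ‖k.eval (fourier 1 t)‖ ∂haarAddCircle := by
  set K := A * ((2 * C + 1) ^ 2 + 2 * B)
  have hA := h.hA
  have hB := h.hB
  have hK : 0 ≤ K := by positivity
  have hcf : Continuous fun t : UnitAddCircle => fourier 1 t := (fourier 1).continuous
  have hck : Continuous fun z : ℂ => k.eval z := k.continuous
  have hcv : Continuous v₀ := hv.continuous
  have hi1 : Integrable (fun t : UnitAddCircle => v₀ (fourier 1 t) * k.eval (fourier 1 t))
      haarAddCircle := integrable_circle (by fun_prop)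
  have key : ∀ η > 0,
      ‖∫ t : UnitAddCircle, v₀ (fourier 1 t) * k.eval (fourier 1 t) ∂haarAddCircle‖ ≤
      K * ((∫ t : UnitAddCircle, ‖k.eval (fourier 1 t)‖ ∂haarAddCircle) + η) := by
    intro η hη
    obtain ⟨θ', hθ', hθ2⟩ := exists_norm_eq_one_mul_eq
      (∫ t : UnitAddCircle, v₀ (fourier 1 t) * k.eval (fourier 1 t) ∂haarAddCircle)
    have hΦc : Continuous Φ := h.smooth_weight.continuous
    have hκc : Continuous (polyModulus k η) := (contDiff_polyModulus k hη (n := 0)).continuous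
    have hP := re_le_integral_poisson (f := fun w => -θ' * (v₀ w * k.eval w) +
        (A : ℂ) * ((polyModulus k η w : ℂ) * (((2 * C + 1) ^ 2 : ℝ) + 2 * (Φ w : ℂ))))
      (z := 0) (by fun_prop) (fun z hz => ?_)
      (fun z hz => h.subharmonic_polynomial hv hv' k hη (by rwa [norm_neg]) hz) (by simp)
    swap
    · refine (contDiffAt_const.mul ((hv.of_le (by norm_cast)).contDiffAt.mul
        (contDiff_polynomial_eval k).contDiffAt)).add (contDiffAt_const.mul
        ((contDiff_polyModulus k hη).contDiffAt.ofReal_comp.mul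
          (contDiffAt_const.add (contDiffAt_const.mul
            (h.smooth_weight.of_le (by norm_cast)).contDiffAt.ofReal_comp))))
    simp only [poissonReal_zero, one_mul] at hP
    have hre : ∀ w : ℂ, ((A : ℂ) * ((polyModulus k η w : ℂ) *
        (((2 * C + 1) ^ 2 : ℝ) + 2 * (Φ w : ℂ)))).re =
        A * (polyModulus k η w * ((2 * C + 1) ^ 2 + 2 * Φ w)) := by
      intro w
      rw [← Complex.ofReal_re (A * (polyModulus k η w * ((2 * C + 1) ^ 2 + 2 * Φ w)))]
      push_cast; rfl
    simp only [Complex.add_re, hre, hk, mul_zero, Complex.zero_re, zero_add] at hP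
    have h0 : 0 ≤ A * (polyModulus k η 0 * ((2 * C + 1) ^ 2 + 2 * Φ 0)) := by
      have := (polyModulus_pos k hη 0).le
      have := h.weight_nonneg 0 (by simp)
      positivity
    rw [integral_add (integrable_circle (by fun_prop)) (integrable_circle (by fun_prop))] at hP
    have h1 : ∫ t : UnitAddCircle, (-θ' * (v₀ (fourier 1 t) * k.eval (fourier 1 t))).re
        ∂haarAddCircle =
        -‖∫ t : UnitAddCircle, v₀ (fourier 1 t) * k.eval (fourier 1 t) ∂haarAddCircle‖ := by
      have := integral_re (hi1.const_mul (-θ'))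
      refine this.trans ?_
      rw [integral_const_mul, neg_mul, hθ2]; simp
    have h2 : ∫ t : UnitAddCircle, A * (polyModulus k η (fourier 1 t) *
        ((2 * C + 1) ^ 2 + 2 * Φ (fourier 1 t))) ∂haarAddCircle ≤
        ∫ t : UnitAddCircle, K * (‖k.eval (fourier 1 t)‖ + η) ∂haarAddCircle := by
      refine integral_mono (integrable_circle (by fun_prop)) (integrable_circle (by fun_prop))
        fun t => ?_
      have hΦt : Φ (fourier 1 t) ≤ B :=
        le_on_closedBall hΦc h.weight_le _ (by rw [mem_closedBall_zero_iff, norm_fourier_one])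
      have h3 := polyModulus_le k hη (fourier 1 t)
      have h4 := (polyModulus_pos k hη (fourier 1 t)).le
      calc A * (polyModulus k η (fourier 1 t) * ((2 * C + 1) ^ 2 + 2 * Φ (fourier 1 t)))
          ≤ A * ((‖k.eval (fourier 1 t)‖ + η) * ((2 * C + 1) ^ 2 + 2 * B)) := by
            refine mul_le_mul_of_nonneg_left ?_ hA
            exact (mul_le_mul_of_nonneg_left (by linarith) h4).trans
              (mul_le_mul_of_nonneg_right h3 (by positivity))
        _ = _ := by simp only [K]; ring
    rw [integral_const_mul K, integral_add (integrable_circle (by fun_prop))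
      (integrable_circle (by fun_prop)), integral_const] at h2
    simp only [probReal_univ, one_smul] at h2
    linarith
  refine le_of_forall_pos_le_add fun ε hε => ?_
  have := key (ε / (K + 1)) (by positivity)
  refine this.trans ?_
  rw [mul_add]
  gcongr
  rw [mul_div_assoc', div_le_iff₀ (by positivity)]
  nlinarith

theorem CarlesonData.norm_sub_integral_le (h : CarlesonData A B C G Φ e)
    (hv : ContDiff ℝ (⊤ : ℕ∞) v₀) (hv' : ∀ z ∈ ball (0 : ℂ) 2, dbar v₀ z = G z)
    {z : ℂ} (hz : z ∈ ball (0 : ℂ) 1) :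
    ‖v₀ z - ∫ t, (poissonReal z t : ℂ) * v₀ (fourier 1 t) ∂haarAddCircle‖ ≤ A * B := by
  have hA := h.hA
  have hcf : Continuous fun t : UnitAddCircle => fourier 1 t := (fourier 1).continuous
  have hcv : Continuous v₀ := hv.continuous
  have hΦc : Continuous Φ := h.smooth_weight.continuous
  have hpc := continuous_poissonReal hz
  obtain ⟨θ, hθ, hθ2⟩ := exists_norm_eq_one_mul_eq
    (v₀ z - ∫ t, (poissonReal z t : ℂ) * v₀ (fourier 1 t) ∂haarAddCircle)
  have hv2 : ContDiff ℝ 2 v₀ := hv.of_le (by norm_cast)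
  have hΦ2 : ContDiff ℝ 2 Φ := h.smooth_weight.of_le (by norm_cast)
  have hP := re_le_integral_poisson (f := fun w => θ * v₀ w + (A : ℂ) * (Φ w : ℂ))
    (z := z) (by fun_prop) (fun w hw => (contDiffAt_const.mul hv2.contDiffAt).add
      (contDiffAt_const.mul hΦ2.contDiffAt.ofReal_comp)) (fun w hw => ?_) hz
  swap
  · rw [dz_dbar_add (contDiffAt_const.mul hv2.contDiffAt)
      (contDiffAt_const.mul hΦ2.contDiffAt.ofReal_comp), dz_dbar_const_mul _ hv2.contDiffAt,
      dz_dbar_const_mul _ hΦ2.contDiffAt.ofReal_comp]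
    have e1 : dz (dbar v₀) w = dz G w := by
      refine Filter.EventuallyEq.dz_eq ?_
      filter_upwards [isOpen_ball.mem_nhds (ball_subset_ball (by norm_num : (1 : ℝ) ≤ 2) hw)]
        with w hw using hv' w hw
    rw [e1, Complex.add_re, Complex.re_ofReal_mul]
    have h1 : -(A * e w ^ 2) ≤ (θ * dz G w).re := by
      refine neg_le_of_abs_le ((Complex.abs_re_le_norm _).trans ?_)
      rw [norm_mul, hθ, one_mul]; exact h.dz_rhs_le w hw
    have h2 := mul_le_mul_of_nonneg_left (h.le_dz_dbar_weight w hw) hA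
    linarith
  simp only [Complex.add_re, Complex.re_ofReal_mul, Complex.ofReal_re, mul_add] at hP
  rw [integral_add (integrable_circle (by fun_prop)) (integrable_circle (by fun_prop))] at hP
  have h1 : ∫ t, poissonReal z t * (θ * v₀ (fourier 1 t)).re ∂haarAddCircle =
      (θ * ∫ t, (poissonReal z t : ℂ) * v₀ (fourier 1 t) ∂haarAddCircle).re := by
    have hi : Integrable (fun t => (poissonReal z t : ℂ) * v₀ (fourier 1 t)) haarAddCircle :=
      integrable_circle (by fun_prop)
    rw [← integral_const_mul]
    have := integral_re (hi.const_mul θ)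
    refine Eq.trans ?_ this
    refine integral_congr_ae (Filter.Eventually.of_forall fun t => ?_)
    simp only [RCLike.re_to_complex]
    rw [mul_left_comm, Complex.re_ofReal_mul]
  have h2 : ∫ t, poissonReal z t * (A * Φ (fourier 1 t)) ∂haarAddCircle ≤
      ∫ t, poissonReal z t * (A * B) ∂haarAddCircle := by
    refine integral_mono (integrable_circle (by fun_prop)) (integrable_circle (by fun_prop))
      fun t => ?_
    have hΦt : Φ (fourier 1 t) ≤ B :=
      le_on_closedBall hΦc h.weight_le _ (by rw [mem_closedBall_zero_iff, norm_fourier_one])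
    exact mul_le_mul_of_nonneg_left (mul_le_mul_of_nonneg_left hΦt hA) (poissonReal_nonneg hz t)
  rw [integral_mul_const, integral_poissonReal hz, one_mul] at h2
  have h3 : ((θ * (v₀ z - ∫ t, (poissonReal z t : ℂ) * v₀ (fourier 1 t) ∂haarAddCircle))).re =
      ‖v₀ z - ∫ t, (poissonReal z t : ℂ) * v₀ (fourier 1 t) ∂haarAddCircle‖ := by
    rw [hθ2, Complex.ofReal_re]
  rw [← h3, mul_sub, Complex.sub_re]
  have h4 := mul_nonneg hA (h.weight_nonneg z hz)
  linarith

/-- Bounded solutions of the `∂̄`-equation on the disc. -/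
theorem CarlesonData.exists_bounded_dbar (h : CarlesonData A B C G Φ e) :
    ∃ v : ℂ → ℂ, ∀ z ∈ ball (0 : ℂ) 1, DifferentiableAt ℝ v z ∧ dbar v z = G z ∧
      ‖v z‖ ≤ A * ((2 * C + 1) ^ 2 + 3 * B) := by
  obtain ⟨v₀, hv, hv'⟩ := exists_dbar_eq h.smooth_rhs
  have hA := h.hA
  have hB := h.hB
  set K := A * ((2 * C + 1) ^ 2 + 2 * B) with hKdef
  have hK : 0 ≤ K := by positivity
  set vc : C(UnitAddCircle, ℂ) := ⟨fun t => v₀ (fourier 1 t), by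
    have : Continuous fun t : UnitAddCircle => fourier 1 t := (fourier 1).continuous
    exact hv.continuous.comp this⟩ with hvc
  set S := Submodule.span ℂ (range fun n : ℕ => (fourier ((n : ℤ) + 1) : C(UnitAddCircle, ℂ)))
  obtain ⟨g, hg, hgn⟩ := exists_linear_extension_of_seminorm (circleL1Seminorm K hK) S
    (circlePairing vc).toLinearMap (fun x hx => by
      obtain ⟨k, hk0, hk⟩ := exists_polynomial_of_mem_span hx
      have := h.norm_integral_polynomial_le hv hv' k hk0
      rw [circleL1Seminorm_apply]
      change ‖circlePairing vc x‖ ≤ _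
      rw [circlePairing_apply]
      simp only [hk]
      exact this)
  have hL1 : ∀ f : C(UnitAddCircle, ℂ), ∫ t, ‖f t‖ ∂haarAddCircle ≤ ‖f‖ := fun f => by
    calc ∫ t, ‖f t‖ ∂haarAddCircle ≤ ∫ _, ‖f‖ ∂haarAddCircle :=
          integral_mono (integrable_circle f.continuous.norm)
            (integrable_circle continuous_const) fun t => f.norm_coe_le_norm t
      _ = ‖f‖ := by simp
  set Lt : C(UnitAddCircle, ℂ) →L[ℂ] ℂ := g.mkContinuous K fun f => (hgn f).trans (by
    rw [circleL1Seminorm_apply]; exact mul_le_mul_of_nonneg_left (hL1 f) hK) with hLt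
  set l := Lt - circlePairing vc with hl
  have hl0 : ∀ n : ℕ, l (fourier ((n : ℤ) + 1)) = 0 := fun n => by
    have := hg _ (Submodule.subset_span ⟨n, rfl⟩)
    rw [hl, _root_.sub_apply, sub_eq_zero]
    exact this
  have hdiff : ∀ z ∈ ball (0 : ℂ) 1, DifferentiableAt ℂ (fun z => l (szego z)) z := fun z hz =>
    (differentiableOn_clm_szego l).differentiableAt (isOpen_ball.mem_nhds hz)
  refine ⟨fun z => v₀ z + l (szego z), fun z hz => ?_⟩
  have hv0d : DifferentiableAt ℝ v₀ z := hv.differentiable (by simp) z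
  refine ⟨hv0d.add ((hdiff z hz).restrictScalars ℝ), ?_, ?_⟩
  · rw [dbar_add hv0d ((hdiff z hz).restrictScalars ℝ), dbar_eq_zero (hdiff z hz), add_zero,
      hv' z (ball_subset_ball (by norm_num) hz)]
  · change ‖v₀ z + l (szego z)‖ ≤ _
    rw [← clm_poissonCircle hl0 hz, hl, _root_.sub_apply]
    have h1 : circlePairing vc (poissonCircle z) =
        ∫ t, (poissonReal z t : ℂ) * v₀ (fourier 1 t) ∂haarAddCircle := by
      rw [circlePairing_apply]
      refine integral_congr_ae (Filter.Eventually.of_forall fun t => ?_)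
      simp only [poissonCircle_apply hz, hvc, ContinuousMap.coe_mk, mul_comm]
    have h2 : ‖Lt (poissonCircle z)‖ ≤ K := by
      refine (hgn _).trans ?_
      rw [circleL1Seminorm_apply]
      have : ∫ t, ‖poissonCircle z t‖ ∂haarAddCircle = 1 := by
        refine Eq.trans ?_ (integral_poissonReal hz)
        refine integral_congr_ae (Filter.Eventually.of_forall fun t => ?_)
        simp only [poissonCircle_apply hz, Complex.norm_real,
          Real.norm_of_nonneg (poissonReal_nonneg hz t)]
      rw [this, mul_one]
    have h3 := h.norm_sub_integral_le hv hv' hz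
    rw [h1]
    calc ‖v₀ z + (Lt (poissonCircle z) - ∫ t, (poissonReal z t : ℂ) * v₀ (fourier 1 t)
          ∂haarAddCircle)‖ = ‖(v₀ z - ∫ t, (poissonReal z t : ℂ) * v₀ (fourier 1 t)
          ∂haarAddCircle) + Lt (poissonCircle z)‖ := by congr 1; ring
      _ ≤ A * B + K := (norm_add_le _ _).trans (add_le_add h3 h2)
      _ = _ := by rw [hKdef]; ring

end BoundedSolution

section HoloComp

variable {E₀ E : Type*} [NormedAddCommGroup E₀] [NormedSpace ℂ E₀] [NormedSpace ℝ E₀]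
  [IsScalarTower ℝ ℂ E₀] [NormedAddCommGroup E] [NormedSpace ℂ E] [NormedSpace ℝ E]
  [IsScalarTower ℝ ℂ E] {Ψ : E₀ → E} {F : ℂ → E₀} {z : ℂ}

theorem fderiv_comp_holo (hΨ : DifferentiableAt ℝ Ψ (F z)) (hF : DifferentiableAt ℂ F z) (v : ℂ) :
    fderiv ℝ (fun w => Ψ (F w)) z v = fderiv ℝ Ψ (F z) (v • deriv F z) := by
  have h1 : HasFDerivAt F ((fderiv ℂ F z).restrictScalars ℝ) z :=
    hF.hasFDerivAt.restrictScalars ℝ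
  have h2 : HasFDerivAt (fun w => Ψ (F w))
      (fderiv ℝ Ψ (F z) ∘L (fderiv ℂ F z).restrictScalars ℝ) z := hΨ.hasFDerivAt.comp z h1
  rw [h2.fderiv, ContinuousLinearMap.comp_apply]
  congr 1
  rw [ContinuousLinearMap.coe_restrictScalars', ← fderiv_apply_one_eq_deriv, ← map_smul,
    smul_eq_mul, mul_one]

theorem norm_half_sub_le (a b : E) : ‖(1 / 2 : ℂ) • (a - I • b)‖ ≤ (‖a‖ + ‖b‖) / 2 := by
  rw [norm_smul]
  have := norm_sub_le a (I • b)
  rw [norm_smul, Complex.norm_I, one_mul] at this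
  norm_num
  linarith

theorem norm_half_add_le (a b : E) : ‖(1 / 2 : ℂ) • (a + I • b)‖ ≤ (‖a‖ + ‖b‖) / 2 := by
  rw [norm_smul]
  have := norm_add_le a (I • b)
  rw [norm_smul, Complex.norm_I, one_mul] at this
  norm_num
  linarith

theorem norm_fderiv_comp_holo_le (hΨ : DifferentiableAt ℝ Ψ (F z)) (hF : DifferentiableAt ℂ F z)
    (v : ℂ) : ‖fderiv ℝ (fun w => Ψ (F w)) z v‖ ≤ ‖fderiv ℝ Ψ (F z)‖ * (‖v‖ * ‖deriv F z‖) := by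
  rw [fderiv_comp_holo hΨ hF, ← norm_smul]
  exact ContinuousLinearMap.le_opNorm _ _

theorem norm_dz_comp_holo_le (hΨ : DifferentiableAt ℝ Ψ (F z)) (hF : DifferentiableAt ℂ F z) :
    ‖dz (fun w => Ψ (F w)) z‖ ≤ ‖fderiv ℝ Ψ (F z)‖ * ‖deriv F z‖ := by
  have h1 := norm_fderiv_comp_holo_le hΨ hF 1
  have h2 := norm_fderiv_comp_holo_le hΨ hF I
  rw [norm_one, one_mul] at h1
  rw [Complex.norm_I, one_mul] at h2
  refine (norm_half_sub_le _ _).trans ?_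
  linarith

theorem norm_dbar_comp_holo_le (hΨ : DifferentiableAt ℝ Ψ (F z)) (hF : DifferentiableAt ℂ F z) :
    ‖dbar (fun w => Ψ (F w)) z‖ ≤ ‖fderiv ℝ Ψ (F z)‖ * ‖deriv F z‖ := by
  have h1 := norm_fderiv_comp_holo_le hΨ hF 1
  have h2 := norm_fderiv_comp_holo_le hΨ hF I
  rw [norm_one, one_mul] at h1
  rw [Complex.norm_I, one_mul] at h2
  refine (norm_half_add_le _ _).trans ?_
  linarith

theorem differentiableAt_deriv_of_eventually [CompleteSpace E₀]
    (hF : ∀ᶠ w in 𝓝 z, DifferentiableAt ℂ F w) : DifferentiableAt ℂ (deriv F) z := by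
  obtain ⟨s, hs, hso, hzs⟩ := _root_.eventually_nhds_iff.mp hF
  have : DifferentiableOn ℂ F s := fun w hw => (hs w hw).differentiableWithinAt
  exact (this.deriv hso).differentiableAt (hso.mem_nhds hzs)

theorem norm_dz_dbar_comp_holo_le [CompleteSpace E₀] (hΨ : ContDiff ℝ 2 Ψ)
    (hF : ∀ᶠ w in 𝓝 z, DifferentiableAt ℂ F w) :
    ‖dz (dbar fun w => Ψ (F w)) z‖ ≤ ‖fderiv ℝ (fderiv ℝ Ψ) (F z)‖ * ‖deriv F z‖ ^ 2 := by
  have hF0 := hF.self_of_nhds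
  have hF' := differentiableAt_deriv_of_eventually hF
  have hΨ1 : Differentiable ℝ Ψ := hΨ.differentiable (by norm_num)
  have hΨ2 : Differentiable ℝ (fderiv ℝ Ψ) :=
    (hΨ.fderiv_right (m := 1) (by norm_num)).differentiable (by norm_num)
  set D2 := fderiv ℝ (fderiv ℝ Ψ) (F z)
  set D1 := fderiv ℝ Ψ (F z)
  have hev : (dbar fun w => Ψ (F w)) =ᶠ[𝓝 z] fun w =>
      (1 / 2 : ℂ) • (fderiv ℝ Ψ (F w) ((1 : ℂ) • deriv F w) +
        I • fderiv ℝ Ψ (F w) (I • deriv F w)) := by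
    filter_upwards [hF] with w hw
    simp only [dbar, fderiv_comp_holo (hΨ1 _) hw]
  have hA : HasFDerivAt (fun w => fderiv ℝ Ψ (F w))
      (D2 ∘L (fderiv ℂ F z).restrictScalars ℝ) z :=
    (hΨ2 _).hasFDerivAt.comp z (hF0.hasFDerivAt.restrictScalars ℝ)
  have hB : ∀ a : ℂ, HasFDerivAt (fun w => a • deriv F w)
      ((a • fderiv ℂ (deriv F) z).restrictScalars ℝ) z := fun a =>
    (hF'.hasFDerivAt.const_smul a).restrictScalars ℝ
  have hC : ∀ a : ℂ, HasFDerivAt (fun w => fderiv ℝ Ψ (F w) (a • deriv F w)) _ z := fun a =>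
    hA.clm_apply (hB a)
  have hv1 : ∀ v : ℂ, fderiv ℂ F z v = v • deriv F z := fun v => by
    rw [← fderiv_apply_one_eq_deriv, ← map_smul, smul_eq_mul, mul_one]
  have hv2 : ∀ v : ℂ, fderiv ℂ (deriv F) z v = v • deriv (deriv F) z := fun v => by
    rw [← fderiv_apply_one_eq_deriv (f := deriv F), ← map_smul, smul_eq_mul, mul_one]
  have hD : ∀ a v : ℂ, fderiv ℝ (fun w => fderiv ℝ Ψ (F w) (a • deriv F w)) z v =
      D1 ((a * v) • deriv (deriv F) z) + D2 (v • deriv F z) (a • deriv F z) := fun a v => by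
    rw [(hC a).fderiv]
    simp [hv1, hv2, smul_smul, D1]
  have hd : ∀ a : ℂ, DifferentiableAt ℝ (fun w => fderiv ℝ Ψ (F w) (a • deriv F w)) z := fun a =>
    (hC a).differentiableAt
  have hdI : DifferentiableAt ℝ (fun w => I • fderiv ℝ Ψ (F w) (I • deriv F w)) z :=
    ((I • ContinuousLinearMap.id ℂ E).restrictScalars ℝ).differentiableAt.comp z (hd I)
  rw [hev.dz_eq, dz_const_smul _ ((hd 1).fun_add hdI), dz_add (hd 1) hdI, dz_const_smul _ (hd I)]
  simp only [dz, hD]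
  simp only [one_mul, mul_one, one_smul, Complex.I_mul_I]
  have e1 : D1 ((-1 : ℂ) • deriv (deriv F) z) = - D1 (deriv (deriv F) z) := by
    rw [neg_one_smul, map_neg]
  set v := deriv F z
  have e2 : (1 / 2 : ℂ) • ((1 / 2 : ℂ) • (D1 (deriv (deriv F) z) + D2 v v -
        I • (D1 (I • deriv (deriv F) z) + D2 (I • v) v)) +
      I • (1 / 2 : ℂ) • (D1 (I • deriv (deriv F) z) + D2 v (I • v) -
        I • (D1 ((-1 : ℂ) • deriv (deriv F) z) + D2 (I • v) (I • v)))) =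
      (1 / 2 : ℂ) • ((1 / 2 : ℂ) • (D2 v v - I • D2 (I • v) v) +
        I • (1 / 2 : ℂ) • (D2 v (I • v) - I • D2 (I • v) (I • v))) := by
    have hII : ∀ x : E, I • (1 / 2 : ℂ) • I • x = -((1 / 2 : ℂ) • x) := fun x => by
      rw [smul_comm (1 / 2 : ℂ) I x, smul_smul, Complex.I_mul_I, neg_one_smul]
    rw [e1]
    simp only [smul_add, smul_sub, smul_neg, hII]
    module
  rw [e2]
  have hb : ∀ a b : ℂ, ‖a‖ = 1 → ‖b‖ = 1 → ‖D2 (a • v) (b • v)‖ ≤ ‖D2‖ * ‖v‖ ^ 2 := by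
    intro a b ha hb
    refine (D2.le_opNorm₂ _ _).trans ?_
    rw [norm_smul, norm_smul, ha, hb]
    exact le_of_eq (by ring)
  have h1 := hb 1 1 norm_one norm_one
  have h2 := hb I 1 Complex.norm_I norm_one
  have h3 := hb 1 I norm_one Complex.norm_I
  have h4 := hb I I Complex.norm_I Complex.norm_I
  rw [one_smul] at h1 h2 h3
  refine (norm_half_add_le _ _).trans ?_
  have h5 := norm_half_sub_le (D2 v v) (D2 (I • v) v)
  have h6 := norm_half_sub_le (D2 v (I • v)) (D2 (I • v) (I • v))
  linarith

theorem exists_bound_on_closedBall {E₁ W : Type*} [NormedAddCommGroup E₁] [ProperSpace E₁]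
    [NormedAddCommGroup W] {f : E₁ → W} (hf : Continuous f) (C₀ : ℝ) :
    ∃ L : ℝ, ∀ w : E₁, ‖w‖ ≤ C₀ → ‖f w‖ ≤ L := by
  obtain ⟨L, hL⟩ := (isCompact_closedBall (0 : E₁) C₀).exists_bound_of_continuousOn hf.continuousOn
  exact ⟨L, fun w hw => hL w (by simpa using hw)⟩

theorem exists_bound_fderiv_on_closedBall {E₁ W : Type*} [NormedAddCommGroup E₁]
    [NormedSpace ℝ E₁] [ProperSpace E₁] [NormedAddCommGroup W] [NormedSpace ℝ W] {f : E₁ → W}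
    (hf : ContDiff ℝ 1 f) (C₀ : ℝ) :
    ∃ L : ℝ, ∀ w : E₁, ‖w‖ ≤ C₀ → ‖fderiv ℝ f w‖ ≤ L :=
  exists_bound_on_closedBall (hf.continuous_fderiv (by norm_num)) C₀

theorem exists_bound_derivs [ProperSpace E₀] (hΨ : ContDiff ℝ 2 Ψ) (C₀ : ℝ) :
    ∃ L : ℝ, 0 ≤ L ∧ ∀ w : E₀, ‖w‖ ≤ C₀ → ‖Ψ w‖ ≤ L ∧ ‖fderiv ℝ Ψ w‖ ≤ L ∧
      ‖fderiv ℝ (fderiv ℝ Ψ) w‖ ≤ L := by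
  have hΨ1 : ContDiff ℝ 1 (fderiv ℝ Ψ) := hΨ.fderiv_right (by norm_num)
  obtain ⟨L0, hL0⟩ := exists_bound_on_closedBall hΨ.continuous C₀
  obtain ⟨L1, hL1⟩ := exists_bound_on_closedBall hΨ1.continuous C₀
  obtain ⟨L2, hL2⟩ := exists_bound_fderiv_on_closedBall hΨ1 C₀
  refine ⟨max 0 (max L0 (max L1 L2)), le_max_left _ _, fun w hw => ?_⟩
  exact ⟨(hL0 w hw).trans (by simp), (hL1 w hw).trans (by simp), (hL2 w hw).trans (by simp)⟩

end HoloComp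

section InnerRules

variable {V : Type*} [NormedAddCommGroup V] [InnerProductSpace ℂ V] [NormedSpace ℝ V]
  [IsScalarTower ℝ ℂ V] {f g : ℂ → V} {z : ℂ}

local notation "⟪" x "," y "⟫" => inner ℂ x y

theorem dz_inner (hf : DifferentiableAt ℝ f z) (hg : DifferentiableAt ℝ g z) :
    dz (fun w => ⟪f w, g w⟫) z = ⟪dbar f z, g z⟫ + ⟪f z, dz g z⟫ := by
  simp only [dz, dbar, fderiv_inner_apply ℂ hf hg, inner_smul_left, inner_smul_right,
    inner_add_left, inner_sub_right, smul_eq_mul, Complex.conj_I, map_div₀, map_one,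
    map_ofNat]
  ring

theorem dbar_inner (hf : DifferentiableAt ℝ f z) (hg : DifferentiableAt ℝ g z) :
    dbar (fun w => ⟪f w, g w⟫) z = ⟪dz f z, g z⟫ + ⟪f z, dbar g z⟫ := by
  simp only [dz, dbar, fderiv_inner_apply ℂ hf hg, inner_smul_left, inner_smul_right,
    inner_sub_left, inner_add_right, smul_eq_mul, Complex.conj_I, map_div₀, map_one,
    map_ofNat]
  ring

theorem DifferentiableAt.inner_complex (hf : DifferentiableAt ℝ f z)
    (hg : DifferentiableAt ℝ g z) : DifferentiableAt ℝ (fun w => ⟪f w, g w⟫) z :=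
  (hf.hasFDerivAt.inner ℂ hg.hasFDerivAt).differentiableAt

theorem ContDiffAt.inner_complex {n : WithTop ℕ∞} (hf : ContDiffAt ℝ n f z)
    (hg : ContDiffAt ℝ n g z) : ContDiffAt ℝ n (fun w => ⟪f w, g w⟫) z := hf.inner ℂ hg

theorem ofReal_norm_sq_eq_inner (f : ℂ → V) :
    (fun w => ((‖f w‖ ^ 2 : ℝ) : ℂ)) = fun w => ⟪f w, f w⟫ := by
  funext w; rw [inner_self_eq_norm_sq_to_K]; push_cast; rfl

theorem dz_norm_sq_holo (hf : DifferentiableAt ℂ f z) :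
    dz (fun w => ((‖f w‖ ^ 2 : ℝ) : ℂ)) z = ⟪f z, deriv f z⟫ := by
  have hr : DifferentiableAt ℝ f z :=
    (hf.hasFDerivAt.restrictScalars ℝ).differentiableAt
  rw [ofReal_norm_sq_eq_inner, dz_inner hr hr, dbar_eq_zero hf, dz_eq_deriv hf, inner_zero_left,
    zero_add]

theorem dz_dbar_norm_sq_holo [CompleteSpace V] (hf : ∀ᶠ w in 𝓝 z, DifferentiableAt ℂ f w) :
    dz (dbar fun w => ((‖f w‖ ^ 2 : ℝ) : ℂ)) z = (‖deriv f z‖ ^ 2 : ℝ) := by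
  have hr : ∀ {g : ℂ → V} {w : ℂ}, DifferentiableAt ℂ g w → DifferentiableAt ℝ g w := fun h =>
    (h.hasFDerivAt.restrictScalars ℝ).differentiableAt
  have hev : dbar (fun w => ((‖f w‖ ^ 2 : ℝ) : ℂ)) =ᶠ[𝓝 z] fun w => ⟪deriv f w, f w⟫ := by
    filter_upwards [hf] with w hw
    rw [ofReal_norm_sq_eq_inner, dbar_inner (hr hw) (hr hw), dbar_eq_zero hw, dz_eq_deriv hw,
      inner_zero_right, add_zero]
  have h0 := hf.self_of_nhds
  have h1 := differentiableAt_deriv_of_eventually hf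
  rw [hev.dz_eq, dz_inner (hr h1) (hr h0), dbar_eq_zero h1, dz_eq_deriv h0, inner_zero_left,
    zero_add, inner_self_eq_norm_sq_to_K]
  push_cast; rfl

end InnerRules

section SmoothExtension

variable {E : Type*} [NormedAddCommGroup E] [NormedSpace ℝ E]

/-- A function smooth on a neighbourhood of the closed unit disk agrees near the closed disk with
a globally smooth function. -/
theorem exists_contDiff_eventuallyEq {f : ℂ → E} {U : Set ℂ} (hU : IsOpen U)
    (hcU : closedBall (0 : ℂ) 1 ⊆ U) (hf : ContDiffOn ℝ (⊤ : ℕ∞) f U) :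
    ∃ g : ℂ → E, ContDiff ℝ (⊤ : ℕ∞) g ∧ ∀ z ∈ closedBall (0 : ℂ) 1, g =ᶠ[𝓝 z] f := by
  obtain ⟨δ, hδ, hsub⟩ := (isCompact_closedBall (0 : ℂ) 1).exists_cthickening_subset_open hU hcU
  rw [cthickening_closedBall hδ.le zero_le_one] at hsub
  let χ : ContDiffBump (0 : ℂ) := ⟨1 + δ / 2, 1 + δ, by positivity, by linarith⟩
  refine ⟨fun z => χ z • f z, ?_, fun z hz => ?_⟩
  · rw [contDiff_iff_contDiffAt]
    intro z
    by_cases hz : z ∈ closedBall (0 : ℂ) (1 + δ)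
    · exact χ.contDiff.contDiffAt.smul (hf.contDiffAt (hU.mem_nhds (hsub (by rwa [add_comm]))))
    · have hz' : z ∉ tsupport χ := by rwa [χ.tsupport_eq]
      have h0 : (fun z => χ z • f z) =ᶠ[𝓝 z] fun _ => 0 := by
        filter_upwards [notMem_tsupport_iff_eventuallyEq.mp hz'] with w hw
        simp [hw]
      exact contDiffAt_const.congr_of_eventuallyEq h0
  · have hz' : z ∈ ball (0 : ℂ) (1 + δ / 2) := by
      rw [mem_closedBall] at hz; rw [mem_ball]; linarith
    filter_upwards [isOpen_ball.mem_nhds hz'] with w hw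
    simp [χ.one_of_mem_closedBall (ball_subset_closedBall hw)]

end SmoothExtension

section Exp

variable {E : Type*} [NormedAddCommGroup E] [NormedSpace ℂ E] [NormedSpace ℝ E]
  [IsScalarTower ℝ ℂ E]

theorem dbar_exp {g : ℂ → ℂ} {z : ℂ} (hg : DifferentiableAt ℝ g z) :
    dbar (fun w => Complex.exp (g w)) z = Complex.exp (g z) * dbar g z := by
  simp only [dbar, hg.hasFDerivAt.cexp.fderiv, _root_.smul_apply, smul_eq_mul]
  ring

end Exp

section RankOne

variable {V : Type*} [NormedAddCommGroup V] [InnerProductSpace ℂ V]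

local notation "⟪" x "," y "⟫" => inner ℂ x y

/-- `p` is the orthogonal projection onto a complex line. -/
def IsRankOneProj (p : V →L[ℂ] V) : Prop := ∃ u : V, ‖u‖ = 1 ∧ ∀ x, p x = ⟪u, x⟫ • u

namespace IsRankOneProj

variable {p q : V →L[ℂ] V} {s x : V}

theorem apply_apply (hp : IsRankOneProj p) (x : V) : p (p x) = p x := by
  obtain ⟨u, hu, h⟩ := hp
  rw [h x, map_smul, h u, inner_self_eq_norm_sq_to_K, hu]
  simp

theorem apply_eq (hp : IsRankOneProj p) (hs : p s = s) (hs0 : s ≠ 0) (x : V) :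
    p x = (⟪s, x⟫ / ⟪s, s⟫) • s := by
  obtain ⟨u, hu, h⟩ := hp
  set c := ⟪u, s⟫ with hc
  have hsu : s = c • u := by rw [hc, ← h, hs]
  have hc0 : c ≠ 0 := by rintro h0; rw [h0, zero_smul] at hsu; exact hs0 hsu
  have huu : ⟪u, u⟫ = 1 := by rw [inner_self_eq_norm_sq_to_K, hu]; simp
  have hcc : (starRingEnd ℂ) c ≠ 0 := by simpa using hc0
  rw [h, hsu, inner_smul_left, inner_smul_left, inner_smul_right, huu, smul_smul]
  congr 1
  field_simp

theorem inner_apply (hp : IsRankOneProj p) (hs : p s = s) (x : V) : ⟪s, p x⟫ = ⟪s, x⟫ := by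
  by_cases hs0 : s = 0
  · simp [hs0]
  have : ⟪s, s⟫ ≠ 0 := inner_self_ne_zero.mpr hs0
  rw [hp.apply_eq hs hs0, inner_smul_right, div_mul_cancel₀ _ this]

theorem apply_eq_zero (hp : IsRankOneProj p) (hs : p s = s) (hs0 : s ≠ 0) (hx : ⟪s, x⟫ = 0) :
    p x = 0 := by
  rw [hp.apply_eq hs hs0, hx]; simp

theorem norm_apply_le (hp : IsRankOneProj p) (x : V) : ‖p x‖ ≤ ‖x‖ := by
  obtain ⟨u, hu, h⟩ := hp
  rw [h, norm_smul, hu, mul_one]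
  simpa [hu] using norm_inner_le_norm (𝕜 := ℂ) u x

theorem norm_sub_apply_sq (hp : IsRankOneProj p) (hs : p s = s) (hs0 : s ≠ 0) (x : V) :
    ‖x - p x‖ ^ 2 = ‖x‖ ^ 2 - ‖⟪s, x⟫‖ ^ 2 / ‖s‖ ^ 2 := by
  have hn : ‖s‖ ≠ 0 := by simpa using hs0
  have horth : ⟪x - p x, p x⟫ = 0 := by
    rw [inner_eq_zero_symm, hp.apply_eq hs hs0, inner_smul_left, inner_sub_right,
      inner_smul_right, div_mul_cancel₀ _ (inner_self_ne_zero.mpr hs0), sub_self, mul_zero]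
  have h := norm_add_sq_eq_norm_sq_add_norm_sq_of_inner_eq_zero (𝕜 := ℂ) _ _ horth
  rw [sub_add_cancel, hp.apply_eq hs hs0, norm_smul, norm_div, inner_self_eq_norm_sq_to_K] at h
  rw [hp.apply_eq hs hs0]
  simp only [norm_pow, coe_algebraMap, norm_real, norm_norm] at h
  have e : ‖⟪s, x⟫‖ / ‖s‖ ^ 2 * ‖s‖ * (‖⟪s, x⟫‖ / ‖s‖ ^ 2 * ‖s‖) = ‖⟪s, x⟫‖ ^ 2 / ‖s‖ ^ 2 := by
    field_simp
  have h' : ‖x‖ * ‖x‖ = ‖x - (⟪s, x⟫ / ⟪s, s⟫) • s‖ ^ 2 + ‖⟪s, x⟫‖ ^ 2 / ‖s‖ ^ 2 := by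
    rw [← e, pow_two ‖x - _‖]; simpa using h
  linarith

end IsRankOneProj

end RankOne

section Nonvanishing

variable {V : Type*} [NormedAddCommGroup V] [InnerProductSpace ℂ V] [NormedSpace ℝ V]
  [IsScalarTower ℝ ℂ V]

/-- A smooth line bundle over the closed disk has a smooth nowhere vanishing section. -/
theorem exists_nonvanishing_section {p : ℂ → V →L[ℂ] V} (hp : ContDiff ℝ (⊤ : ℕ∞) p)
    (h1 : ∀ z ∈ closedBall (0 : ℂ) 1, IsRankOneProj (p z)) :
    ∃ s : ℂ → V, ContDiff ℝ (⊤ : ℕ∞) s ∧ ∀ z ∈ closedBall (0 : ℂ) 1, p z (s z) = s z ∧ s z ≠ 0 := by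
  have huc : UniformContinuousOn p (closedBall 0 1) :=
    (ProperSpace.isCompact_closedBall _ _).uniformContinuousOn_of_continuous hp.continuous.continuousOn
  obtain ⟨δ, hδ, hδp⟩ := Metric.uniformContinuousOn_iff.mp huc 1 one_pos
  obtain ⟨N, hN⟩ := exists_nat_gt (1 / δ)
  have hN0 : (0 : ℝ) < N := lt_trans (by positivity) hN
  obtain ⟨u, hu, hpu⟩ := h1 0 (by simp)
  let c : ℕ → ℝ := fun j => (j : ℝ) / N
  let t : ℕ → ℂ → V := fun j => Nat.rec (fun _ => u) (fun j t z => p (c (j + 1) • z) (t z)) j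
  have ht0 : ∀ z, t 0 z = u := fun _ => rfl
  have hts : ∀ j z, t (j + 1) z = p (c (j + 1) • z) (t j z) := fun _ _ => rfl
  have htsm : ∀ j, ContDiff ℝ (⊤ : ℕ∞) (t j) := by
    intro j
    induction j with
    | zero => exact contDiff_const
    | succ j ih =>
      have h2 : ContDiff ℝ (⊤ : ℕ∞) fun z => p (c (j + 1) • z) :=
        hp.comp (contDiff_const_smul (c (j + 1)))
      have hB : IsBoundedBilinearMap ℝ fun x : (V →L[ℂ] V) × V => x.1 x.2 :=
        { add_left := fun _ _ _ => rfl
          smul_left := fun _ _ _ => rfl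
          add_right := fun _ _ _ => map_add _ _ _
          smul_right := fun c f x => ContinuousLinearMap.map_smul_of_tower f c x
          bound := ⟨1, one_pos, fun f x => by rw [one_mul]; exact f.le_opNorm x⟩ }
      exact hB.contDiff.comp (h2.prodMk ih)
  have hmem : ∀ j ≤ N, ∀ z ∈ closedBall (0 : ℂ) 1, c j • z ∈ closedBall (0 : ℂ) 1 := by
    intro j hj z hz
    rw [mem_closedBall_zero_iff] at hz ⊢
    have : c j ≤ 1 := by
      rw [div_le_one hN0]; exact_mod_cast hj
    have h0 : 0 ≤ c j := by positivity
    rw [norm_smul, Real.norm_of_nonneg h0]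
    exact mul_le_one₀ this (norm_nonneg _) hz
  have key : ∀ j ≤ N, ∀ z ∈ closedBall (0 : ℂ) 1,
      p (c j • z) (t j z) = t j z ∧ t j z ≠ 0 := by
    intro j
    induction j with
    | zero =>
      intro _ z _
      have huu : inner ℂ u u = (1 : ℂ) := by rw [inner_self_eq_norm_sq_to_K, hu]; simp
      refine ⟨?_, ?_⟩
      · simp only [c, ht0, Nat.cast_zero, zero_div, zero_smul, hpu, huu, one_smul]
      · rw [ht0]; rintro rfl; simp at hu
    | succ j ih =>
      intro hj z hz
      obtain ⟨ih1, ih2⟩ := ih (by omega) z hz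
      refine ⟨by rw [hts]; exact (h1 _ (hmem _ hj z hz)).apply_apply _, fun h0 => ih2 ?_⟩
      rw [hts] at h0
      have hd : dist (p (c j • z)) (p (c (j + 1) • z)) < 1 := by
        refine hδp _ (hmem j (by omega) z hz) _ (hmem _ hj z hz) ?_
        rw [dist_eq_norm, ← sub_smul, norm_smul]
        have e : c j - c (j + 1) = - (1 / N) := by
          simp only [c]; push_cast; field_simp; ring
        rw [mem_closedBall_zero_iff] at hz
        rw [e, norm_neg, Real.norm_of_nonneg (by positivity)]
        calc 1 / (N : ℝ) * ‖z‖ ≤ 1 / N * 1 := by gcongr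
          _ < δ := by
            rw [mul_one, div_lt_iff₀ hN0]; rw [div_lt_iff₀ hδ] at hN; linarith
      rw [dist_eq_norm] at hd
      exfalso
      have hpos : 0 < ‖t j z‖ := norm_pos_iff.mpr ih2
      have h3 : ‖t j z‖ ≤ ‖p (c j • z) - p (c (j + 1) • z)‖ * ‖t j z‖ := by
        have := (p (c j • z) - p (c (j + 1) • z)).le_opNorm (t j z)
        rwa [_root_.sub_apply, ih1, h0, sub_zero] at this
      nlinarith
  refine ⟨t N, htsm N, fun z hz => ?_⟩
  have := key N le_rfl z hz
  have e : c N = 1 := div_self hN0.ne'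
  rwa [e, one_smul] at this

end Nonvanishing

section AdaptedSection

variable {V : Type*} [NormedAddCommGroup V] [InnerProductSpace ℂ V] [NormedSpace ℝ V]
  [IsScalarTower ℝ ℂ V]

local notation "⟪" x "," y "⟫" => inner ℂ x y

theorem dz_clm_apply {p : ℂ → V →L[ℂ] V} {s : ℂ → V} {z : ℂ} (hp : DifferentiableAt ℝ p z)
    (hs : DifferentiableAt ℝ s z) :
    dz (fun w => p w (s w)) z = dz p z (s z) + p z (dz s z) :=
  dz_bilin (ContinuousLinearMap.id ℂ (V →L[ℂ] V)) hp hs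

theorem dbar_clm_apply {p : ℂ → V →L[ℂ] V} {s : ℂ → V} {z : ℂ} (hp : DifferentiableAt ℝ p z)
    (hs : DifferentiableAt ℝ s z) :
    dbar (fun w => p w (s w)) z = dbar p z (s z) + p z (dbar s z) :=
  dbar_bilin (ContinuousLinearMap.id ℂ (V →L[ℂ] V)) hp hs

/-- A smooth frame of the line bundle given by `p` whose `dbar`-derivative is orthogonal to it. -/
structure IsAdaptedSection (p : ℂ → V →L[ℂ] V) (s : ℂ → V) : Prop where
  smooth : ContDiff ℝ (⊤ : ℕ∞) s
  apply_eq : ∀ z ∈ closedBall (0 : ℂ) 1, p z (s z) = s z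
  ne_zero : ∀ z ∈ closedBall (0 : ℂ) 1, s z ≠ 0
  inner_dbar : ∀ z ∈ ball (0 : ℂ) 1, ⟪s z, dbar s z⟫ = 0

theorem exists_adaptedSection {p : ℂ → V →L[ℂ] V} (hp : ContDiff ℝ (⊤ : ℕ∞) p)
    (h1 : ∀ z ∈ closedBall (0 : ℂ) 1, IsRankOneProj (p z)) :
    ∃ s : ℂ → V, IsAdaptedSection p s := by
  obtain ⟨s, hs, hps⟩ := exists_nonvanishing_section hp h1
  have hU : IsOpen {z | s z ≠ 0} := isOpen_ne_fun hs.continuous continuous_const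
  have hτ : ContDiffOn ℝ (⊤ : ℕ∞) (fun z => ⟪s z, dbar s z⟫ / ⟪s z, s z⟫) {z | s z ≠ 0} := by
    simp only [div_eq_mul_inv]
    exact (hs.inner ℂ hs.dbar).contDiffOn.mul
      ((hs.inner ℂ hs).contDiffOn.inv fun z hz => inner_self_ne_zero.mpr hz)
  obtain ⟨τ, hτs, hτe⟩ := exists_contDiff_eventuallyEq hU (fun z hz => (hps z hz).2) hτ
  obtain ⟨v, hv, hvd⟩ := exists_dbar_eq hτs
  have hg : ContDiff ℝ (⊤ : ℕ∞) fun z => Complex.exp (-v z) := hv.neg.cexp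
  refine ⟨fun z => Complex.exp (-v z) • s z, hg.smul hs, fun z hz => ?_, fun z hz => ?_,
    fun z hz => ?_⟩
  · rw [map_smul, (hps z hz).1]
  · exact smul_ne_zero (Complex.exp_ne_zero _) (hps z hz).2
  · have hd := hv.differentiable (by simp) z
    have hneg : dbar (fun w => -v w) z = - dbar v z := by
      simpa using dbar_const_mul (-1) hd
    have hne : ⟪s z, s z⟫ ≠ 0 := inner_self_ne_zero.mpr (hps z (ball_subset_closedBall hz)).2
    rw [dbar_smul (hg.differentiable (by simp) z) (hs.differentiable (by simp) z),
      dbar_exp hd.fun_neg, hneg, hvd z (ball_subset_ball (by norm_num) hz),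
      (hτe z (ball_subset_closedBall hz)).self_of_nhds]
    simp only [inner_smul_left, inner_smul_right, inner_add_right]
    field_simp
    ring

namespace IsAdaptedSection

variable {p : ℂ → V →L[ℂ] V} {s : ℂ → V} {z : ℂ}

theorem exp_smul (h : IsAdaptedSection p s) {g : ℂ → ℂ} (hg : Differentiable ℂ g)
    (hgs : ContDiff ℝ (⊤ : ℕ∞) g) : IsAdaptedSection p fun z => Complex.exp (g z) • s z := by
  have he : ContDiff ℝ (⊤ : ℕ∞) fun z => Complex.exp (g z) := hgs.cexp
  refine ⟨he.smul h.smooth, fun z hz => ?_, fun z hz => ?_, fun z hz => ?_⟩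
  · rw [map_smul, h.apply_eq z hz]
  · exact smul_ne_zero (Complex.exp_ne_zero _) (h.ne_zero z hz)
  · rw [dbar_smul (he.differentiable (by simp) z) (h.smooth.differentiable (by simp) z),
      dbar_eq_zero (hg z).cexp, zero_smul, zero_add]
    simp only [inner_smul_left, inner_smul_right, h.inner_dbar z hz, mul_zero]

theorem differentiableAt (h : IsAdaptedSection p s) : DifferentiableAt ℝ s z :=
  h.smooth.differentiable (by simp) z

theorem eventually_apply_eq (h : IsAdaptedSection p s) (hz : z ∈ ball (0 : ℂ) 1) :
    (fun w => p w (s w)) =ᶠ[𝓝 z] s := by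
  filter_upwards [isOpen_ball.mem_nhds hz] with w hw
  exact h.apply_eq w (ball_subset_closedBall hw)

theorem dbar_eq (h : IsAdaptedSection p s) (hp : DifferentiableAt ℝ p z)
    (hz : z ∈ ball (0 : ℂ) 1) (h1 : IsRankOneProj (p z)) : dbar s z = dbar p z (s z) := by
  have hz' := ball_subset_closedBall hz
  rw [← (h.eventually_apply_eq hz).dbar_eq, dbar_clm_apply hp h.differentiableAt,
    h1.apply_eq_zero (h.apply_eq z hz') (h.ne_zero z hz') (h.inner_dbar z hz), add_zero]

theorem dz_sub_eq (h : IsAdaptedSection p s) (hp : DifferentiableAt ℝ p z)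
    (hz : z ∈ ball (0 : ℂ) 1) : dz s z - p z (dz s z) = dz p z (s z) := by
  have e := dz_clm_apply hp (h.differentiableAt (z := z))
  rw [(h.eventually_apply_eq hz).dz_eq] at e
  rw [sub_eq_iff_eq_add]
  exact e

theorem dbar_ofReal_norm_sq (h : IsAdaptedSection p s) (hz : z ∈ ball (0 : ℂ) 1) :
    dbar (fun w => ((‖s w‖ ^ 2 : ℝ) : ℂ)) z = ⟪dz s z, s z⟫ := by
  rw [ofReal_norm_sq_eq_inner, dbar_inner h.differentiableAt h.differentiableAt,
    h.inner_dbar z hz, add_zero]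

theorem dz_ofReal_norm_sq (h : IsAdaptedSection p s) (hz : z ∈ ball (0 : ℂ) 1) :
    dz (fun w => ((‖s w‖ ^ 2 : ℝ) : ℂ)) z = ⟪s z, dz s z⟫ := by
  rw [ofReal_norm_sq_eq_inner, dz_inner h.differentiableAt h.differentiableAt,
    inner_eq_zero_symm.mp (h.inner_dbar z hz), zero_add]

theorem dz_dbar_norm_sq (h : IsAdaptedSection p s) (hz : z ∈ ball (0 : ℂ) 1) :
    dz (dbar fun w => ((‖s w‖ ^ 2 : ℝ) : ℂ)) z = ((‖dz s z‖ ^ 2 - ‖dbar s z‖ ^ 2 : ℝ) : ℂ) := by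
  have hnb := isOpen_ball.mem_nhds hz
  have e1 : (dbar fun w => ((‖s w‖ ^ 2 : ℝ) : ℂ)) =ᶠ[𝓝 z] fun w => ⟪dz s w, s w⟫ := by
    filter_upwards [hnb] with w hw using h.dbar_ofReal_norm_sq hw
  have e2 : (fun w => ⟪s w, dbar s w⟫) =ᶠ[𝓝 z] fun _ => 0 := by
    filter_upwards [hnb] with w hw using h.inner_dbar w hw
  have h2 : ContDiffAt ℝ 2 s z := h.smooth.contDiffAt.of_le (by norm_cast)
  have hdb := h2.differentiableAt_dbar
  have hdz := h2.differentiableAt_dz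
  have e3 := e2.dz_eq
  rw [dz_const, dz_inner h.differentiableAt hdb, inner_self_eq_norm_sq_to_K] at e3
  have e4 : ⟪dz (dbar s) z, s z⟫ = - (‖dbar s z‖ : ℂ) ^ 2 := by
    rw [← inner_conj_symm, eq_neg_of_add_eq_zero_right e3]
    simp
  rw [e1.dz_eq, dz_inner hdz h.differentiableAt, ← dz_dbar_comm h2, e4, inner_self_eq_norm_sq_to_K]
  push_cast
  simp only [coe_algebraMap]
  ring

theorem contDiff_norm_sq (h : IsAdaptedSection p s) :
    ContDiff ℝ (⊤ : ℕ∞) fun z => ‖s z‖ ^ 2 := h.smooth.norm_sq ℂ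

/-- The curvature identity for the norm of an adapted section. -/
theorem dz_dbar_log_norm_sq (h : IsAdaptedSection p s) (hp : DifferentiableAt ℝ p z)
    (hz : z ∈ ball (0 : ℂ) 1) (h1 : IsRankOneProj (p z)) :
    dz (dbar fun w => ((Real.log (‖s w‖ ^ 2) : ℝ) : ℂ)) z =
      (((‖dz p z (s z)‖ ^ 2 - ‖dbar p z (s z)‖ ^ 2) / ‖s z‖ ^ 2 : ℝ) : ℂ) := by
  have hz' := ball_subset_closedBall hz
  have hne : ‖s z‖ ≠ 0 := norm_ne_zero_iff.mpr (h.ne_zero z hz')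
  rw [dz_dbar_log (h.contDiff_norm_sq.contDiffAt.of_le (by norm_cast))
    (by positivity), h.dz_dbar_norm_sq hz, h.dz_ofReal_norm_sq hz, h.dbar_ofReal_norm_sq hz,
    ← h.dz_sub_eq hp hz, h1.norm_sub_apply_sq (h.apply_eq z hz') (h.ne_zero z hz'),
    ← h.dbar_eq hp hz h1, ← inner_conj_symm (dz s z), Complex.mul_conj, Complex.normSq_eq_norm_sq]
  push_cast
  have hne' : (‖s z‖ : ℂ) ≠ 0 := by exact_mod_cast hne
  field_simp
  ring

end IsAdaptedSection

variable {E₀ : Type*} [NormedAddCommGroup E₀] [InnerProductSpace ℂ E₀] [NormedSpace ℝ E₀]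
  [IsScalarTower ℝ ℂ E₀] [CompleteSpace E₀]

/-- If the projections vary at most as fast as a bounded holomorphic map, then an adapted section
with uniformly controlled norm exists. -/
theorem exists_adaptedSection_log_norm_le {p : ℂ → V →L[ℂ] V} (hp : ContDiff ℝ (⊤ : ℕ∞) p)
    (h1 : ∀ z ∈ closedBall (0 : ℂ) 1, IsRankOneProj (p z)) {F : ℂ → E₀}
    (hF : ContDiff ℝ (⊤ : ℕ∞) F) (hFh : ∀ z ∈ ball (0 : ℂ) 1, DifferentiableAt ℂ F z) {C₀ L : ℝ}
    (hFC : ∀ z ∈ closedBall (0 : ℂ) 1, ‖F z‖ ≤ C₀)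
    (hdz : ∀ z ∈ ball (0 : ℂ) 1, ‖dz p z‖ ≤ L * ‖deriv F z‖)
    (hdbar : ∀ z ∈ ball (0 : ℂ) 1, ‖dbar p z‖ ≤ L * ‖deriv F z‖) :
    ∃ s : ℂ → V, IsAdaptedSection p s ∧
      ∀ z ∈ ball (0 : ℂ) 1, |Real.log (‖s z‖ ^ 2)| ≤ 2 + L ^ 2 * C₀ ^ 2 := by
  obtain ⟨s₀, hs₀⟩ := exists_adaptedSection hp h1
  have hlog : ContinuousOn (fun z => -Real.log ‖s₀ z‖) (sphere (0 : ℂ) 1) :=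
    (hs₀.smooth.continuous.norm.continuousOn.log fun z hz =>
      norm_ne_zero_iff.mpr (hs₀.ne_zero z (sphere_subset_closedBall hz))).neg
  obtain ⟨q, hq⟩ := exists_polynomial_re_close hlog one_pos
  have hs := hs₀.exp_smul (g := fun z => q.eval z) q.differentiable (contDiff_polynomial_eval q)
  set s : ℂ → V := fun z => Complex.exp (q.eval z) • s₀ z with hsdef
  refine ⟨s, hs, ?_⟩
  have hcirc : ∀ z ∈ sphere (0 : ℂ) 1, |Real.log (‖s z‖ ^ 2)| ≤ 2 := by
    intro z hz
    have hne : ‖s₀ z‖ ≠ 0 := norm_ne_zero_iff.mpr (hs₀.ne_zero z (sphere_subset_closedBall hz))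
    have h2 := hq z hz
    have e : Real.log (‖s z‖ ^ 2) = 2 * ((q.eval z).re - -Real.log ‖s₀ z‖) := by
      rw [hsdef]
      simp only [norm_smul, Complex.norm_exp]
      rw [Real.log_pow, Real.log_mul (Real.exp_ne_zero _) hne, Real.log_exp]
      push_cast; ring
    rw [e, abs_mul, abs_two, abs_sub_comm]
    linarith
  have hN := hs.contDiff_norm_sq
  have hpos : ∀ z ∈ closedBall (0 : ℂ) 1, 0 < ‖s z‖ ^ 2 := fun z hz =>
    pow_pos (norm_pos_iff.mpr (hs.ne_zero z hz)) 2
  have hF2 : ContDiff ℝ (⊤ : ℕ∞) fun z => ‖F z‖ ^ 2 := hF.norm_sq ℂ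
  have hlogc : ∀ z ∈ closedBall (0 : ℂ) 1,
      ContDiffAt ℝ 2 (fun w => ((Real.log (‖s w‖ ^ 2) : ℝ) : ℂ)) z := fun z hz =>
    ((hN.contDiffAt.of_le (by norm_cast)).log (hpos z hz).ne').ofReal_comp
  have hF2c : ∀ z, ContDiffAt ℝ 2 (fun w => ((‖F w‖ ^ 2 : ℝ) : ℂ)) z := fun z =>
    (hF2.contDiffAt.of_le (by norm_cast)).ofReal_comp
  have main : ∀ σ : ℝ, |σ| = 1 → ∀ z ∈ ball (0 : ℂ) 1,
      σ * Real.log (‖s z‖ ^ 2) ≤ 2 + L ^ 2 * C₀ ^ 2 := by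
    intro σ hσ z hz
    let f : ℂ → ℂ := fun w => (σ : ℂ) * ((Real.log (‖s w‖ ^ 2) : ℝ) : ℂ) +
      ((L ^ 2 : ℝ) : ℂ) * ((‖F w‖ ^ 2 : ℝ) : ℂ)
    have hfre : ∀ w, (f w).re = σ * Real.log (‖s w‖ ^ 2) + L ^ 2 * ‖F w‖ ^ 2 := by
      intro w
      simp only [f, Complex.add_re, Complex.re_ofReal_mul, Complex.ofReal_re]
    have hfc : ∀ w ∈ closedBall (0 : ℂ) 1, ContDiffAt ℝ 2 f w := fun w hw =>
      (contDiffAt_const.mul (hlogc w hw)).add (contDiffAt_const.mul (hF2c w))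
    have hsub := re_le_of_subharmonic (f := f) (M := 2 + L ^ 2 * C₀ ^ 2)
      (fun w hw => (hfc w hw).continuousAt.continuousWithinAt)
      (fun w hw => hfc w (ball_subset_closedBall hw)) ?_ ?_ z hz
    · rw [hfre] at hsub
      have : 0 ≤ L ^ 2 * ‖F z‖ ^ 2 := by positivity
      linarith
    · intro w hw
      have hw' := ball_subset_closedBall hw
      have hFe : ∀ᶠ y in 𝓝 w, DifferentiableAt ℂ F y := by
        filter_upwards [isOpen_ball.mem_nhds hw] with y hy using hFh y hy
      have e : dz (dbar f) w = (((σ * ((‖dz p w (s w)‖ ^ 2 - ‖dbar p w (s w)‖ ^ 2) / ‖s w‖ ^ 2) +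
          L ^ 2 * ‖deriv F w‖ ^ 2 : ℝ)) : ℂ) := by
        rw [dz_dbar_add (contDiffAt_const.mul (hlogc w hw')) (contDiffAt_const.mul (hF2c w)),
          dz_dbar_const_mul _ (hlogc w hw'), dz_dbar_const_mul _ (hF2c w),
          hs.dz_dbar_log_norm_sq (hp.differentiable (by simp) w) hw (h1 w hw'),
          dz_dbar_norm_sq_holo hFe]
        push_cast; ring
      rw [e, Complex.ofReal_re]
      have hb : ∀ T : V →L[ℂ] V, ‖T‖ ≤ L * ‖deriv F w‖ →
          ‖T (s w)‖ ^ 2 / ‖s w‖ ^ 2 ≤ L ^ 2 * ‖deriv F w‖ ^ 2 := by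
        intro T hT
        rw [div_le_iff₀ (hpos w hw'), ← mul_pow, ← mul_pow]
        exact pow_le_pow_left₀ (norm_nonneg _) ((T.le_opNorm _).trans (by gcongr)) 2
      have b1 := hb _ (hdz w hw)
      have b2 := hb _ (hdbar w hw)
      have n1 : 0 ≤ ‖dz p w (s w)‖ ^ 2 / ‖s w‖ ^ 2 := by positivity
      have n2 : 0 ≤ ‖dbar p w (s w)‖ ^ 2 / ‖s w‖ ^ 2 := by positivity
      rw [sub_div]
      rcases (abs_eq zero_le_one).mp hσ with rfl | rfl <;> linarith
    · intro w hw
      rw [hfre]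
      have b1 := hcirc w hw
      have b2 : σ * Real.log (‖s w‖ ^ 2) ≤ |Real.log (‖s w‖ ^ 2)| := by
        calc _ ≤ |σ * Real.log (‖s w‖ ^ 2)| := le_abs_self _
          _ = _ := by rw [abs_mul, hσ, one_mul]
      have b3 := hFC w (sphere_subset_closedBall hw)
      have b4 : L ^ 2 * ‖F w‖ ^ 2 ≤ L ^ 2 * C₀ ^ 2 := by gcongr
      linarith
  intro z hz
  rw [abs_le]
  have m1 := main 1 (by simp) z hz
  have m2 := main (-1) (by simp) z hz
  constructor <;> linarith

end AdaptedSection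

section CarlesonWeight

/-- The conditions on a weight in the bounded `dbar` theorem. -/
structure CarlesonWeight (B C : ℝ) (Φ e : ℂ → ℝ) : Prop where
  hB : 0 ≤ B
  hC : 0 ≤ C
  smooth : ContDiff ℝ (⊤ : ℕ∞) Φ
  nonneg : ∀ z ∈ ball (0 : ℂ) 1, 0 ≤ e z
  weight_nonneg : ∀ z ∈ ball (0 : ℂ) 1, 0 ≤ Φ z
  weight_le : ∀ z ∈ ball (0 : ℂ) 1, Φ z ≤ B
  dz_weight_le : ∀ z ∈ ball (0 : ℂ) 1, ‖dz (fun w => (Φ w : ℂ)) z‖ ≤ C * e z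
  le_dz_dbar_weight : ∀ z ∈ ball (0 : ℂ) 1, e z ^ 2 ≤ (dz (dbar fun w => (Φ w : ℂ)) z).re

variable {V : Type*} [NormedAddCommGroup V] [InnerProductSpace ℂ V] [NormedSpace ℝ V]
  [IsScalarTower ℝ ℂ V] [FiniteDimensional ℂ V]

theorem CarlesonWeight.exists_bounded_dbar {B C : ℝ} {Φ e : ℂ → ℝ} (h : CarlesonWeight B C Φ e)
    {G : ℂ → V} {A : ℝ} (hA : 0 ≤ A) (hG : ContDiff ℝ (⊤ : ℕ∞) G)
    (h1 : ∀ z ∈ ball (0 : ℂ) 1, ‖G z‖ ≤ A * e z)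
    (h2 : ∀ z ∈ ball (0 : ℂ) 1, ‖dz G z‖ ≤ A * e z ^ 2) :
    ∃ v : ℂ → V, ∀ z ∈ ball (0 : ℂ) 1, DifferentiableAt ℝ v z ∧ dbar v z = G z ∧
      ‖v z‖ ≤ Module.finrank ℂ V * (A * ((2 * C + 1) ^ 2 + 3 * B)) := by
  let b := stdOrthonormalBasis ℂ V
  have hle : ∀ k x, ‖innerSL ℂ (b k) x‖ ≤ ‖x‖ := by
    intro k x
    simpa [b.orthonormal.1 k] using norm_inner_le_norm (𝕜 := ℂ) (b k) x
  have hk : ∀ k, ∃ v : ℂ → ℂ, ∀ z ∈ ball (0 : ℂ) 1, DifferentiableAt ℝ v z ∧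
      dbar v z = innerSL ℂ (b k) (G z) ∧ ‖v z‖ ≤ A * ((2 * C + 1) ^ 2 + 3 * B) := by
    intro k
    refine CarlesonData.exists_bounded_dbar (Φ := Φ) (e := e)
      ⟨hA, h.hB, h.hC, ?_, h.smooth, h.nonneg, fun z hz => (hle k _).trans (h1 z hz),
        fun z hz => ?_, h.weight_nonneg, h.weight_le, h.dz_weight_le, h.le_dz_dbar_weight⟩
    · exact ((innerSL ℂ (b k)).restrictScalars ℝ).contDiff.comp hG
    · rw [dz_clm _ (hG.differentiable (by simp) z)]
      exact (hle k _).trans (h2 z hz)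
  choose v hv using hk
  refine ⟨fun z => ∑ k, v k z • b k, fun z hz => ⟨?_, ?_, ?_⟩⟩
  · exact DifferentiableAt.fun_sum fun k _ => (hv k z hz).1.smul_const (b k)
  · rw [dbar_sum _ fun k _ => (hv k z hz).1.smul_const (b k)]
    conv_rhs => rw [← b.sum_repr' (G z)]
    refine Finset.sum_congr rfl fun k _ => ?_
    rw [dbar_smul (hv k z hz).1 (differentiableAt_const _), dbar_const, smul_zero, add_zero,
      (hv k z hz).2.1]
    rfl
  · refine (norm_sum_le _ _).trans ?_
    refine (Finset.sum_le_card_nsmul _ _ (A * ((2 * C + 1) ^ 2 + 3 * B)) fun k _ => ?_).trans ?_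
    · rw [norm_smul, b.orthonormal.1 k, mul_one]
      exact (hv k z hz).2.2
    · simp

end CarlesonWeight

section Localization

variable {E₀ V : Type*} [NormedAddCommGroup E₀] [InnerProductSpace ℂ E₀] [NormedSpace ℝ E₀]
  [IsScalarTower ℝ ℂ E₀] [NormedAddCommGroup V] [InnerProductSpace ℂ V] [NormedSpace ℝ V]
  [IsScalarTower ℝ ℂ V]

local notation "⟪" x "," y "⟫" => inner ℂ x y

/-- A globally smooth map, holomorphic on the unit disk and bounded by `C₀` on its closure. -/
structure IsBoundedHolo (F : ℂ → E₀) (C₀ : ℝ) : Prop where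
  smooth : ContDiff ℝ (⊤ : ℕ∞) F
  holo : ∀ z ∈ ball (0 : ℂ) 1, DifferentiableAt ℂ F z
  norm_le : ∀ z ∈ closedBall (0 : ℂ) 1, ‖F z‖ ≤ C₀

theorem IsBoundedHolo.eventually {F : ℂ → E₀} {C₀ : ℝ} (hF : IsBoundedHolo F C₀) {z : ℂ}
    (hz : z ∈ ball (0 : ℂ) 1) : ∀ᶠ w in 𝓝 z, DifferentiableAt ℂ F w := by
  filter_upwards [isOpen_ball.mem_nhds hz] with w hw using hF.holo w hw

section SqrtWeight

variable [CompleteSpace E₀] {F : ℂ → E₀} {C₀ ε : ℝ}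

theorem contDiff_dist_sq (hF : IsBoundedHolo F C₀) (lam : E₀) : ContDiff ℝ (⊤ : ℕ∞) fun z => ‖F z - lam‖ ^ 2 + ε ^ 2 :=
  ((hF.smooth.sub contDiff_const).norm_sq ℂ).add contDiff_const

theorem dz_dist_sq (hF : IsBoundedHolo F C₀) (lam : E₀)
    {z : ℂ} (hz : z ∈ ball (0 : ℂ) 1) :
    dz (fun w => ((‖F w - lam‖ ^ 2 + ε ^ 2 : ℝ) : ℂ)) z = ⟪F z - lam, deriv F z⟫ := by
  have h1 : DifferentiableAt ℝ (fun w => ((‖F w - lam‖ ^ 2 : ℝ) : ℂ)) z :=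
    (((hF.smooth.sub contDiff_const).norm_sq ℂ).differentiable (by simp) z).ofReal_comp'
  have e : (fun w => ((‖F w - lam‖ ^ 2 + ε ^ 2 : ℝ) : ℂ)) =
      fun w => ((‖F w - lam‖ ^ 2 : ℝ) : ℂ) + ((ε ^ 2 : ℝ) : ℂ) := by funext w; push_cast; ring
  rw [e, dz_add h1 (differentiableAt_const _), dz_const, add_zero,
    dz_norm_sq_holo ((hF.holo z hz).sub_const lam), deriv_sub_const]

theorem norm_dz_dist_sq_le (hF : IsBoundedHolo F C₀) (lam : E₀)
    {z : ℂ} (hz : z ∈ ball (0 : ℂ) 1) :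
    ‖dz (fun w => ((‖F w - lam‖ ^ 2 + ε ^ 2 : ℝ) : ℂ)) z‖ ≤ ‖F z - lam‖ * ‖deriv F z‖ := by
  rw [dz_dist_sq hF lam hz]; exact norm_inner_le_norm _ _

theorem dz_dbar_dist_sq (hF : IsBoundedHolo F C₀) (lam : E₀)
    {z : ℂ} (hz : z ∈ ball (0 : ℂ) 1) :
    dz (dbar fun w => ((‖F w - lam‖ ^ 2 + ε ^ 2 : ℝ) : ℂ)) z = (‖deriv F z‖ ^ 2 : ℝ) := by
  have h1 : ContDiffAt ℝ 2 (fun w => ((‖F w - lam‖ ^ 2 : ℝ) : ℂ)) z :=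
    (((hF.smooth.sub contDiff_const).norm_sq ℂ).contDiffAt.of_le (by norm_cast)).ofReal_comp
  have e : (fun w => ((‖F w - lam‖ ^ 2 + ε ^ 2 : ℝ) : ℂ)) =
      fun w => ((‖F w - lam‖ ^ 2 : ℝ) : ℂ) + ((ε ^ 2 : ℝ) : ℂ) := by funext w; push_cast; ring
  have h0 : (dbar fun _ : ℂ => ((ε ^ 2 : ℝ) : ℂ)) = fun _ => 0 := funext fun w => dbar_const _ w
  have h2 : ∀ᶠ w in 𝓝 z, DifferentiableAt ℂ (fun w => F w - lam) w :=
    (hF.eventually hz).mono fun w hw => hw.sub_const lam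
  rw [e, dz_dbar_add h1 contDiffAt_const, h0, dz_const, add_zero, dz_dbar_norm_sq_holo h2,
    deriv_sub_const]

theorem norm_dz_sqrt_dist_le (hF : IsBoundedHolo F C₀) (lam : E₀) (hε : 0 < ε)
    {z : ℂ} (hz : z ∈ ball (0 : ℂ) 1) :
    ‖dz (fun w => ((√(‖F w - lam‖ ^ 2 + ε ^ 2) : ℝ) : ℂ)) z‖ ≤ ‖deriv F z‖ / 2 := by
  have h0 : 0 < ‖F z - lam‖ ^ 2 + ε ^ 2 := by positivity
  rw [dz_sqrt ((contDiff_dist_sq hF lam).differentiable (by simp) z) h0, norm_div,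
    Complex.norm_real, Real.norm_of_nonneg (by positivity)]
  have h1 := norm_dz_dist_sq_le hF lam (ε := ε) hz
  have h2 : ‖F z - lam‖ ≤ √(‖F z - lam‖ ^ 2 + ε ^ 2) :=
    Real.le_sqrt_of_sq_le (by nlinarith [sq_nonneg ε])
  have h3 := Real.sqrt_pos.mpr h0
  rw [div_le_div_iff₀ (by positivity) two_pos]
  have h4 := mul_le_mul_of_nonneg_right h2 (norm_nonneg (deriv F z))
  nlinarith

theorem le_dz_dbar_sqrt_dist (hF : IsBoundedHolo F C₀) (lam : E₀) (hε : 0 < ε)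
    {z : ℂ} (hz : z ∈ ball (0 : ℂ) 1) :
    ‖deriv F z‖ ^ 2 / √(‖F z - lam‖ ^ 2 + ε ^ 2) ≤
      4 * (dz (dbar fun w => ((√(‖F w - lam‖ ^ 2 + ε ^ 2) : ℝ) : ℂ)) z).re := by
  have h0 : 0 < ‖F z - lam‖ ^ 2 + ε ^ 2 := by positivity
  have h3 := Real.sqrt_pos.mpr h0
  rw [dz_dbar_sqrt ((contDiff_dist_sq hF lam).contDiffAt.of_le (by norm_cast)) h0,
    dz_dbar_dist_sq hF lam hz, Complex.ofReal_re]
  have h1 := norm_dz_dist_sq_le hF lam (ε := ε) hz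
  have h2 : ‖dz (fun w => ((‖F w - lam‖ ^ 2 + ε ^ 2 : ℝ) : ℂ)) z‖ ^ 2 /
      (2 * (‖F z - lam‖ ^ 2 + ε ^ 2)) ≤ ‖deriv F z‖ ^ 2 / 2 := by
    rw [div_le_div_iff₀ (by positivity) two_pos]
    have := pow_le_pow_left₀ (norm_nonneg _) h1 2
    rw [mul_pow] at this
    nlinarith [mul_nonneg (sq_nonneg ‖deriv F z‖) (sq_nonneg ε)]
  rw [← mul_div_assoc, div_le_div_iff₀ h3 (by positivity)]
  nlinarith

end SqrtWeight

theorem carlesonWeight_adapted [CompleteSpace E₀] {F : ℂ → E₀} {C₀ : ℝ} (hF : IsBoundedHolo F C₀)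
    {p : ℂ → V →L[ℂ] V} {s : ℂ → V} (hp : ContDiff ℝ (⊤ : ℕ∞) p)
    (h1 : ∀ z ∈ closedBall (0 : ℂ) 1, IsRankOneProj (p z)) (hs : IsAdaptedSection p s) {S L : ℝ}
    (hS0 : 0 ≤ S) (hS : ∀ z ∈ ball (0 : ℂ) 1, ‖s z‖ ≤ S)
    (hdbar : ∀ z ∈ ball (0 : ℂ) 1, ‖dbar p z‖ ≤ L * ‖deriv F z‖) {lam : E₀} (hlam : ‖lam‖ ≤ C₀)
    {ε : ℝ} (hε : 0 < ε) (hε1 : ε ≤ 1) :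
    CarlesonWeight (S ^ 2 + (L ^ 2 * S ^ 2 + 1) * C₀ ^ 2 + 4 * (2 * C₀ + 1))
      (S + (L ^ 2 * S ^ 2 + 1) * C₀ + 2)
      (fun z => ‖s z‖ ^ 2 + (L ^ 2 * S ^ 2 + 1) * ‖F z‖ ^ 2 + 4 * √(‖F z - lam‖ ^ 2 + ε ^ 2))
      (fun z => √(‖dz s z‖ ^ 2 + ‖deriv F z‖ ^ 2 +
        ‖deriv F z‖ ^ 2 / √(‖F z - lam‖ ^ 2 + ε ^ 2))) := by
  have hC0 : 0 ≤ C₀ := (norm_nonneg _).trans hlam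
  set c := L ^ 2 * S ^ 2 + 1 with hc
  have hc0 : 0 < c := by positivity
  have hN0 : ∀ z, 0 < ‖F z - lam‖ ^ 2 + ε ^ 2 := fun z => by positivity
  have sm1 : ContDiff ℝ (⊤ : ℕ∞) fun z => ‖s z‖ ^ 2 := hs.contDiff_norm_sq
  have sm2 : ContDiff ℝ (⊤ : ℕ∞) fun z => ‖F z‖ ^ 2 := hF.smooth.norm_sq ℂ
  have sm3 : ContDiff ℝ (⊤ : ℕ∞) fun z => √(‖F z - lam‖ ^ 2 + ε ^ 2) :=
    (contDiff_dist_sq hF lam).sqrt fun z => (hN0 z).ne'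
  have cast : (fun w => ((‖s w‖ ^ 2 + c * ‖F w‖ ^ 2 + 4 * √(‖F w - lam‖ ^ 2 + ε ^ 2) : ℝ) : ℂ)) =
      fun w => (((‖s w‖ ^ 2 : ℝ) : ℂ) + (c : ℂ) * ((‖F w‖ ^ 2 : ℝ) : ℂ)) +
        ((4 : ℝ) : ℂ) * ((√(‖F w - lam‖ ^ 2 + ε ^ 2) : ℝ) : ℂ) := by
    funext w; push_cast; ring
  have cd : ∀ {N : ℂ → ℝ}, ContDiff ℝ (⊤ : ℕ∞) N → ∀ z, ContDiffAt ℝ 2 (fun w => (N w : ℂ)) z :=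
    fun hN z => (hN.contDiffAt.of_le (by norm_cast)).ofReal_comp
  have df : ∀ {N : ℂ → ℝ}, ContDiff ℝ (⊤ : ℕ∞) N → ∀ z, DifferentiableAt ℝ (fun w => (N w : ℂ)) z :=
    fun hN z => (hN.differentiable (by simp) z).ofReal_comp'
  have hq0 : ∀ z, 0 ≤ ‖deriv F z‖ ^ 2 / √(‖F z - lam‖ ^ 2 + ε ^ 2) := fun z => by positivity
  refine ⟨by positivity, by positivity, (sm1.add (contDiff_const.mul sm2)).add
    (contDiff_const.mul sm3), fun z _ => Real.sqrt_nonneg _, fun z _ => by positivity,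
    fun z hz => ?_, fun z hz => ?_, fun z hz => ?_⟩
  · have b1 := hF.norm_le z (ball_subset_closedBall hz)
    have b2 : √(‖F z - lam‖ ^ 2 + ε ^ 2) ≤ 2 * C₀ + 1 := by
      rw [Real.sqrt_le_left (by positivity)]
      have b3 : ‖F z - lam‖ ≤ 2 * C₀ := (norm_sub_le _ _).trans (by linarith)
      have b4 := pow_le_pow_left₀ (norm_nonneg _) b3 2
      have b5 : ε ^ 2 ≤ 1 := pow_le_one₀ hε.le hε1
      nlinarith
    have b6 := pow_le_pow_left₀ (norm_nonneg _) b1 2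
    have b7 := pow_le_pow_left₀ (norm_nonneg _) (hS z hz) 2
    have b8 := mul_le_mul_of_nonneg_left b6 hc0.le
    linarith
  · simp only [cast]
    rw [dz_add ((df sm1 z).fun_add ((df sm2 z).const_mul _)) ((df sm3 z).const_mul _),
      dz_add (df sm1 z) ((df sm2 z).const_mul _), dz_const_mul _ (df sm2 z),
      dz_const_mul _ (df sm3 z), hs.dz_ofReal_norm_sq hz, dz_norm_sq_holo (hF.holo z hz)]
    set e := √(‖dz s z‖ ^ 2 + ‖deriv F z‖ ^ 2 + ‖deriv F z‖ ^ 2 / √(‖F z - lam‖ ^ 2 + ε ^ 2))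
    have e1 : ‖dz s z‖ ≤ e := Real.le_sqrt_of_sq_le (by
      have := hq0 z; have := sq_nonneg ‖deriv F z‖; linarith)
    have e2 : ‖deriv F z‖ ≤ e := Real.le_sqrt_of_sq_le (by
      have := hq0 z; have := sq_nonneg ‖dz s z‖; linarith)
    have b1 : ‖⟪s z, dz s z⟫‖ ≤ S * e := (norm_inner_le_norm _ _).trans (by
      have := hS z hz; gcongr)
    have b2 : ‖⟪F z, deriv F z⟫‖ ≤ C₀ * e := (norm_inner_le_norm _ _).trans (by
      have := hF.norm_le z (ball_subset_closedBall hz); gcongr)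
    have b3 := norm_dz_sqrt_dist_le hF lam hε hz
    refine (norm_add₃_le).trans ?_
    rw [norm_mul, norm_mul, Complex.norm_real, Complex.norm_real, Real.norm_of_nonneg hc0.le,
      Real.norm_of_nonneg (by norm_num : (0 : ℝ) ≤ 4)]
    have b4 := mul_le_mul_of_nonneg_left b2 hc0.le
    nlinarith
  · have hnn : 0 ≤ ‖dz s z‖ ^ 2 + ‖deriv F z‖ ^ 2 +
        ‖deriv F z‖ ^ 2 / √(‖F z - lam‖ ^ 2 + ε ^ 2) := by positivity
    simp only [cast]
    rw [Real.sq_sqrt hnn, dz_dbar_add ((cd sm1 z).add (contDiffAt_const.mul (cd sm2 z)))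
      (contDiffAt_const.mul (cd sm3 z)), dz_dbar_add (cd sm1 z) (contDiffAt_const.mul (cd sm2 z)),
      dz_dbar_const_mul _ (cd sm2 z), dz_dbar_const_mul _ (cd sm3 z), hs.dz_dbar_norm_sq hz,
      dz_dbar_norm_sq_holo (hF.eventually hz)]
    simp only [Complex.add_re, Complex.re_ofReal_mul, Complex.ofReal_re]
    have b1 := le_dz_dbar_sqrt_dist hF lam hε hz
    have b2 : ‖dbar s z‖ ≤ L * ‖deriv F z‖ * S := by
      rw [hs.dbar_eq (hp.differentiable (by simp) z) hz (h1 z (ball_subset_closedBall hz))]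
      refine (ContinuousLinearMap.le_opNorm _ _).trans ?_
      exact mul_le_mul (hdbar z hz) (hS z hz) (norm_nonneg _) ((norm_nonneg _).trans (hdbar z hz))
    have b3 := pow_le_pow_left₀ (norm_nonneg _) b2 2
    rw [hc]
    nlinarith

end Localization

section LocalizationRhs

variable {E₀ V : Type*} [NormedAddCommGroup E₀] [InnerProductSpace ℂ E₀] [NormedSpace ℝ E₀]
  [IsScalarTower ℝ ℂ E₀] [NormedAddCommGroup V] [InnerProductSpace ℂ V] [NormedSpace ℝ V]
  [IsScalarTower ℝ ℂ V]

local notation "⟪" x "," y "⟫" => inner ℂ x y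

theorem ContDiff.differentiableAt_top {W : Type*} [NormedAddCommGroup W] [NormedSpace ℝ W]
    {f : ℂ → W} (hf : ContDiff ℝ (⊤ : ℕ∞) f) {z : ℂ} : DifferentiableAt ℝ f z :=
  hf.differentiable (by simp) z

theorem rhs_estimate {R D t S L α a r : ℝ} (hr : 0 < r) (hR : 0 ≤ R) (hS : 1 ≤ S)
    (hα : 0 ≤ α) (ha : 0 ≤ a) (hRr : R ≤ r) (har : a ≤ α * r)
    (haR : a * R ≤ α * r ^ 2) :
    a * ((R * D / (r ^ 2) ^ 2) * ((L * R) * (L * D * S)) +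
      (r ^ 2)⁻¹ * ((L * D) * (L * D * S) + (L * R) * (L * D ^ 2 * S + L * D * t))) ≤
      2 * S * L ^ 2 * α * (t ^ 2 + D ^ 2 + D ^ 2 / r) := by
  have hx : a / r ^ 2 ≤ α / r := by
    rw [div_le_div_iff₀ (by positivity) hr]; nlinarith
  have hy : a * R / r ^ 2 ≤ α := by rwa [div_le_iff₀ (by positivity)]
  have hw : R ^ 2 / r ^ 2 ≤ 1 := by
    rw [div_le_one (by positivity)]; exact pow_le_pow_left₀ hR hRr 2
  have hx0 : 0 ≤ a / r ^ 2 := by positivity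
  have hy0 : 0 ≤ a * R / r ^ 2 := by positivity
  have e : a * ((R * D / (r ^ 2) ^ 2) * ((L * R) * (L * D * S)) +
      (r ^ 2)⁻¹ * ((L * D) * (L * D * S) + (L * R) * (L * D ^ 2 * S + L * D * t))) =
      L ^ 2 * S * D ^ 2 * (a / r ^ 2 * (R ^ 2 / r ^ 2)) + L ^ 2 * S * D ^ 2 * (a / r ^ 2) +
      L ^ 2 * S * D ^ 2 * (a * R / r ^ 2) + L ^ 2 * (D * t) * (a * R / r ^ 2) := by
    field_simp; ring
  have hLSD : 0 ≤ L ^ 2 * S * D ^ 2 := by positivity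
  have t1 : L ^ 2 * S * D ^ 2 * (a / r ^ 2 * (R ^ 2 / r ^ 2)) ≤ L ^ 2 * S * D ^ 2 * (α / r) :=
    mul_le_mul_of_nonneg_left ((mul_le_of_le_one_right hx0 hw).trans hx) hLSD
  have t2 := mul_le_mul_of_nonneg_left hx hLSD
  have t3 := mul_le_mul_of_nonneg_left hy hLSD
  have hDt : D * t ≤ (D ^ 2 + t ^ 2) / 2 := by nlinarith [sq_nonneg (D - t)]
  have t4 : L ^ 2 * (D * t) * (a * R / r ^ 2) ≤ L ^ 2 * ((D ^ 2 + t ^ 2) / 2) * α := by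
    refine mul_le_mul (mul_le_mul_of_nonneg_left hDt (sq_nonneg L)) hy hy0 (by positivity)
  rw [e]
  have h5 : L ^ 2 * ((D ^ 2 + t ^ 2) / 2) * α ≤ L ^ 2 * S * α * (D ^ 2 + 2 * t ^ 2) := by
    have : (D ^ 2 + t ^ 2) / 2 ≤ S * (D ^ 2 + 2 * t ^ 2) := by nlinarith [sq_nonneg D, sq_nonneg t]
    calc _ ≤ L ^ 2 * (S * (D ^ 2 + 2 * t ^ 2)) * α := by gcongr
      _ = _ := by ring
  have h6 : 2 * S * L ^ 2 * α * (t ^ 2 + D ^ 2 + D ^ 2 / r) =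
      L ^ 2 * S * D ^ 2 * (α / r) + L ^ 2 * S * D ^ 2 * (α / r) + L ^ 2 * S * D ^ 2 * α +
        L ^ 2 * S * α * (D ^ 2 + 2 * t ^ 2) := by
    field_simp; ring
  linarith

variable [CompleteSpace E₀]

theorem dz_inv_dist_sq {F : ℂ → E₀} {C₀ : ℝ} (hF : IsBoundedHolo F C₀) (lam : E₀) {ε : ℝ}
    (hε : 0 < ε) {z : ℂ} (hz : z ∈ ball (0 : ℂ) 1) :
    ‖dz (fun w => (((‖F w - lam‖ ^ 2 + ε ^ 2)⁻¹ : ℝ) : ℂ)) z‖ ≤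
      ‖F z - lam‖ * ‖deriv F z‖ / (‖F z - lam‖ ^ 2 + ε ^ 2) ^ 2 := by
  have h0 : 0 < ‖F z - lam‖ ^ 2 + ε ^ 2 := by positivity
  rw [dz_comp_real (φ := fun x => x⁻¹) ((contDiff_dist_sq hF lam).differentiable (by simp) z)
    (differentiableAt_inv h0.ne'), norm_mul, deriv_inv, Complex.norm_real, norm_neg,
    Real.norm_of_nonneg (by positivity), inv_mul_eq_div]
  gcongr
  exact norm_dz_dist_sq_le hF lam hz

theorem norm_dbar_adapted_le {F : ℂ → E₀} {p : ℂ → V →L[ℂ] V} {s : ℂ → V}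
    (hp : ContDiff ℝ (⊤ : ℕ∞) p) (h1 : ∀ z ∈ closedBall (0 : ℂ) 1, IsRankOneProj (p z))
    (hs : IsAdaptedSection p s) {S L : ℝ} (hS : ∀ z ∈ ball (0 : ℂ) 1, ‖s z‖ ≤ S)
    (hdbar : ∀ z ∈ ball (0 : ℂ) 1, ‖dbar p z‖ ≤ L * ‖deriv F z‖) {z : ℂ}
    (hz : z ∈ ball (0 : ℂ) 1) : ‖dbar s z‖ ≤ L * ‖deriv F z‖ * S := by
  rw [hs.dbar_eq (hp.differentiable (by simp) z) hz (h1 z (ball_subset_closedBall hz))]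
  exact ((dbar p z).le_opNorm _).trans (mul_le_mul (hdbar z hz) (hS z hz) (norm_nonneg _)
    ((norm_nonneg _).trans (hdbar z hz)))

theorem norm_dz_dbar_adapted_le {F : ℂ → E₀} {p : ℂ → V →L[ℂ] V} {s : ℂ → V}
    (hp : ContDiff ℝ (⊤ : ℕ∞) p) (h1 : ∀ z ∈ closedBall (0 : ℂ) 1, IsRankOneProj (p z))
    (hs : IsAdaptedSection p s) {S L : ℝ} (hS : ∀ z ∈ ball (0 : ℂ) 1, ‖s z‖ ≤ S)
    (hdbar : ∀ z ∈ ball (0 : ℂ) 1, ‖dbar p z‖ ≤ L * ‖deriv F z‖)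
    (hdd : ∀ z ∈ ball (0 : ℂ) 1, ‖dz (dbar p) z‖ ≤ L * ‖deriv F z‖ ^ 2) {z : ℂ}
    (hz : z ∈ ball (0 : ℂ) 1) :
    ‖dz (dbar s) z‖ ≤ L * ‖deriv F z‖ ^ 2 * S + L * ‖deriv F z‖ * ‖dz s z‖ := by
  have e : dbar s =ᶠ[𝓝 z] fun w => dbar p w (s w) := by
    filter_upwards [isOpen_ball.mem_nhds hz] with w hw
    exact hs.dbar_eq (hp.differentiable (by simp) w) hw (h1 w (ball_subset_closedBall hw))
  rw [e.dz_eq, dz_clm_apply (hp.dbar.differentiable (by simp) z) hs.differentiableAt]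
  refine (norm_add_le _ _).trans (add_le_add ?_ ?_)
  · exact ((dz (dbar p) z).le_opNorm _).trans (mul_le_mul (hdd z hz) (hS z hz) (norm_nonneg _)
      ((norm_nonneg _).trans (hdd z hz)))
  · exact ((dbar p z).le_opNorm _).trans (mul_le_mul_of_nonneg_right (hdbar z hz) (norm_nonneg _))

theorem contDiff_clm_apply_real {p : ℂ → V →L[ℂ] V} {s : ℂ → V} (hp : ContDiff ℝ (⊤ : ℕ∞) p)
    (hs : ContDiff ℝ (⊤ : ℕ∞) s) : ContDiff ℝ (⊤ : ℕ∞) fun z => p z (s z) :=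
  (isBoundedBilinearMap_apply (𝕜 := ℝ) (E := V) (F := V)).contDiff.comp
    (((ContinuousLinearMap.restrictScalarsL ℂ V V ℝ ℝ).contDiff.comp hp).prodMk hs)

/-- Solution of the `dbar`-equation for one term of the localized division problem. -/
theorem exists_dbar_localized [FiniteDimensional ℂ V] {F : ℂ → E₀} {C₀ : ℝ}
    (hF : IsBoundedHolo F C₀) {p : ℂ → V →L[ℂ] V} {s : ℂ → V} (hp : ContDiff ℝ (⊤ : ℕ∞) p)
    (h1 : ∀ z ∈ closedBall (0 : ℂ) 1, IsRankOneProj (p z)) (hs : IsAdaptedSection p s) {S L : ℝ}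
    (hS1 : 1 ≤ S) (hL : 0 ≤ L) (hS : ∀ z ∈ ball (0 : ℂ) 1, ‖s z‖ ≤ S)
    (hdz : ∀ z ∈ ball (0 : ℂ) 1, ‖dz p z‖ ≤ L * ‖deriv F z‖)
    (hdbar : ∀ z ∈ ball (0 : ℂ) 1, ‖dbar p z‖ ≤ L * ‖deriv F z‖)
    (hdd : ∀ z ∈ ball (0 : ℂ) 1, ‖dz (dbar p) z‖ ≤ L * ‖deriv F z‖ ^ 2)
    {lam : E₀} (hlam : ‖lam‖ ≤ C₀) {Q : V →L[ℂ] V}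
    (hQ : ∀ z ∈ ball (0 : ℂ) 1, ‖Q - p z‖ ≤ L * ‖F z - lam‖)
    {ε : ℝ} (hε : 0 < ε) (hε1 : ε ≤ 1) {κ : ℂ → ℂ} (hκ : ContDiff ℝ (⊤ : ℕ∞) κ)
    (hκ0 : ∀ z ∈ ball (0 : ℂ) 1, dz κ z = 0) {α : ℝ} (hα : 0 ≤ α)
    (hκ1 : ∀ z ∈ ball (0 : ℂ) 1, ‖κ z‖ ≤ α * √(‖F z - lam‖ ^ 2 + ε ^ 2))
    (hκ2 : ∀ z ∈ ball (0 : ℂ) 1, ‖κ z‖ * ‖F z - lam‖ ≤ α * (‖F z - lam‖ ^ 2 + ε ^ 2)) :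
    ∃ v : ℂ → V, ∀ z ∈ ball (0 : ℂ) 1, DifferentiableAt ℝ v z ∧
      dbar v z = κ z • (((‖F z - lam‖ ^ 2 + ε ^ 2)⁻¹ : ℝ) : ℂ) • (Q - p z) (dbar s z) ∧
      ‖v z‖ ≤ Module.finrank ℂ V * (2 * S * L ^ 2 * α *
        ((2 * (S + (L ^ 2 * S ^ 2 + 1) * C₀ + 2) + 1) ^ 2 +
          3 * (S ^ 2 + (L ^ 2 * S ^ 2 + 1) * C₀ ^ 2 + 4 * (2 * C₀ + 1)))) := by
  have hW := carlesonWeight_adapted hF hp h1 hs (zero_le_one.trans hS1) hS hdbar hlam hε hε1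
  have hN : ContDiff ℝ (⊤ : ℕ∞) fun z => (‖F z - lam‖ ^ 2 + ε ^ 2)⁻¹ :=
    (contDiff_dist_sq hF lam).inv fun z => by positivity
  have hNc : ContDiff ℝ (⊤ : ℕ∞) fun z => (((‖F z - lam‖ ^ 2 + ε ^ 2)⁻¹ : ℝ) : ℂ) :=
    Complex.ofRealCLM.contDiff.comp hN
  have hQp : ContDiff ℝ (⊤ : ℕ∞) fun z => Q - p z := contDiff_const.sub hp
  have hK : ContDiff ℝ (⊤ : ℕ∞) fun z => (Q - p z) (dbar s z) :=
    contDiff_clm_apply_real hQp hs.smooth.dbar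
  refine hW.exists_bounded_dbar (by positivity) (hκ.smul (hNc.smul hK)) (fun z hz => ?_)
    (fun z hz => ?_)
  all_goals
    set r := √(‖F z - lam‖ ^ 2 + ε ^ 2) with hr
    have hN0 : 0 < ‖F z - lam‖ ^ 2 + ε ^ 2 := by positivity
    have hr0 : 0 < r := Real.sqrt_pos.mpr hN0
    have hr2 : ‖F z - lam‖ ^ 2 + ε ^ 2 = r ^ 2 := (Real.sq_sqrt hN0.le).symm
    have k1 := hκ1 z hz
    have k2 := hκ2 z hz
    have bs := norm_dbar_adapted_le hp h1 hs hS hdbar hz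
    have bQ : ‖(Q - p z) (dbar s z)‖ ≤ (L * ‖F z - lam‖) * (L * ‖deriv F z‖ * S) :=
      ((Q - p z).le_opNorm _).trans (mul_le_mul (hQ z hz) bs (norm_nonneg _) (by positivity))
    have bN : ‖(((‖F z - lam‖ ^ 2 + ε ^ 2)⁻¹ : ℝ) : ℂ)‖ = (r ^ 2)⁻¹ := by
      rw [Complex.norm_real, hr2, Real.norm_of_nonneg (by positivity)]
    rw [hr2] at k2
    have hnn : 0 ≤ ‖dz s z‖ ^ 2 + ‖deriv F z‖ ^ 2 + ‖deriv F z‖ ^ 2 / r := by positivity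
  · rw [norm_smul, norm_smul, bN]
    have e2 : ‖deriv F z‖ ≤ √(‖dz s z‖ ^ 2 + ‖deriv F z‖ ^ 2 + ‖deriv F z‖ ^ 2 / r) :=
      Real.le_sqrt_of_sq_le (by
        have : 0 ≤ ‖deriv F z‖ ^ 2 / r := by positivity
        have := sq_nonneg ‖dz s z‖; linarith)
    have hy : ‖κ z‖ * ‖F z - lam‖ * (r ^ 2)⁻¹ ≤ α := by
      rwa [← div_eq_mul_inv, div_le_iff₀ (by positivity)]
    calc ‖κ z‖ * ((r ^ 2)⁻¹ * ‖(Q - p z) (dbar s z)‖)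
        ≤ ‖κ z‖ * ((r ^ 2)⁻¹ * ((L * ‖F z - lam‖) * (L * ‖deriv F z‖ * S))) := by gcongr
      _ = (‖κ z‖ * ‖F z - lam‖ * (r ^ 2)⁻¹) * (S * L ^ 2 * ‖deriv F z‖) := by ring
      _ ≤ α * (S * L ^ 2 * ‖deriv F z‖) := by gcongr
      _ ≤ 2 * S * L ^ 2 * α * ‖deriv F z‖ := by
          have : 0 ≤ S * L ^ 2 * α * ‖deriv F z‖ := by positivity
          linarith
      _ ≤ _ := by gcongr
  · have hRr : ‖F z - lam‖ ≤ r := Real.le_sqrt_of_sq_le (by nlinarith [sq_nonneg ε])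
    have dK : DifferentiableAt ℝ (fun w => (((‖F w - lam‖ ^ 2 + ε ^ 2)⁻¹ : ℝ) : ℂ) •
        (Q - p w) (dbar s w)) z := (hNc.smul hK).differentiableAt_top
    rw [dz_smul hκ.differentiableAt_top dK, hκ0 z hz, zero_smul, zero_add,
      dz_smul hNc.differentiableAt_top hK.differentiableAt_top,
      dz_clm_apply hQp.differentiableAt_top hs.smooth.dbar.differentiableAt_top,
      dz_sub (differentiableAt_const _) hp.differentiableAt_top, dz_const, zero_sub, norm_smul,
      Real.sq_sqrt hnn]
    have b1 := dz_inv_dist_sq hF lam hε hz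
    rw [hr2] at b1
    have b2 := norm_dz_dbar_adapted_le hp h1 hs hS hdbar hdd hz
    have b3 : ‖(-dz p z) (dbar s z) + (Q - p z) (dz (dbar s) z)‖ ≤
        (L * ‖deriv F z‖) * (L * ‖deriv F z‖ * S) + (L * ‖F z - lam‖) *
          (L * ‖deriv F z‖ ^ 2 * S + L * ‖deriv F z‖ * ‖dz s z‖) := by
      refine (norm_add_le _ _).trans (add_le_add ?_ ?_)
      · refine ((-dz p z).le_opNorm _).trans (mul_le_mul ?_ bs (norm_nonneg _) (by positivity))
        rw [norm_neg]; exact hdz z hz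
      · exact ((Q - p z).le_opNorm _).trans (mul_le_mul (hQ z hz) b2 (norm_nonneg _)
          (by positivity))
    refine le_trans (mul_le_mul_of_nonneg_left ((norm_add_le _ _).trans (add_le_add
      ((norm_smul_le _ _).trans (mul_le_mul b1 bQ (norm_nonneg _) (by positivity)))
      ((norm_smul_le _ _).trans (mul_le_mul bN.le b3 (norm_nonneg _) (by positivity)))))
      (norm_nonneg _)) ?_
    exact rhs_estimate hr0 (norm_nonneg _) hS1 hα (norm_nonneg _) hRr k1 k2

end LocalizationRhs

section UniformSection

variable {E₀ V : Type*} [NormedAddCommGroup E₀] [InnerProductSpace ℂ E₀] [NormedSpace ℝ E₀]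
  [IsScalarTower ℝ ℂ E₀] [FiniteDimensional ℂ E₀] [NormedAddCommGroup V] [InnerProductSpace ℂ V]
  [NormedSpace ℝ V] [IsScalarTower ℝ ℂ V]

local notation "⟪" x "," y "⟫" => inner ℂ x y

theorem exists_composite_bounds {W : Type*} [NormedAddCommGroup W] [NormedSpace ℂ W]
    [NormedSpace ℝ W] [IsScalarTower ℝ ℂ W] {P : E₀ → W} (hP : ContDiff ℝ (⊤ : ℕ∞) P) (C₀ : ℝ) :
    ∃ L : ℝ, 0 ≤ L ∧ (∀ a b : E₀, ‖a‖ ≤ C₀ → ‖b‖ ≤ C₀ → ‖P a - P b‖ ≤ L * ‖a - b‖) ∧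
      (∀ a : E₀, ‖a‖ ≤ C₀ → ‖P a‖ ≤ L) ∧
      ∀ F : ℂ → E₀, IsBoundedHolo F C₀ → ∀ z ∈ ball (0 : ℂ) 1,
        ‖dz (fun w => P (F w)) z‖ ≤ L * ‖deriv F z‖ ∧
        ‖dbar (fun w => P (F w)) z‖ ≤ L * ‖deriv F z‖ ∧
        ‖dz (dbar fun w => P (F w)) z‖ ≤ L * ‖deriv F z‖ ^ 2 := by
  have : ProperSpace E₀ := FiniteDimensional.proper ℂ E₀
  have : CompleteSpace E₀ := FiniteDimensional.complete ℂ E₀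
  have hP2 : ContDiff ℝ 2 P := hP.of_le (by norm_cast)
  obtain ⟨L, hL, hb⟩ := exists_bound_derivs hP2 C₀
  have hd : ∀ a, DifferentiableAt ℝ P a := fun a => hP.differentiable (by simp) a
  refine ⟨L, hL, fun a b ha hb' => ?_, fun a ha => (hb a ha).1, fun F hF z hz => ?_⟩
  · refine (convex_closedBall (0 : E₀) C₀).norm_image_sub_le_of_norm_fderiv_le (𝕜 := ℝ)
      (fun x _ => hd x) (fun x hx => (hb x (by simpa using hx)).2.1) ?_ ?_
    · simpa using hb'
    · simpa using ha
  · have hFz := hb (F z) (hF.norm_le z (ball_subset_closedBall hz))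
    refine ⟨?_, ?_, ?_⟩
    · refine (norm_dz_comp_holo_le (hd _) (hF.holo z hz)).trans ?_
      have := hFz.2.1; gcongr
    · refine (norm_dbar_comp_holo_le (hd _) (hF.holo z hz)).trans ?_
      have := hFz.2.1; gcongr
    · refine (norm_dz_dbar_comp_holo_le hP2 (hF.eventually hz)).trans ?_
      have := hFz.2.2; gcongr

/-- Adapted sections of the pulled back line bundle, with bounds depending only on the bundle
and on the sup norm of the map. -/
theorem exists_uniform_adaptedSection {P : E₀ → V →L[ℂ] V} (hP : ContDiff ℝ (⊤ : ℕ∞) P) (C₀ : ℝ) :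
    ∃ S : ℝ, 1 ≤ S ∧ ∀ F : ℂ → E₀, IsBoundedHolo F C₀ →
      (∀ z ∈ closedBall (0 : ℂ) 1, IsRankOneProj (P (F z))) →
      ∃ s : ℂ → V, IsAdaptedSection (fun z => P (F z)) s ∧
        ∀ z ∈ ball (0 : ℂ) 1, S⁻¹ ≤ ‖s z‖ ∧ ‖s z‖ ≤ S := by
  have : CompleteSpace E₀ := FiniteDimensional.complete ℂ E₀
  obtain ⟨L, hL, -, -, hb⟩ := exists_composite_bounds hP C₀
  refine ⟨Real.exp ((2 + L ^ 2 * C₀ ^ 2) / 2), Real.one_le_exp (by positivity), fun F hF h1 => ?_⟩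
  obtain ⟨s, hs, hlog⟩ := exists_adaptedSection_log_norm_le (hP.comp hF.smooth) h1 hF.smooth
    hF.holo hF.norm_le (fun z hz => (hb F hF z hz).1) (fun z hz => (hb F hF z hz).2.1)
  refine ⟨s, hs, fun z hz => ?_⟩
  have hpos : 0 < ‖s z‖ := norm_pos_iff.mpr (hs.ne_zero z (ball_subset_closedBall hz))
  have h2 := hlog z hz
  rw [Real.log_pow, abs_le] at h2
  push_cast at h2
  rw [← Real.exp_neg, ← Real.exp_log hpos]
  rw [Real.exp_le_exp, Real.exp_le_exp]
  constructor <;> linarith [h2.1, h2.2]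

/-- Near the fibre of `F` over `lam`, adapted sections are uniformly close to bounded holomorphic
maps. -/
theorem exists_holo_close [FiniteDimensional ℂ V] {P : E₀ → V →L[ℂ] V}
    (hP : ContDiff ℝ (⊤ : ℕ∞) P) {C₀ S : ℝ} (hS1 : 1 ≤ S) {lam : E₀} (hlam : ‖lam‖ ≤ C₀) {η : ℝ}
    (hη : 0 < η) :
    ∃ C₂ : ℝ, 0 ≤ C₂ ∧ ∀ (F : ℂ → E₀), IsBoundedHolo F C₀ →
      (∀ z ∈ closedBall (0 : ℂ) 1, IsRankOneProj (P (F z))) → ∀ s : ℂ → V,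
      IsAdaptedSection (fun z => P (F z)) s → (∀ z ∈ ball (0 : ℂ) 1, ‖s z‖ ≤ S) →
      ∃ H : ℂ → V, ∀ z ∈ ball (0 : ℂ) 1, DifferentiableAt ℂ H z ∧
        ‖s z - H z‖ ≤ η + C₂ * ‖F z - lam‖ := by
  have : CompleteSpace E₀ := FiniteDimensional.complete ℂ E₀
  obtain ⟨L, hL, hLip, -, hb⟩ := exists_composite_bounds hP C₀
  have hC0 : 0 ≤ C₀ := (norm_nonneg _).trans hlam
  set K : ℝ := Module.finrank ℂ V * (2 * S * L ^ 2 *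
        ((2 * (S + (L ^ 2 * S ^ 2 + 1) * C₀ + 2) + 1) ^ 2 +
          3 * (S ^ 2 + (L ^ 2 * S ^ 2 + 1) * C₀ ^ 2 + 4 * (2 * C₀ + 1)))) with hK
  have hK0 : 0 ≤ K := by positivity
  let b := stdOrthonormalBasis ℂ E₀
  set ε : ℝ := min 1 (η / (K + 1)) with hεdef
  have hε : 0 < ε := lt_min one_pos (by positivity)
  have hε1 : ε ≤ 1 := min_le_left _ _
  have hεη : ε * K ≤ η := by
    have h1 : ε ≤ η / (K + 1) := min_le_right _ _
    rw [le_div_iff₀ (by positivity)] at h1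
    nlinarith
  refine ⟨L * S + Module.finrank ℂ E₀ * K, by positivity, fun F hF h1 s hs hS => ?_⟩
  have hp : ContDiff ℝ (⊤ : ℕ∞) fun z => P (F z) := hP.comp hF.smooth
  have hball : ∀ {z : ℂ}, z ∈ ball (0 : ℂ) 1 → z ∈ closedBall (0 : ℂ) 1 := fun h =>
    ball_subset_closedBall h
  have hQ : ∀ z ∈ ball (0 : ℂ) 1, ‖P lam - P (F z)‖ ≤ L * ‖F z - lam‖ := fun z hz => by
    rw [norm_sub_rev (F z)]; exact hLip _ _ hlam (hF.norm_le z (hball hz))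
  have sol := fun (κ : ℂ → ℂ) hκ hκ0 (α : ℝ) hα hκ1 hκ2 =>
    exists_dbar_localized hF hp h1 hs hS1 hL hS (fun z hz => (hb F hF z hz).1)
      (fun z hz => (hb F hF z hz).2.1) (fun z hz => (hb F hF z hz).2.2) hlam hQ hε hε1
      (κ := κ) hκ hκ0 (α := α) hα hκ1 hκ2
  have hRr : ∀ z, ‖F z - lam‖ ≤ √(‖F z - lam‖ ^ 2 + ε ^ 2) := fun z =>
    Real.le_sqrt_of_sq_le (by nlinarith [sq_nonneg ε])
  have hεr : ∀ z, ε ≤ √(‖F z - lam‖ ^ 2 + ε ^ 2) := fun z =>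
    Real.le_sqrt_of_sq_le (by nlinarith [sq_nonneg ‖F z - lam‖])
  obtain ⟨v₀, hv₀⟩ := sol (fun _ => ((ε ^ 2 : ℝ) : ℂ)) contDiff_const (fun z _ => dz_const _ z) ε hε.le
    (fun z _ => by
      rw [Complex.norm_real, Real.norm_of_nonneg (by positivity)]
      exact (sq ε).le.trans (mul_le_mul_of_nonneg_left (hεr z) hε.le))
    (fun z _ => by
      rw [Complex.norm_real, Real.norm_of_nonneg (by positivity)]
      have h : ε * ‖F z - lam‖ ≤ ‖F z - lam‖ ^ 2 + ε ^ 2 := by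
        nlinarith [sq_nonneg (ε - ‖F z - lam‖), sq_nonneg ‖F z - lam‖, sq_nonneg ε]
      calc ε ^ 2 * ‖F z - lam‖ = ε * (ε * ‖F z - lam‖) := by ring
        _ ≤ _ := mul_le_mul_of_nonneg_left h hε.le)
  have hbw : ∀ i x, ‖⟪b i, x⟫‖ ≤ ‖x‖ := fun i x => by
    simpa [b.orthonormal.1 i] using norm_inner_le_norm (𝕜 := ℂ) (b i) x
  have hwh : ∀ i, ∀ z ∈ ball (0 : ℂ) 1, DifferentiableAt ℂ (fun w => ⟪b i, F w - lam⟫) z :=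
    fun i z hz => (innerSL ℂ (b i)).differentiableAt.comp z ((hF.holo z hz).sub_const lam)
  have hws : ∀ i, ContDiff ℝ (⊤ : ℕ∞) (fun w => ⟪b i, F w - lam⟫) := fun i =>
    contDiff_const.inner ℂ (hF.smooth.sub contDiff_const)
  have hi : ∀ i, ∃ v : ℂ → V, ∀ z ∈ ball (0 : ℂ) 1, DifferentiableAt ℝ v z ∧
      dbar v z = starRingEnd ℂ ⟪b i, F z - lam⟫ •
        (((‖F z - lam‖ ^ 2 + ε ^ 2)⁻¹ : ℝ) : ℂ) • (P lam - P (F z)) (dbar s z) ∧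
      ‖v z‖ ≤ Module.finrank ℂ V * (2 * S * L ^ 2 * 1 *
        ((2 * (S + (L ^ 2 * S ^ 2 + 1) * C₀ + 2) + 1) ^ 2 +
          3 * (S ^ 2 + (L ^ 2 * S ^ 2 + 1) * C₀ ^ 2 + 4 * (2 * C₀ + 1)))) := by
    intro i
    refine sol (fun z => starRingEnd ℂ ⟪b i, F z - lam⟫) ?_ (fun z hz => ?_) 1 zero_le_one
      (fun z _ => ?_) (fun z _ => ?_)
    · exact (Complex.conjCLE : ℂ →L[ℝ] ℂ).contDiff.comp (hws i)
    · rw [dz_conj (hws i).differentiableAt_top, dbar_eq_zero (hwh i z hz), map_zero]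
    · rw [RCLike.norm_conj, one_mul]
      exact (hbw i _).trans (hRr z)
    · rw [RCLike.norm_conj, one_mul]
      refine (mul_le_mul_of_nonneg_right (hbw i _) (norm_nonneg _)).trans ?_
      nlinarith [sq_nonneg ε]
  choose v hv using hi
  refine ⟨fun z => P lam (s z) - (∑ i, ⟪b i, F z - lam⟫ • v i z + v₀ z), fun z hz => ⟨?_, ?_⟩⟩
  · have hsd : DifferentiableAt ℝ s z := hs.differentiableAt
    have d1 : DifferentiableAt ℝ (fun w => P lam (s w)) z :=
      ((P lam).restrictScalars ℝ).differentiableAt.comp z hsd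
    have d2 : ∀ i, DifferentiableAt ℝ (fun w => ⟪b i, F w - lam⟫ • v i w) z := fun i =>
      (hws i).differentiableAt_top.fun_smul (hv i z hz).1
    have d3 : DifferentiableAt ℝ (fun w => ∑ i, ⟪b i, F w - lam⟫ • v i w) z :=
      DifferentiableAt.fun_sum fun i _ => d2 i
    have d4 := d3.fun_add (hv₀ z hz).1
    refine differentiableAt_of_dbar_eq_zero (d1.fun_sub d4) ?_
    have h0 : 0 < ‖F z - lam‖ ^ 2 + ε ^ 2 := by positivity
    have e : ∀ i, dbar (fun w => ⟪b i, F w - lam⟫ • v i w) z =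
        ((‖⟪b i, F z - lam⟫‖ ^ 2 : ℝ) : ℂ) • (((‖F z - lam‖ ^ 2 + ε ^ 2)⁻¹ : ℝ) : ℂ) •
          (P lam - P (F z)) (dbar s z) := by
      intro i
      rw [dbar_smul (hws i).differentiableAt_top (hv i z hz).1, dbar_eq_zero (hwh i z hz), zero_smul,
        zero_add, (hv i z hz).2.1, smul_smul, Complex.mul_conj, Complex.normSq_eq_norm_sq]
    have hPs : P (F z) (dbar s z) = 0 :=
      (h1 z (hball hz)).apply_eq_zero (hs.apply_eq z (hball hz)) (hs.ne_zero z (hball hz))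
        (hs.inner_dbar z hz)
    rw [dbar_sub d1 d4, dbar_add d3 (hv₀ z hz).1, dbar_sum _ fun i _ => d2 i, dbar_clm _ hsd,
      Finset.sum_congr rfl fun i _ => e i, (hv₀ z hz).2.1, ← Finset.sum_smul, ← add_smul,
      ← Complex.ofReal_sum, ← Complex.ofReal_add, b.sum_sq_norm_inner_right, smul_smul,
      ← Complex.ofReal_mul, mul_inv_cancel₀ h0.ne', Complex.ofReal_one, one_smul,
      _root_.sub_apply, hPs, sub_zero, sub_self]
  · have hz' := hball hz
    have e : s z - (P lam (s z) - (∑ i, ⟪b i, F z - lam⟫ • v i z + v₀ z)) =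
        - (P lam - P (F z)) (s z) + (∑ i, ⟪b i, F z - lam⟫ • v i z + v₀ z) := by
      rw [_root_.sub_apply, hs.apply_eq z hz']; abel
    rw [e]
    have b1 : ‖-(P lam - P (F z)) (s z)‖ ≤ L * ‖F z - lam‖ * S := by
      rw [norm_neg]
      exact ((P lam - P (F z)).le_opNorm _).trans
        (mul_le_mul (hQ z hz) (hS z hz) (norm_nonneg _) (by positivity))
    have b2 : ‖∑ i, ⟪b i, F z - lam⟫ • v i z‖ ≤ Module.finrank ℂ E₀ * (‖F z - lam‖ * K) := by
      refine (norm_sum_le _ _).trans ?_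
      refine (Finset.sum_le_card_nsmul _ _ (‖F z - lam‖ * K) fun i _ => ?_).trans (by simp)
      rw [norm_smul]
      refine mul_le_mul (hbw i _) ?_ (norm_nonneg _) (norm_nonneg _)
      simpa only [mul_one] using (hv i z hz).2.2
    have b3 : ‖v₀ z‖ ≤ ε * K := by
      refine (hv₀ z hz).2.2.trans (le_of_eq ?_)
      rw [hK]; ring
    calc _ ≤ L * ‖F z - lam‖ * S + (Module.finrank ℂ E₀ * (‖F z - lam‖ * K) + ε * K) :=
          (norm_add_le _ _).trans (add_le_add b1 ((norm_add_le _ _).trans (add_le_add b2 b3)))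
      _ ≤ L * ‖F z - lam‖ * S + (Module.finrank ℂ E₀ * (‖F z - lam‖ * K) + η) := by gcongr
      _ = _ := by ring

end UniformSection

section Corona

local notation "⟪" x "," y "⟫" => inner ℂ x y

theorem IsBoundedHolo.carlesonWeight {E₀ : Type*} [NormedAddCommGroup E₀] [InnerProductSpace ℂ E₀]
    [NormedSpace ℝ E₀] [IsScalarTower ℝ ℂ E₀] [CompleteSpace E₀] {F : ℂ → E₀} {C₀ : ℝ}
    (hF : IsBoundedHolo F C₀) :
    CarlesonWeight (C₀ ^ 2) C₀ (fun z => ‖F z‖ ^ 2) fun z => ‖deriv F z‖ where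
  hB := sq_nonneg _
  hC := (norm_nonneg _).trans (hF.norm_le 0 (mem_closedBall_self zero_le_one))
  smooth := hF.smooth.norm_sq ℂ
  nonneg := fun _ _ => norm_nonneg _
  weight_nonneg := fun _ _ => sq_nonneg _
  weight_le := fun z hz =>
    pow_le_pow_left₀ (norm_nonneg _) (hF.norm_le z (ball_subset_closedBall hz)) 2
  dz_weight_le := fun z hz => by
    rw [dz_norm_sq_holo (hF.holo z hz)]
    exact (norm_inner_le_norm _ _).trans
      (mul_le_mul_of_nonneg_right (hF.norm_le z (ball_subset_closedBall hz)) (norm_nonneg _))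
  le_dz_dbar_weight := fun z hz => by
    rw [dz_dbar_norm_sq_holo (hF.eventually hz), Complex.ofReal_re]

variable {ι : Type*} [Fintype ι]

/-- A globally smooth solution of `∑ i, ψ i w * w i = 1` away from a neighbourhood of zero. -/
theorem exists_contDiff_sum_mul_eq_one {δ : ℝ} (hδ : 0 < δ) :
    ∃ ψ : ι → EuclideanSpace ℂ ι → ℂ, (∀ i, ContDiff ℝ (⊤ : ℕ∞) (ψ i)) ∧
      ∀ w, δ ≤ ‖w‖ → ∑ i, ψ i w * w i = 1 := by
  set D : EuclideanSpace ℂ ι → ℝ := fun w => ‖w‖ ^ 2 + (1 - Real.smoothTransition (‖w‖ ^ 2 / δ ^ 2))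
    with hD
  have hD0 : ∀ w, D w ≠ 0 := fun w => by
    have h1 := Real.smoothTransition.le_one (‖w‖ ^ 2 / δ ^ 2)
    refine ne_of_gt ?_
    rcases eq_or_ne w 0 with rfl | hw
    · simp [hD]
    · have := norm_pos_iff.mpr hw
      have : 0 < ‖w‖ ^ 2 := by positivity
      simp only [hD]; linarith
  have hn : ContDiff ℝ (⊤ : ℕ∞) fun w : EuclideanSpace ℂ ι => ‖w‖ ^ 2 := contDiff_id.norm_sq ℂ
  have hDs : ContDiff ℝ (⊤ : ℕ∞) D :=
    hn.add (contDiff_const.sub (Real.smoothTransition.contDiff.comp (hn.div_const _)))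
  refine ⟨fun i w => starRingEnd ℂ (w i) * (((D w)⁻¹ : ℝ) : ℂ), fun i => ?_, fun w hw => ?_⟩
  · refine ContDiff.mul ?_ (Complex.ofRealCLM.contDiff.comp (hDs.inv hD0))
    have h : ContDiff ℝ (⊤ : ℕ∞) fun w : EuclideanSpace ℂ ι => w i :=
      ((EuclideanSpace.proj i : EuclideanSpace ℂ ι →L[ℂ] ℂ).restrictScalars ℝ).contDiff
    exact (Complex.conjCLE : ℂ →L[ℝ] ℂ).contDiff.comp h
  · have hDw : D w = ‖w‖ ^ 2 := by
      have : Real.smoothTransition (‖w‖ ^ 2 / δ ^ 2) = 1 :=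
        Real.smoothTransition.one_of_one_le (by
          rw [one_le_div (by positivity)]; exact pow_le_pow_left₀ hδ.le hw 2)
      simp only [hD, this]; ring
    have h0 : ((‖w‖ ^ 2 : ℝ) : ℂ) ≠ 0 := by
      have := hδ.trans_le hw
      exact_mod_cast (by positivity : (‖w‖ ^ 2 : ℝ) ≠ 0)
    have e : ∀ i, starRingEnd ℂ (w i) * (((D w)⁻¹ : ℝ) : ℂ) * w i =
        ((‖w i‖ ^ 2 : ℝ) : ℂ) * (((‖w‖ ^ 2 : ℝ) : ℂ))⁻¹ := fun i => by
      rw [hDw, ← Complex.normSq_eq_norm_sq, ← Complex.mul_conj, Complex.ofReal_inv]; ring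
    rw [Finset.sum_congr rfl fun i _ => e i, ← Finset.sum_mul, ← Complex.ofReal_sum,
      ← EuclideanSpace.norm_sq_eq, mul_inv_cancel₀ h0]

/-- The corona theorem for maps smooth up to the boundary, with uniform bounds. -/
theorem exists_corona_solution (C₀ : ℝ) {δ : ℝ} (hδ : 0 < δ) :
    ∃ K : ℝ, ∀ F : ℂ → EuclideanSpace ℂ ι, IsBoundedHolo F C₀ →
      (∀ z ∈ ball (0 : ℂ) 1, δ ≤ ‖F z‖) → ∃ g : ι → ℂ → ℂ, ∀ z ∈ ball (0 : ℂ) 1,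
        (∀ i, DifferentiableAt ℂ (g i) z ∧ ‖g i z‖ ≤ K) ∧ ∑ i, g i z * F z i = 1 := by
  classical
  obtain ⟨ψ, hψ, hψ1⟩ := exists_contDiff_sum_mul_eq_one (ι := ι) hδ
  choose L hL0 _ hLb hLF using fun i => exists_composite_bounds (hψ i) C₀
  set K₀ : ι → ι → ℝ := fun i j => Module.finrank ℂ ℂ * (2 * (L i * L j) *
    ((2 * C₀ + 1) ^ 2 + 3 * C₀ ^ 2)) with hK₀
  have hK0 : ∀ i j, 0 ≤ K₀ i j := fun i j => by
    have := hL0 i; have := hL0 j; positivity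
  refine ⟨∑ i, L i + ∑ i, ∑ j, (K₀ i j + K₀ j i) * C₀, fun F hF hFδ => ?_⟩
  have hC0 : 0 ≤ C₀ := (norm_nonneg _).trans (hF.norm_le 0 (mem_closedBall_self zero_le_one))
  have hφ : ∀ i, ContDiff ℝ (⊤ : ℕ∞) fun z => ψ i (F z) := fun i => (hψ i).comp hF.smooth
  have hφd : ∀ i z, DifferentiableAt ℝ (fun z => ψ i (F z)) z := fun i z =>
    (hφ i).differentiableAt_top
  have hφn : ∀ i, ∀ z ∈ ball (0 : ℂ) 1, ‖ψ i (F z)‖ ≤ L i := fun i z hz =>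
    hLb i _ (hF.norm_le z (ball_subset_closedBall hz))
  have hv : ∀ i j, ∃ v : ℂ → ℂ, ∀ z ∈ ball (0 : ℂ) 1, DifferentiableAt ℝ v z ∧
      dbar v z = ψ i (F z) * dbar (fun w => ψ j (F w)) z ∧ ‖v z‖ ≤ K₀ i j := by
    intro i j
    have hL2 : 0 ≤ L i * L j := mul_nonneg (hL0 i) (hL0 j)
    refine hF.carlesonWeight.exists_bounded_dbar (A := 2 * (L i * L j)) (by positivity)
      ((hφ i).mul (hφ j).dbar) (fun z hz => ?_) fun z hz => ?_
    · obtain ⟨-, b2, -⟩ := hLF j F hF z hz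
      have b1 := hφn i z hz
      rw [norm_mul]
      calc _ ≤ L i * (L j * ‖deriv F z‖) := mul_le_mul b1 b2 (norm_nonneg _) (hL0 i)
        _ ≤ _ := by nlinarith [mul_nonneg hL2 (norm_nonneg (deriv F z))]
    · rw [dz_mul (hφd i z) (hφ j).dbar.differentiableAt_top]
      obtain ⟨c1, -, -⟩ := hLF i F hF z hz
      obtain ⟨-, b2, b3⟩ := hLF j F hF z hz
      refine (norm_add_le _ _).trans ?_
      rw [norm_mul, norm_mul]
      have d1 := mul_le_mul c1 b2 (norm_nonneg _) ((norm_nonneg _).trans c1)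
      have d2 := mul_le_mul (hφn i z hz) b3 (norm_nonneg _) (hL0 i)
      nlinarith
  choose v hv using hv
  have hFi : ∀ i, ∀ z ∈ ball (0 : ℂ) 1, DifferentiableAt ℂ (fun w => F w i) z := fun i z hz =>
    (EuclideanSpace.proj i : EuclideanSpace ℂ ι →L[ℂ] ℂ).differentiableAt.comp z (hF.holo z hz)
  have hFir : ∀ i, ∀ z ∈ ball (0 : ℂ) 1, DifferentiableAt ℝ (fun w => F w i) z := fun i z hz =>
    (hFi i z hz).restrictScalars ℝ
  have hsum : ∀ z ∈ ball (0 : ℂ) 1, ∑ i, ψ i (F z) * F z i = 1 := fun z hz => hψ1 _ (hFδ z hz)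
  have hterm : ∀ i j, ∀ z ∈ ball (0 : ℂ) 1,
      DifferentiableAt ℝ (fun w => (v i j w - v j i w) * F w j) z := fun i j z hz =>
    ((hv i j z hz).1.fun_sub (hv j i z hz).1).fun_mul (hFir j z hz)
  have hzero : ∀ z ∈ ball (0 : ℂ) 1, ∑ j, dbar (fun w => ψ j (F w)) z * F z j = 0 := by
    intro z hz
    have hd : dbar (fun w => ∑ j, ψ j (F w) * F w j) z = 0 := by
      have hev : (fun w => ∑ j, ψ j (F w) * F w j) =ᶠ[𝓝 z] fun _ => (1 : ℂ) := by
        filter_upwards [isOpen_ball.mem_nhds hz] with w hw using hsum w hw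
      rw [hev.dbar_eq, dbar_const]
    rw [dbar_sum _ fun j _ => (hφd j z).fun_mul (hFir j z hz)] at hd
    rw [← hd]
    refine Finset.sum_congr rfl fun j _ => ?_
    rw [dbar_mul (hφd j z) (hFir j z hz), dbar_eq_zero (hFi j z hz), mul_zero, add_zero]
  refine ⟨fun i z => ψ i (F z) + ∑ j, (v i j z - v j i z) * F z j, fun z hz =>
    ⟨fun i => ⟨?_, ?_⟩, ?_⟩⟩
  · have ds := DifferentiableAt.fun_sum (u := Finset.univ) fun j _ => hterm i j z hz
    refine differentiableAt_of_dbar_eq_zero ((hφd i z).fun_add ds) ?_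
    rw [dbar_add (hφd i z) ds, dbar_sum _ fun j _ => hterm i j z hz]
    have e : ∀ j, dbar (fun w => (v i j w - v j i w) * F w j) z =
        ψ i (F z) * (dbar (fun w => ψ j (F w)) z * F z j) -
          dbar (fun w => ψ i (F w)) z * (ψ j (F z) * F z j) := by
      intro j
      rw [dbar_mul ((hv i j z hz).1.fun_sub (hv j i z hz).1) (hFir j z hz),
        dbar_eq_zero (hFi j z hz), dbar_sub (hv i j z hz).1 (hv j i z hz).1, (hv i j z hz).2.1,
        (hv j i z hz).2.1]
      ring
    rw [Finset.sum_congr rfl fun j _ => e j, Finset.sum_sub_distrib, ← Finset.mul_sum,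
      ← Finset.mul_sum, hzero z hz, hsum z hz]
    ring
  · refine (norm_add_le _ _).trans (add_le_add ((hφn i z hz).trans
      (Finset.single_le_sum (fun k _ => hL0 k) (Finset.mem_univ i))) ?_)
    refine (norm_sum_le _ _).trans ?_
    refine (Finset.sum_le_sum fun j _ => ?_).trans (Finset.single_le_sum
      (f := fun i => ∑ j, (K₀ i j + K₀ j i) * C₀) (fun k _ => Finset.sum_nonneg fun j _ =>
        mul_nonneg (add_nonneg (hK0 _ _) (hK0 _ _)) hC0) (Finset.mem_univ i))
    rw [norm_mul]
    refine mul_le_mul ((norm_sub_le _ _).trans (add_le_add (hv i j z hz).2.2 (hv j i z hz).2.2))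
      ((PiLp.norm_apply_le _ _).trans (hF.norm_le z (ball_subset_closedBall hz))) (norm_nonneg _)
      (add_nonneg (hK0 _ _) (hK0 _ _))
  · have e : ∑ i, (∑ j, (v i j z - v j i z) * F z j) * F z i = 0 := by
      have h1 : ∑ i, ∑ j, v i j z * F z j * F z i = ∑ i, ∑ j, v j i z * F z j * F z i := by
        rw [Finset.sum_comm]
        refine Finset.sum_congr rfl fun i _ => Finset.sum_congr rfl fun j _ => by ring
      simp only [Finset.sum_mul, sub_mul, Finset.sum_sub_distrib]
      rw [h1, sub_self]
    simp only [add_mul, Finset.sum_add_distrib]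
    rw [hsum z hz, e, add_zero]

end Corona

section Ultralimit

open Filter

variable {V : Type*} [NormedAddCommGroup V] [NormedSpace ℂ V]

/-- Pointwise limits of uniformly bounded holomorphic maps on the disk are holomorphic. -/
theorem differentiableOn_of_tendsto_bounded [CompleteSpace V] {l : Filter ℕ} [l.NeBot]
    {h : ℕ → ℂ → V} {y : ℂ → V} {K : ℝ} (hd : ∀ m, DifferentiableOn ℂ (h m) (ball 0 1))
    (hK : ∀ m, ∀ z ∈ ball (0 : ℂ) 1, ‖h m z‖ ≤ K)
    (hy : ∀ z ∈ ball (0 : ℂ) 1, Tendsto (fun m => h m z) l (𝓝 (y z))) :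
    DifferentiableOn ℂ y (ball 0 1) := by
  refine TendstoLocallyUniformlyOn.differentiableOn (F := h) (φ := l) ?_
    (Eventually.of_forall hd) isOpen_ball
  rw [Metric.tendstoLocallyUniformlyOn_iff]
  intro ε hε z₀ hz₀
  obtain ⟨ρ, hρ, hsub⟩ := Metric.isOpen_ball.mem_nhds hz₀ |> Metric.mem_nhds_iff.mp
  have hlip : ∀ m, ∀ z ∈ ball z₀ ρ, dist (h m z) (h m z₀) ≤ 2 * K / ρ * dist z z₀ := fun m z hz =>
    Complex.dist_le_div_mul_dist_of_mapsTo_ball ((hd m).mono hsub) (fun w hw => by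
      rw [mem_closedBall, dist_eq_norm]
      exact (norm_sub_le _ _).trans (by linarith [hK m w (hsub hw), hK m z₀ hz₀])) hz
  have hlip' : ∀ z ∈ ball z₀ ρ, dist (y z) (y z₀) ≤ 2 * K / ρ * dist z z₀ := fun z hz =>
    le_of_tendsto ((hy z (hsub hz)).dist (hy z₀ hz₀)) (Eventually.of_forall fun m => hlip m z hz)
  have hK0 : 0 ≤ K := (norm_nonneg _).trans (hK 0 z₀ hz₀)
  set L := 2 * K / ρ with hL
  have hL0 : 0 ≤ L := by positivity
  set r := min ρ (ε / (3 * (L + 1))) with hr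
  have hr0 : 0 < r := lt_min hρ (by positivity)
  have hrL : L * r < ε / 3 := by
    have h1 : r ≤ ε / (3 * (L + 1)) := min_le_right _ _
    rw [le_div_iff₀ (by positivity)] at h1
    nlinarith
  refine ⟨ball z₀ r, mem_nhdsWithin_of_mem_nhds (ball_mem_nhds z₀ hr0), ?_⟩
  filter_upwards [(Metric.tendsto_nhds.mp (hy z₀ hz₀)) (ε / 3) (by positivity)] with m hm z hz
  have hzρ : z ∈ ball z₀ ρ := ball_subset_ball (min_le_left _ _) hz
  have b1 := hlip m z hzρ
  have b2 := hlip' z hzρ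
  have b3 : L * dist z z₀ ≤ L * r := mul_le_mul_of_nonneg_left (mem_ball.mp hz).le hL0
  rw [dist_comm] at hm
  have b4 := dist_triangle4 (y z) (y z₀) (h m z₀) (h m z)
  rw [dist_comm (h m z₀)] at b4
  linarith

theorem exists_tendsto_hyperfilter [ProperSpace V] {α : Type*} {s : Set α} {x : ℕ → α → V} {K : ℝ}
    (hx : ∀ m, ∀ a ∈ s, ‖x m a‖ ≤ K) :
    ∃ y : α → V, ∀ a ∈ s, Tendsto (fun m => x m a) (hyperfilter ℕ) (𝓝 (y a)) := by
  have h : ∀ a, ∃ y : V, a ∈ s → Tendsto (fun m => x m a) (hyperfilter ℕ) (𝓝 y) := by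
    intro a
    by_cases ha : a ∈ s
    · obtain ⟨y, -, hy⟩ := (ProperSpace.isCompact_closedBall (0 : V) K).ultrafilter_le_nhds'
        ((hyperfilter ℕ).map fun m => x m a)
        (by
          rw [Ultrafilter.mem_map]
          exact univ_mem' fun m => by simpa using hx m a ha)
      exact ⟨y, fun _ => hy⟩
    · exact ⟨0, fun h => absurd h ha⟩
  choose y hy using h
  exact ⟨y, hy⟩

end Ultralimit

section Dilation

open Filter

variable {E₀ V : Type*} [NormedAddCommGroup E₀] [InnerProductSpace ℂ E₀] [NormedSpace ℝ E₀]
  [IsScalarTower ℝ ℂ E₀] [FiniteDimensional ℂ E₀] [NormedAddCommGroup V] [InnerProductSpace ℂ V]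
  [NormedSpace ℝ V] [IsScalarTower ℝ ℂ V]

theorem smul_mem_unitBall {r : ℝ} (hr0 : 0 ≤ r) (hr : r < 1) {z : ℂ} (hz : z ∈ closedBall (0 : ℂ) 1) :
    (r : ℂ) * z ∈ ball (0 : ℂ) 1 := by
  rw [mem_ball_zero_iff, norm_mul, Complex.norm_real, Real.norm_of_nonneg hr0]
  have := mem_closedBall_zero_iff.mp hz
  nlinarith [norm_nonneg z]

/-- A dilate of a bounded holomorphic map on the disk extends to a globally smooth map. -/
theorem exists_dilate {F : ℂ → E₀} {C₀ : ℝ} (hF : DifferentiableOn ℂ F (ball 0 1))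
    (hC : ∀ z ∈ ball (0 : ℂ) 1, ‖F z‖ ≤ C₀) {r : ℝ} (hr0 : 0 < r) (hr : r < 1) :
    ∃ G : ℂ → E₀, IsBoundedHolo G C₀ ∧ ∀ z ∈ closedBall (0 : ℂ) 1, G z = F (r * z) := by
  have : CompleteSpace E₀ := FiniteDimensional.complete ℂ E₀
  have hmaps : MapsTo (fun z : ℂ => (r : ℂ) * z) (ball 0 r⁻¹) (ball 0 1) := fun z hz => by
    rw [mem_ball_zero_iff] at hz ⊢
    rw [norm_mul, Complex.norm_real, Real.norm_of_nonneg hr0.le]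
    exact (mul_lt_mul_of_pos_left hz hr0).trans_eq (mul_inv_cancel₀ hr0.ne')
  have hd : DifferentiableOn ℂ (fun z => F (r * z)) (ball 0 r⁻¹) :=
    hF.comp ((differentiable_id.const_mul (r : ℂ)).differentiableOn) hmaps
  have hsub : closedBall (0 : ℂ) 1 ⊆ ball 0 r⁻¹ := closedBall_subset_ball ((one_lt_inv₀ hr0).mpr hr)
  have hs : ContDiffOn ℂ (⊤ : ℕ∞) (fun z => F (r * z)) (ball 0 r⁻¹) := hd.contDiffOn isOpen_ball
  obtain ⟨G, hG, hGe⟩ := exists_contDiff_eventuallyEq isOpen_ball hsub (hs.restrict_scalars ℝ)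
  refine ⟨G, ⟨hG, fun z hz => ?_, fun z hz => ?_⟩, fun z hz => (hGe z hz).eq_of_nhds⟩
  · have hz' := ball_subset_closedBall hz
    exact (hd.differentiableAt (isOpen_ball.mem_nhds (hsub hz'))).congr_of_eventuallyEq (hGe z hz')
  · rw [(hGe z hz).eq_of_nhds]
    exact hC _ (smul_mem_unitBall hr0.le hr hz)

theorem exists_dilates {F : ℂ → E₀} {C₀ : ℝ} (hF : DifferentiableOn ℂ F (ball 0 1))
    (hC : ∀ z ∈ ball (0 : ℂ) 1, ‖F z‖ ≤ C₀) :
    ∃ G : ℕ → ℂ → E₀, (∀ m, IsBoundedHolo (G m) C₀) ∧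
      (∀ m, ∀ z ∈ closedBall (0 : ℂ) 1, ∃ w ∈ ball (0 : ℂ) 1, G m z = F w) ∧
      ∀ z ∈ ball (0 : ℂ) 1, Tendsto (fun m => G m z) (hyperfilter ℕ) (𝓝 (F z)) := by
  set r : ℕ → ℝ := fun m => 1 - 1 / ((m : ℝ) + 1 + 1) with hr
  have hr0 : ∀ m, 0 < r m := fun m => by
    have : 1 / ((m : ℝ) + 1 + 1) < 1 := by rw [div_lt_one (by positivity)]; linarith [m.cast_nonneg (α := ℝ)]
    simp only [hr]; linarith
  have hr1 : ∀ m, r m < 1 := fun m => by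
    have : 0 < 1 / ((m : ℝ) + 1 + 1) := by positivity
    simp only [hr]; linarith
  have hrt : Tendsto r atTop (𝓝 1) := by
    have h1 := ((tendsto_one_div_add_atTop_nhds_zero_nat (𝕜 := ℝ)).comp (tendsto_add_atTop_nat 1))
    have h2 := h1.const_sub (1 : ℝ)
    simp only [sub_zero] at h2
    refine h2.congr fun m => ?_
    simp [hr]
  choose G hG hGe using fun m => exists_dilate hF hC (hr0 m) (hr1 m)
  refine ⟨G, hG, fun m z hz => ⟨_, smul_mem_unitBall (hr0 m).le (hr1 m) hz, hGe m z hz⟩,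
    fun z hz => ?_⟩
  have hc : Tendsto (fun m => F ((r m : ℂ) * z)) atTop (𝓝 (F z)) := by
    have h1 : Tendsto (fun m => (r m : ℂ) * z) atTop (𝓝 z) := by
      have h2 := ((Complex.continuous_ofReal.tendsto 1).comp hrt).mul_const z
      simpa using h2
    exact (hF.differentiableAt (isOpen_ball.mem_nhds hz)).continuousAt.tendsto.comp h1
  exact (hc.mono_left Nat.hyperfilter_le_atTop).congr fun m =>
    (hGe m z (ball_subset_closedBall hz)).symm

/-- The corona theorem with uniform bounds. -/
theorem exists_corona_solution_of_differentiableOn {ι : Type*} [Fintype ι] (C₀ : ℝ) {δ : ℝ}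
    (hδ : 0 < δ) :
    ∃ K : ℝ, ∀ F : ℂ → EuclideanSpace ℂ ι, DifferentiableOn ℂ F (ball 0 1) →
      (∀ z ∈ ball (0 : ℂ) 1, ‖F z‖ ≤ C₀) → (∀ z ∈ ball (0 : ℂ) 1, δ ≤ ‖F z‖) →
      ∃ g : ι → ℂ → ℂ, (∀ i, DifferentiableOn ℂ (g i) (ball 0 1)) ∧
        ∀ z ∈ ball (0 : ℂ) 1, (∀ i, ‖g i z‖ ≤ K) ∧ ∑ i, g i z * F z i = 1 := by
  obtain ⟨K, hK⟩ := exists_corona_solution (ι := ι) C₀ hδ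
  refine ⟨K, fun F hF hC hFδ => ?_⟩
  obtain ⟨G, hG, hGF, hGt⟩ := exists_dilates hF hC
  choose g hg using fun m => hK (G m) (hG m) fun z hz => by
    obtain ⟨w, hw, e⟩ := hGF m z (ball_subset_closedBall hz)
    rw [e]; exact hFδ w hw
  choose y hy using fun i => exists_tendsto_hyperfilter (V := ℂ) (s := ball (0 : ℂ) 1)
    (x := fun m => g m i) fun m z hz => ((hg m z hz).1 i).2
  refine ⟨y, fun i => differentiableOn_of_tendsto_bounded (l := (hyperfilter ℕ : Filter ℕ))
    (fun m z hz => ((hg m z hz).1 i).1.differentiableWithinAt)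
    (fun m z hz => ((hg m z hz).1 i).2) (hy i), fun z hz => ⟨fun i => ?_, ?_⟩⟩
  · exact le_of_tendsto (hy i z hz).norm (Eventually.of_forall fun m => ((hg m z hz).1 i).2)
  · have ht : Tendsto (fun m => ∑ i, g m i z * G m z i) (hyperfilter ℕ)
        (𝓝 (∑ i, y i z * F z i)) := tendsto_finsetSum _ fun i _ =>
      (hy i z hz).mul (((EuclideanSpace.proj i : EuclideanSpace ℂ ι →L[ℂ] ℂ).continuous.tendsto
        _).comp (hGt z hz))
    refine tendsto_nhds_unique ht (tendsto_const_nhds.congr fun m => ((hg m z hz).2).symm)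

/-- Sections of the pulled back line bundle over the disk which are bounded, bounded away from
zero and uniformly close to bounded holomorphic maps near the fibres. -/
theorem exists_section_of_differentiableOn [FiniteDimensional ℂ V] {P : E₀ → V →L[ℂ] V}
    (hP : ContDiff ℝ (⊤ : ℕ∞) P) (C₀ : ℝ) :
    ∃ S : ℝ, 1 ≤ S ∧ ∃ C₂ : E₀ → ℝ → ℝ, ∀ F : ℂ → E₀, DifferentiableOn ℂ F (ball 0 1) →
      (∀ z ∈ ball (0 : ℂ) 1, ‖F z‖ ≤ C₀) → (∀ z ∈ ball (0 : ℂ) 1, IsRankOneProj (P (F z))) →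
      ∃ s : ℂ → V, (∀ z ∈ ball (0 : ℂ) 1, P (F z) (s z) = s z ∧ S⁻¹ ≤ ‖s z‖ ∧ ‖s z‖ ≤ S) ∧
        ∀ lam η, ‖lam‖ ≤ C₀ → 0 < η → 0 ≤ C₂ lam η ∧ ∃ H : ℂ → V,
          DifferentiableOn ℂ H (ball 0 1) ∧
          ∀ z ∈ ball (0 : ℂ) 1, ‖s z - H z‖ ≤ η + C₂ lam η * ‖F z - lam‖ := by
  have : CompleteSpace V := FiniteDimensional.complete ℂ V
  have : ProperSpace V := FiniteDimensional.proper ℂ V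
  obtain ⟨S, hS, hsec⟩ := exists_uniform_adaptedSection hP C₀
  have hcl : ∀ lam η, ∃ C₂ : ℝ, ‖lam‖ ≤ C₀ → 0 < η → 0 ≤ C₂ ∧ ∀ (F : ℂ → E₀),
      IsBoundedHolo F C₀ → (∀ z ∈ closedBall (0 : ℂ) 1, IsRankOneProj (P (F z))) → ∀ s : ℂ → V,
      IsAdaptedSection (fun z => P (F z)) s → (∀ z ∈ ball (0 : ℂ) 1, ‖s z‖ ≤ S) →
      ∃ H : ℂ → V, ∀ z ∈ ball (0 : ℂ) 1, DifferentiableAt ℂ H z ∧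
        ‖s z - H z‖ ≤ η + C₂ * ‖F z - lam‖ := by
    intro lam η
    by_cases h : ‖lam‖ ≤ C₀ ∧ 0 < η
    · obtain ⟨C₂, hC₂⟩ := exists_holo_close hP hS h.1 h.2
      exact ⟨C₂, fun _ _ => hC₂⟩
    · exact ⟨0, fun h1 h2 => absurd ⟨h1, h2⟩ h⟩
  choose C₂ hC₂ using hcl
  refine ⟨S, hS, C₂, fun F hF hC h1 => ?_⟩
  obtain ⟨G, hG, hGF, hGt⟩ := exists_dilates hF hC
  have hG1 : ∀ m, ∀ z ∈ closedBall (0 : ℂ) 1, IsRankOneProj (P (G m z)) := fun m z hz => by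
    obtain ⟨w, hw, e⟩ := hGF m z hz
    rw [e]; exact h1 w hw
  choose s hs hsS using fun m => hsec (G m) (hG m) (hG1 m)
  obtain ⟨y, hy⟩ := exists_tendsto_hyperfilter (s := ball (0 : ℂ) 1) (x := s)
    fun m z hz => (hsS m z hz).2
  refine ⟨y, fun z hz => ⟨?_, ?_, ?_⟩, fun lam η hlam hη => ?_⟩
  · have ht : Tendsto (fun m => P (G m z) (s m z)) (hyperfilter ℕ) (𝓝 (P (F z) (y z))) :=
      ((isBoundedBilinearMap_apply (𝕜 := ℂ) (E := V) (F := V)).continuous.tendsto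
        (P (F z), y z)).comp (((hP.continuous.tendsto _).comp (hGt z hz)).prodMk_nhds (hy z hz))
    exact tendsto_nhds_unique ht ((hy z hz).congr fun m =>
      ((hs m).apply_eq z (ball_subset_closedBall hz)).symm)
  · exact ge_of_tendsto (hy z hz).norm (Eventually.of_forall fun m => (hsS m z hz).1)
  · exact le_of_tendsto (hy z hz).norm (Eventually.of_forall fun m => (hsS m z hz).2)
  · obtain ⟨hC20, hH⟩ := hC₂ lam η hlam hη
    refine ⟨hC20, ?_⟩
    choose H hH using fun m => hH (G m) (hG m) (hG1 m) (s m) (hs m) fun z hz => (hsS m z hz).2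
    have hHb : ∀ m, ∀ z ∈ ball (0 : ℂ) 1, ‖H m z‖ ≤ S + (η + C₂ lam η * (2 * C₀)) := by
      intro m z hz
      have e : H m z = s m z - (s m z - H m z) := by abel
      rw [e]
      refine (norm_sub_le _ _).trans (add_le_add (hsS m z hz).2 ((hH m z hz).2.trans ?_))
      have b : ‖G m z - lam‖ ≤ 2 * C₀ := (norm_sub_le _ _).trans (by
        linarith [(hG m).norm_le z (ball_subset_closedBall hz)])
      linarith [mul_le_mul_of_nonneg_left b hC20]
    obtain ⟨Y, hY⟩ := exists_tendsto_hyperfilter (s := ball (0 : ℂ) 1) hHb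
    refine ⟨Y, differentiableOn_of_tendsto_bounded (l := (hyperfilter ℕ : Filter ℕ))
      (fun m z hz => (hH m z hz).1.differentiableWithinAt) hHb hY, fun z hz => ?_⟩
    exact le_of_tendsto_of_tendsto ((hy z hz).sub (hY z hz)).norm
      ((((hGt z hz).sub_const lam).norm.const_mul _).const_add _)
      (Eventually.of_forall fun m => (hH m z hz).2)

end Dilation

section HinfDiskNat

open Filter

/-- The extension by zero to the plane of the restriction of a function to one of the disks. -/
def slice (f : DiskNat →ᵇ ℂ) (n : ℕ) (z : ℂ) : ℂ := by
  classical exact if h : z ∈ unitDisk then f (⟨z, h⟩, n) else 0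

theorem slice_of_mem (f : DiskNat →ᵇ ℂ) (n : ℕ) {z : ℂ} (h : z ∈ unitDisk) :
    slice f n z = f (⟨z, h⟩, n) := dif_pos h

theorem norm_slice_le (f : DiskNat →ᵇ ℂ) (n : ℕ) {z : ℂ} (h : z ∈ unitDisk) :
    ‖slice f n z‖ ≤ ‖f‖ := by
  rw [slice_of_mem f n h]; exact f.norm_coe_le_norm _

theorem mem_HinfDiskNat_iff {f : DiskNat →ᵇ ℂ} :
    f ∈ HinfDiskNat ↔ ∀ n, DifferentiableOn ℂ (slice f n) unitDisk := by
  refine ⟨fun hf n => ?_, fun hf n => ⟨slice f n, hf n, fun z => (slice_of_mem f n z.2).symm⟩⟩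
  obtain ⟨g, hg, e⟩ := hf n
  exact hg.congr fun z hz => (slice_of_mem f n hz).trans (e ⟨z, hz⟩)

theorem isClosed_HinfDiskNat : IsClosed (HinfDiskNat : Set (DiskNat →ᵇ ℂ)) := by
  refine isClosed_of_closure_subset fun f hf => ?_
  obtain ⟨x, hx, hxf⟩ := mem_closure_iff_seq_limit.mp hf
  obtain ⟨K, hK⟩ := (Metric.isBounded_range_of_tendsto x hxf).exists_norm_le
  refine mem_HinfDiskNat_iff.mpr fun n => ?_
  refine differentiableOn_of_tendsto_bounded (l := atTop) (h := fun m => slice (x m) n) (K := K)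
    (fun m => mem_HinfDiskNat_iff.mp (hx m) n)
    (fun m z hz => (norm_slice_le _ n hz).trans (hK _ ⟨m, rfl⟩)) fun z hz => ?_
  simp only [slice_of_mem _ n hz]
  exact (((continuous_apply _).comp BoundedContinuousFunction.continuous_coe).tendsto f).comp hxf

instance : CompleteSpace HinfDiskNat := isClosed_HinfDiskNat.completeSpace_coe

/-- Uniformly bounded holomorphic functions on the disks form a bounded holomorphic function. -/
theorem exists_HinfDiskNat {g : ℕ → ℂ → ℂ} {K : ℝ} (hg : ∀ n, DifferentiableOn ℂ (g n) unitDisk)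
    (hK : ∀ n, ∀ z ∈ unitDisk, ‖g n z‖ ≤ K) :
    ∃ f : HinfDiskNat, ∀ d : DiskNat, (f : DiskNat →ᵇ ℂ) d = g d.2 d.1 := by
  have hc : Continuous fun d : DiskNat => g d.2 d.1 := by
    rw [continuous_prod_of_discrete_right]
    exact fun n => (hg n).continuousOn.domRestrict
  exact ⟨⟨BoundedContinuousFunction.ofNormedAddCommGroup _ hc K fun d => hK _ _ d.1.2,
    fun n => ⟨g n, hg n, fun z => rfl⟩⟩, fun d => rfl⟩

/-- Evaluation at a point of `𝔻 × ℕ`. -/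
def pointEval (d : DiskNat) : MaxIdealSpaceDiskNat :=
  CharacterSpace.equivAlgHom.symm
    { toFun := fun f => (f : DiskNat →ᵇ ℂ) d
      map_one' := rfl
      map_mul' := fun _ _ => rfl
      map_zero' := rfl
      map_add' := fun _ _ => rfl
      commutes' := fun _ => rfl }

theorem pointEval_apply (d : DiskNat) (f : HinfDiskNat) : pointEval d f = (f : DiskNat →ᵇ ℂ) d :=
  rfl

theorem continuous_character_apply (f : HinfDiskNat) :
    Continuous fun φ : MaxIdealSpaceDiskNat => φ f :=
  (WeakDual.eval_continuous f).comp continuous_subtype_val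

/-- The basic neighbourhoods in the maximal ideal space. -/
theorem exists_finset_of_mem_nhds {x : MaxIdealSpaceDiskNat} {U : Set MaxIdealSpaceDiskNat}
    (hU : U ∈ 𝓝 x) : ∃ S : Finset HinfDiskNat, ∃ ε : ℝ, 0 < ε ∧
      ∀ y : MaxIdealSpaceDiskNat, (∀ f ∈ S, ‖y f - x f‖ < ε) → y ∈ U := by
  have hind : IsInducing fun (φ : MaxIdealSpaceDiskNat) (f : HinfDiskNat) => φ f := by
    have h1 : IsInducing fun (φ : WeakDual ℂ HinfDiskNat) (f : HinfDiskNat) => φ f := ⟨rfl⟩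
    exact h1.comp IsInducing.subtypeVal
  rw [hind.nhds_eq_comap, Filter.mem_comap] at hU
  obtain ⟨t, ht, htU⟩ := hU
  rw [nhds_pi, Filter.mem_pi] at ht
  obtain ⟨I, hI, u, hu, hut⟩ := ht
  choose ε hε hεu using fun f => Metric.mem_nhds_iff.mp (hu f)
  obtain ⟨e, he, hle⟩ : ∃ e : ℝ, 0 < e ∧ ∀ f ∈ I, e ≤ ε f := by
    rcases hI.toFinset.eq_empty_or_nonempty with h | h
    · refine ⟨1, one_pos, fun f hf => ?_⟩
      rw [Set.Finite.toFinset_eq_empty] at h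
      simp [h] at hf
    · obtain ⟨f₀, -, hmin⟩ := hI.toFinset.exists_min_image ε h
      exact ⟨ε f₀, hε f₀, fun f hf => hmin f (hI.mem_toFinset.mpr hf)⟩
  refine ⟨hI.toFinset, e, he, fun y hy => htU (hut fun f hf => hεu f ?_)⟩
  rw [mem_ball, dist_eq_norm]
  exact (hy f (hI.mem_toFinset.mpr hf)).trans_le (hle f hf)

/-- The vector of values of finitely many elements at a character. -/
def evalVec (S : Finset HinfDiskNat) (φ : MaxIdealSpaceDiskNat) : EuclideanSpace ℂ S :=
  WithLp.toLp 2 fun f => φ (f : HinfDiskNat)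

theorem continuous_evalVec (S : Finset HinfDiskNat) : Continuous (evalVec S) :=
  (PiLp.continuous_toLp 2 _).comp (continuous_pi fun f => continuous_character_apply f)

theorem exists_norm_evalVec_le (S : Finset HinfDiskNat) :
    ∃ C₀ : ℝ, ∀ φ, ‖evalVec S φ‖ ≤ C₀ := by
  obtain ⟨C, hC⟩ := (isCompact_range (continuous_evalVec S)).isBounded.exists_norm_le
  exact ⟨C, fun φ => hC _ ⟨φ, rfl⟩⟩

/-- The holomorphic map on the `n`-th disk given by finitely many elements. -/
def sliceVec (S : Finset HinfDiskNat) (n : ℕ) (z : ℂ) : EuclideanSpace ℂ S :=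
  WithLp.toLp 2 fun f => slice (f : HinfDiskNat) n z

theorem sliceVec_eq (S : Finset HinfDiskNat) (d : DiskNat) :
    sliceVec S d.2 d.1 = evalVec S (pointEval d) := by
  ext f
  exact slice_of_mem _ _ d.1.2

theorem differentiableOn_sliceVec (S : Finset HinfDiskNat) (n : ℕ) :
    DifferentiableOn ℂ (sliceVec S n) unitDisk := by
  have h : DifferentiableOn ℂ (fun z (f : S) => slice (f : HinfDiskNat) n z) unitDisk :=
    differentiableOn_pi.mpr fun f => mem_HinfDiskNat_iff.mp f.1.2 n
  exact ((PiLp.continuousLinearEquiv 2 ℂ fun _ : S => ℂ).symm.differentiable).comp_differentiableOn h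

/-- The points of `𝔻 × ℕ` are dense in the maximal ideal space. -/
theorem exists_pointEval_mem {U : Set MaxIdealSpaceDiskNat} (hU : IsOpen U) (hne : U.Nonempty) :
    ∃ d, pointEval d ∈ U := by
  obtain ⟨x, hx⟩ := hne
  obtain ⟨S, ε, hε, hS⟩ := exists_finset_of_mem_nhds (hU.mem_nhds hx)
  by_contra hcon
  push Not at hcon
  obtain ⟨C₀, hC₀⟩ := exists_norm_evalVec_le S
  set lam := evalVec S x with hlam
  obtain ⟨K, hK⟩ := exists_corona_solution_of_differentiableOn (ι := S) (C₀ + C₀) hε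
  have hd : ∀ n, ∀ z ∈ unitDisk, ∃ d : DiskNat, sliceVec S n z = evalVec S (pointEval d) :=
    fun n z hz => ⟨(⟨z, hz⟩, n), sliceVec_eq S (⟨z, hz⟩, n)⟩
  choose g hg hgK using fun n => hK (fun z => sliceVec S n z - lam)
    ((differentiableOn_sliceVec S n).sub_const lam)
    (fun z hz => by
      obtain ⟨d, e⟩ := hd n z hz
      rw [e]
      exact (norm_sub_le _ _).trans (add_le_add (hC₀ _) (hC₀ _)))
    (fun z hz => by
      obtain ⟨d, e⟩ := hd n z hz
      by_contra h
      rw [not_le, e] at h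
      refine hcon d (hS _ fun f hf => lt_of_le_of_lt ?_ h)
      exact PiLp.norm_apply_le (evalVec S (pointEval d) - lam) ⟨f, hf⟩)
  choose G hG using fun f : S => exists_HinfDiskNat (g := fun n => g n f) (K := K)
    (fun n => hg n f) fun n z hz => (hgK n z hz).1 f
  have hsum : ∑ f : S, G f * ((f : HinfDiskNat) - algebraMap ℂ HinfDiskNat (x (f : HinfDiskNat))) =
      1 := by
    refine Subtype.ext (BoundedContinuousFunction.ext fun d => ?_)
    have h1 := (hgK d.2 d.1 d.1.2).2
    have h2 : ∀ f : HinfDiskNat, (f : DiskNat →ᵇ ℂ) d = pointEval d f := fun f => rfl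
    rw [h2, h2, map_sum, map_one, ← h1]
    refine Finset.sum_congr rfl fun f _ => ?_
    rw [map_mul, map_sub, AlgHomClass.commutes, sliceVec_eq, pointEval_apply, hG]
    rfl
  have h := congrArg x hsum
  rw [map_sum, map_one, Finset.sum_eq_zero] at h
  · exact zero_ne_one h
  · intro f _
    rw [map_mul, map_sub, AlgHomClass.commutes]
    simp

end HinfDiskNat

section Turn

/-- The point of the unit circle at `t` turns. -/
def turn (t : ℝ) : ℂ := Complex.exp ((2 * Real.pi * t : ℝ) * I)

theorem turn_add (s t : ℝ) : turn (s + t) = turn s * turn t := by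
  rw [turn, turn, turn, ← Complex.exp_add]; push_cast; ring_nf

theorem turn_eq_turn_iff {s t : ℝ} : turn s = turn t ↔ ∃ m : ℤ, s = t + m := by
  have hp : (2 * Real.pi * I : ℂ) ≠ 0 := Complex.two_pi_I_ne_zero
  rw [turn, turn, Complex.exp_eq_exp_iff_exists_int]
  refine exists_congr fun m => ?_
  have e1 : ((2 * Real.pi * s : ℝ) : ℂ) * I = (2 * Real.pi * I) * s := by push_cast; ring
  have e2 : ((2 * Real.pi * t : ℝ) : ℂ) * I + m * (2 * Real.pi * I) =
      (2 * Real.pi * I) * ((t + m : ℝ) : ℂ) := by push_cast; ring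
  rw [e1, e2, mul_right_inj' hp, Complex.ofReal_inj]

theorem norm_turn (t : ℝ) : ‖turn t‖ = 1 := Complex.norm_exp_ofReal_mul_I _

theorem conj_turn (t : ℝ) : starRingEnd ℂ (turn t) = turn (-t) := by
  rw [turn, turn, ← Complex.exp_conj, map_mul, Complex.conj_ofReal, Complex.conj_I]
  push_cast
  ring_nf

theorem norm_mul_turn_arg (z : ℂ) : (‖z‖ : ℂ) * turn (arg z / (2 * Real.pi)) = z := by
  rw [turn, mul_div_cancel₀ _ Real.two_pi_pos.ne', Complex.norm_mul_exp_arg_mul_I]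

theorem contDiff_turn : ContDiff ℝ (⊤ : ℕ∞) turn := by
  have h : ContDiff ℝ (⊤ : ℕ∞) fun t : ℝ => ((2 * Real.pi * t : ℝ) : ℂ) * I :=
    (Complex.ofRealCLM.contDiff.comp (contDiff_const.mul contDiff_id)).mul contDiff_const
  exact h.cexp

theorem exists_abs_arg_lt : ∃ κ : ℝ, 0 < κ ∧ κ ≤ 1 ∧ ∀ w : ℂ, ‖w - 1‖ < κ → |arg w| < Real.pi / 4 := by
  have h := Metric.continuousAt_iff.mp (Complex.continuousAt_arg Complex.one_mem_slitPlane)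
    (Real.pi / 4) (by positivity)
  obtain ⟨δ, hδ, hw⟩ := h
  refine ⟨min δ 1, lt_min hδ one_pos, min_le_right _ _, fun w h1 => ?_⟩
  have := hw (x := w) (by rw [dist_eq_norm]; exact h1.trans_le (min_le_left _ _))
  simpa [Real.dist_eq] using this

/-- A complex number close to `H` has an argument close to that of `H`. -/
theorem exists_turn_close {κ : ℝ} (hκ0 : 0 < κ) (hκ1 : κ ≤ 1)
    (hκ : ∀ w : ℂ, ‖w - 1‖ < κ → |arg w| < Real.pi / 4) {r : ℝ} (hr : 0 < r) {s H : ℂ}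
    (hs : r ≤ ‖s‖) (hsH : ‖s - H‖ ≤ 3 * (κ * r / 8)) :
    ∃ t : ℝ, |t - arg H / (2 * Real.pi)| < 1 / 8 ∧ s = ‖s‖ * turn t := by
  have hκr : 0 < κ * r := by positivity
  have hH : 5 * r / 8 ≤ ‖H‖ := by
    have := norm_sub_norm_le s H
    nlinarith
  have hH0 : H ≠ 0 := norm_pos_iff.mp (by linarith)
  have h1 : ‖s / H - 1‖ < κ := by
    rw [div_sub_one hH0, norm_div, div_lt_iff₀ (norm_pos_iff.mpr hH0)]
    nlinarith
  refine ⟨arg (s / H) / (2 * Real.pi) + arg H / (2 * Real.pi), ?_, ?_⟩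
  · rw [add_sub_cancel_right, abs_div, abs_of_pos Real.two_pi_pos, div_lt_iff₀ Real.two_pi_pos]
    linarith [hκ _ h1]
  · have e : (‖s‖ : ℂ) = (‖s / H‖ : ℂ) * (‖H‖ : ℂ) := by
      rw [← Complex.ofReal_mul, ← norm_mul, div_mul_cancel₀ s hH0]
    calc s = s / H * H := (div_mul_cancel₀ s hH0).symm
      _ = (‖s / H‖ * turn (arg (s / H) / (2 * Real.pi))) *
          (‖H‖ * turn (arg H / (2 * Real.pi))) := by rw [norm_mul_turn_arg, norm_mul_turn_arg]
      _ = _ := by rw [turn_add, e]; ring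

end Turn

section LineBundle

variable {κ : Type*} [Fintype κ] [DecidableEq κ]

local notation "⟪" x "," y "⟫" => inner ℂ x y

/-- The matrix with entries `ρ k * ρ l * turn (a l k)`. -/
def bundleProj (ρ : κ → ℝ) (a : κ → κ → ℝ) : EuclideanSpace ℂ κ →L[ℂ] EuclideanSpace ℂ κ :=
  ∑ k, ∑ l, ((ρ k * ρ l : ℝ) * turn (a l k) : ℂ) •
    (EuclideanSpace.proj l : EuclideanSpace ℂ κ →L[ℂ] ℂ).smulRight (EuclideanSpace.single k (1 : ℂ))

theorem bundleProj_apply (ρ : κ → ℝ) (a : κ → κ → ℝ) (x : EuclideanSpace ℂ κ) (k : κ) :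
    bundleProj ρ a x k = ∑ l, ((ρ k * ρ l : ℝ) * turn (a l k) : ℂ) * x l := by
  simp only [bundleProj, _root_.sum_apply, _root_.smul_apply, ContinuousLinearMap.smulRight_apply,
    PiLp.proj_apply, WithLp.ofLp_sum, Finset.sum_apply, PiLp.smul_apply, smul_eq_mul,
    PiLp.single_apply, mul_ite, mul_one, mul_zero]
  rw [Finset.sum_eq_single k (fun i _ hi => by simp [hi.symm]) (by simp)]
  simp

theorem contDiff_bundleProj {E : Type*} [NormedAddCommGroup E] [NormedSpace ℝ E]
    {ρ : κ → E → ℝ} {a : κ → κ → E → ℝ} (hρ : ∀ k, ContDiff ℝ (⊤ : ℕ∞) (ρ k))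
    (ha : ∀ k l, ContDiff ℝ (⊤ : ℕ∞) (a k l)) :
    ContDiff ℝ (⊤ : ℕ∞) fun w => bundleProj (fun k => ρ k w) fun k l => a k l w := by
  refine ContDiff.sum fun k _ => ContDiff.sum fun l _ => ContDiff.fun_smul ?_ contDiff_const
  exact (Complex.ofRealCLM.contDiff.comp ((hρ k).mul (hρ l))).mul (contDiff_turn.comp (ha l k))

variable {ρ : κ → ℝ} {a : κ → κ → ℝ}

theorem exists_bundleProj_eq (h0 : ∀ k, 0 ≤ ρ k) (h1 : ∑ k, ρ k ^ 2 = 1)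
    (hc : ∀ j k l, ρ j ≠ 0 → ρ k ≠ 0 → ρ l ≠ 0 → ∃ m : ℤ, a k l - a j l + a j k = m) :
    ∃ k₀, ρ k₀ ≠ 0 ∧ ∃ u : EuclideanSpace ℂ κ, (∀ k, u k = ρ k * turn (a k₀ k)) ∧ ‖u‖ = 1 ∧
      ∀ x, bundleProj ρ a x = ⟪u, x⟫ • u := by
  obtain ⟨k₀, hk₀⟩ : ∃ k₀, ρ k₀ ≠ 0 := by
    by_contra! h
    simp [h] at h1
  refine ⟨k₀, hk₀, WithLp.toLp 2 fun k => ρ k * turn (a k₀ k), fun k => rfl, ?_, fun x => ?_⟩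
  · rw [EuclideanSpace.norm_eq, Real.sqrt_eq_one, ← h1]
    refine Finset.sum_congr rfl fun k _ => ?_
    rw [norm_mul, norm_turn, mul_one, Complex.norm_real, Real.norm_of_nonneg (h0 k)]
  · ext k
    rw [bundleProj_apply, PiLp.smul_apply, smul_eq_mul, PiLp.inner_apply, Finset.sum_mul]
    refine Finset.sum_congr rfl fun l _ => ?_
    simp only [RCLike.inner_apply, map_mul, Complex.conj_ofReal, conj_turn]
    rcases eq_or_ne (ρ k) 0 with hk | hk
    · simp [hk]
    rcases eq_or_ne (ρ l) 0 with hl | hl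
    · simp [hl]
    have e : turn (a l k) = turn (-a k₀ l) * turn (a k₀ k) := by
      rw [← turn_add, turn_eq_turn_iff]
      obtain ⟨m, hm⟩ := hc k₀ l k hk₀ hl hk
      exact ⟨m, by linarith⟩
    rw [e]; push_cast; ring

theorem isRankOneProj_bundleProj (h0 : ∀ k, 0 ≤ ρ k) (h1 : ∑ k, ρ k ^ 2 = 1)
    (hc : ∀ j k l, ρ j ≠ 0 → ρ k ≠ 0 → ρ l ≠ 0 → ∃ m : ℤ, a k l - a j l + a j k = m) :
    IsRankOneProj (bundleProj ρ a) := by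
  obtain ⟨k₀, -, u, -, hu, hP⟩ := exists_bundleProj_eq h0 h1 hc
  exact ⟨u, hu, hP⟩

theorem coord_of_bundleProj_eq (h0 : ∀ k, 0 ≤ ρ k) (h1 : ∑ k, ρ k ^ 2 = 1)
    (hc : ∀ j k l, ρ j ≠ 0 → ρ k ≠ 0 → ρ l ≠ 0 → ∃ m : ℤ, a k l - a j l + a j k = m)
    {s : EuclideanSpace ℂ κ} (hs : bundleProj ρ a s = s) :
    (∀ k, ‖s k‖ = ρ k * ‖s‖) ∧ ∀ k l, ρ k ≠ 0 → ρ l ≠ 0 →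
      ρ k * s l = ρ l * turn (a k l) * s k := by
  obtain ⟨k₀, hk₀, u, huk, hu, hP⟩ := exists_bundleProj_eq h0 h1 hc
  rw [hP] at hs
  set c := ⟪u, s⟫
  have hsc : ‖s‖ = ‖c‖ := by rw [← hs, norm_smul, hu, mul_one]
  have hsk : ∀ k, s k = c * (ρ k * turn (a k₀ k)) := fun k => by
    conv_lhs => rw [← hs]
    rw [PiLp.smul_apply, smul_eq_mul, huk]
  refine ⟨fun k => ?_, fun k l hk hl => ?_⟩
  · rw [hsk, norm_mul, norm_mul, norm_turn, mul_one, Complex.norm_real, Real.norm_of_nonneg (h0 k),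
      hsc, mul_comm]
  · have e : turn (a k₀ l) = turn (a k l) * turn (a k₀ k) := by
      rw [← turn_add, eq_comm, turn_eq_turn_iff]
      obtain ⟨m, hm⟩ := hc k₀ k l hk₀ hk hl
      exact ⟨m, by linarith⟩
    rw [hsk, hsk, e]; ring

end LineBundle

section SquarePartition

/-- A smooth partition of unity by squares on a compact set. -/
theorem exists_contDiff_sum_sq_eq_one {E : Type*} [NormedAddCommGroup E] [NormedSpace ℝ E]
    [FiniteDimensional ℝ E] {κ : Type*} [Fintype κ] {σ : Set E} (hσ : IsCompact σ) {W : κ → Set E}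
    (hW : ∀ k, IsOpen (W k)) (hσW : σ ⊆ ⋃ k, W k) :
    ∃ ρ : κ → E → ℝ, (∀ k, ContDiff ℝ (⊤ : ℕ∞) (ρ k)) ∧ (∀ k w, 0 ≤ ρ k w) ∧
      (∀ k w, ρ k w ≠ 0 → w ∈ W k) ∧ ∀ w ∈ σ, ∑ k, ρ k w ^ 2 = 1 := by
  choose f hfW hfs hf01 using fun k => (hW k).exists_contDiff_support_eq (n := ⊤)
  have hf0 : ∀ k w, 0 ≤ f k w := fun k w => (hf01 k ⟨w, rfl⟩).1
  set D : E → ℝ := fun w => ∑ k, f k w ^ 2 with hD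
  have hDs : ContDiff ℝ (⊤ : ℕ∞) D := ContDiff.sum fun k _ => (hfs k).pow 2
  have hD0 : ∀ w, 0 ≤ D w := fun w => Finset.sum_nonneg fun k _ => sq_nonneg _
  have hDpos : ∀ w ∈ σ, 0 < D w := fun w hw => by
    obtain ⟨k, hk⟩ := mem_iUnion.mp (hσW hw)
    rw [← hfW k, Function.mem_support] at hk
    exact Finset.sum_pos' (fun k _ => sq_nonneg _) ⟨k, Finset.mem_univ k, by positivity⟩
  obtain ⟨m, hm, hmD⟩ : ∃ m : ℝ, 0 < m ∧ ∀ w ∈ σ, m ≤ D w := by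
    rcases σ.eq_empty_or_nonempty with rfl | hne
    · exact ⟨1, one_pos, by simp⟩
    · obtain ⟨w₀, hw₀, hmin⟩ := hσ.exists_isMinOn hne hDs.continuous.continuousOn
      exact ⟨D w₀, hDpos w₀ hw₀, fun w hw => hmin hw⟩
  set T : E → ℝ := fun w => D w + (1 - Real.smoothTransition (D w / m)) with hT
  have hTs : ContDiff ℝ (⊤ : ℕ∞) T :=
    hDs.add (contDiff_const.sub (Real.smoothTransition.contDiff.comp (hDs.div_const _)))
  have hTpos : ∀ w, 0 < T w := fun w => by
    have h1 := Real.smoothTransition.le_one (D w / m)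
    rcases (hD0 w).eq_or_lt with h | h
    · simp [hT, ← h]
    · simp only [hT]; linarith
  refine ⟨fun k w => f k w / √(T w), fun k => (hfs k).div (hTs.sqrt fun w => (hTpos w).ne')
    fun w => (Real.sqrt_pos.mpr (hTpos w)).ne', fun k w => div_nonneg (hf0 k w) (Real.sqrt_nonneg _),
    fun k w h => ?_, fun w hw => ?_⟩
  · rw [← hfW k, Function.mem_support]
    exact fun h0 => h (by simp [h0])
  · have hTD : T w = D w := by
      have : Real.smoothTransition (D w / m) = 1 :=
        Real.smoothTransition.one_of_one_le ((one_le_div hm).mpr (hmD w hw))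
      simp only [hT, this]; ring
    simp only [div_pow, Real.sq_sqrt (hTpos w).le]
    rw [← Finset.sum_div, hTD]
    exact div_self (hDpos w hw).ne'

end SquarePartition

section Branches

variable (S : Finset HinfDiskNat) {κ : Type*} [Fintype κ] [DecidableEq κ]
  {ρ : κ → EuclideanSpace ℂ S → ℝ} {a : κ → κ → EuclideanSpace ℂ S → ℝ}

/-- A section of the line bundle over the disks that is almost holomorphic near every point. -/
theorem exists_section_approx (hρ : ∀ k, ContDiff ℝ (⊤ : ℕ∞) (ρ k))
    (ha : ∀ k l, ContDiff ℝ (⊤ : ℕ∞) (a k l)) (h0 : ∀ k w, 0 ≤ ρ k w)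
    (h1 : ∀ φ, ∑ k, ρ k (evalVec S φ) ^ 2 = 1)
    (hc : ∀ φ j k l, ρ j (evalVec S φ) ≠ 0 → ρ k (evalVec S φ) ≠ 0 → ρ l (evalVec S φ) ≠ 0 →
      ∃ m : ℤ, a k l (evalVec S φ) - a j l (evalVec S φ) + a j k (evalVec S φ) = m) :
    ∃ (M : ℝ) (s : DiskNat → EuclideanSpace ℂ κ), 1 ≤ M ∧
      (∀ d, bundleProj (fun k => ρ k (evalVec S (pointEval d)))
        (fun k l => a k l (evalVec S (pointEval d))) (s d) = s d ∧ M⁻¹ ≤ ‖s d‖) ∧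
      ∀ (φ : MaxIdealSpaceDiskNat) (η : ℝ), 0 < η → ∃ C : ℝ, 0 ≤ C ∧ ∃ h : κ → HinfDiskNat,
        ∀ d k, ‖s d k - pointEval d (h k)‖ ≤
          η + C * ‖evalVec S (pointEval d) - evalVec S φ‖ := by
  obtain ⟨C₀, hC₀⟩ := exists_norm_evalVec_le S
  obtain ⟨M, hM, C₂, hC₂⟩ := exists_section_of_differentiableOn (contDiff_bundleProj hρ ha) C₀
  choose s hs hsH using fun n => hC₂ (sliceVec S n) (differentiableOn_sliceVec S n)
    (fun z hz => by rw [sliceVec_eq S (⟨z, hz⟩, n)]; exact hC₀ _)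
    (fun z hz => by
      rw [sliceVec_eq S (⟨z, hz⟩, n)]
      exact isRankOneProj_bundleProj (fun k => h0 k _) (h1 _) (hc _))
  refine ⟨M, fun d => s d.2 d.1, hM, fun d => ?_, fun φ η hη => ?_⟩
  · have h := hs d.2 d.1 d.1.2
    rw [sliceVec_eq] at h
    exact ⟨h.1, h.2.1⟩
  · refine ⟨C₂ (evalVec S φ) η, (hsH 0 _ η (hC₀ φ) hη).1, ?_⟩
    have hC2 := (hsH 0 _ η (hC₀ φ) hη).1
    choose H hH hHs using fun n => (hsH n _ η (hC₀ φ) hη).2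
    choose h hh using fun k : κ => exists_HinfDiskNat (g := fun n z => H n z k)
      (K := M + (η + C₂ (evalVec S φ) η * (C₀ + C₀)))
      (fun n => ((EuclideanSpace.proj k : EuclideanSpace ℂ κ →L[ℂ] ℂ).differentiable).comp_differentiableOn
        (hH n))
      (fun n z hz => by
        have e1 := hHs n z hz
        have e2 := (hs n z hz).2.2
        rw [sliceVec_eq S (⟨z, hz⟩, n)] at e1
        have e3 : ‖evalVec S (pointEval (⟨z, hz⟩, n)) - evalVec S φ‖ ≤ C₀ + C₀ :=
          (norm_sub_le _ _).trans (add_le_add (hC₀ _) (hC₀ _))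
        have e4 : ‖H n z‖ ≤ ‖s n z‖ + ‖s n z - H n z‖ := by
          have := norm_sub_le (s n z) (s n z - H n z)
          simpa using this
        have e5 := mul_le_mul_of_nonneg_left e3 hC2
        refine (PiLp.norm_apply_le (H n z) k).trans ?_
        linarith)
    refine ⟨h, fun d k => ?_⟩
    rw [pointEval_apply, hh, ← sliceVec_eq]
    exact (PiLp.norm_apply_le (s d.2 d.1 - H d.2 d.1) k).trans (hHs d.2 d.1 d.1.2)

/-- A component of an almost holomorphic section has a logarithm near every point. -/
theorem exists_branch (hρ : ∀ k, Continuous (ρ k)) (ha : ∀ k l, Continuous (a k l))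
    (h0 : ∀ k w, 0 ≤ ρ k w) (h1 : ∀ φ, ∑ k, ρ k (evalVec S φ) ^ 2 = 1) {M : ℝ} (hM : 1 ≤ M)
    {s : DiskNat → EuclideanSpace ℂ κ} (hs : ∀ d, M⁻¹ ≤ ‖s d‖)
    (hsρ : ∀ d k, ‖s d k‖ = ρ k (evalVec S (pointEval d)) * ‖s d‖)
    (hsh : ∀ (φ : MaxIdealSpaceDiskNat) (η : ℝ), 0 < η → ∃ C : ℝ, 0 ≤ C ∧
      ∃ h : κ → HinfDiskNat, ∀ d k, ‖s d k - pointEval d (h k)‖ ≤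
        η + C * ‖evalVec S (pointEval d) - evalVec S φ‖) (φ : MaxIdealSpaceDiskNat) :
    ∃ (k : κ) (N : Set MaxIdealSpaceDiskNat) (α : DiskNat → ℝ) (θ : ℝ), IsOpen N ∧ φ ∈ N ∧
      (∀ y ∈ N, ρ k (evalVec S y) ≠ 0 ∧
        ∀ i j, |a i j (evalVec S y) - a i j (evalVec S φ)| < 1 / 8) ∧
      ∀ d, pointEval d ∈ N → |α d - θ| < 1 / 8 ∧ s d k = ‖s d k‖ * turn (α d) := by
  obtain ⟨κ₀, hκ0, hκ1, hκ⟩ := exists_abs_arg_lt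
  obtain ⟨k, hk⟩ : ∃ k, ρ k (evalVec S φ) ≠ 0 := by
    by_contra! h
    have := h1 φ
    simp [h] at this
  have hk' : 0 < ρ k (evalVec S φ) := (h0 _ _).lt_of_ne' hk
  have hM0 : 0 < M := one_pos.trans_le hM
  set r : ℝ := ρ k (evalVec S φ) / 2 * M⁻¹ with hr
  have hr0 : 0 < r := by positivity
  set η : ℝ := κ₀ * r / 8 with hη
  have hη0 : 0 < η := by positivity
  obtain ⟨C, hC, h, hh⟩ := hsh φ η hη0
  have hev : ∀ᶠ y in 𝓝 φ, ρ k (evalVec S φ) / 2 < ρ k (evalVec S y) ∧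
      C * ‖evalVec S y - evalVec S φ‖ < η ∧ ‖y (h k) - φ (h k)‖ < η ∧
      ∀ i j, |a i j (evalVec S y) - a i j (evalVec S φ)| < 1 / 8 := by
    have hF := continuous_evalVec S
    have c1 : Continuous fun y => ρ k (evalVec S y) := (hρ k).comp hF
    have c2 : Continuous fun y => C * ‖evalVec S y - evalVec S φ‖ :=
      continuous_const.mul (hF.sub continuous_const).norm
    have c3 : Continuous fun y : MaxIdealSpaceDiskNat => ‖y (h k) - φ (h k)‖ :=
      ((continuous_character_apply (h k)).sub continuous_const).norm
    have c4 : ∀ i j, Continuous fun y => |a i j (evalVec S y) - a i j (evalVec S φ)| :=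
      fun i j => (((ha i j).comp hF).sub continuous_const).abs
    refine (c1.continuousAt.eventually_const_lt (by linarith)).and
      ((c2.continuousAt.eventually_lt_const (by simpa using hη0)).and
      ((c3.continuousAt.eventually_lt_const (by simpa using hη0)).and ?_))
    exact Filter.eventually_all.mpr fun i => Filter.eventually_all.mpr fun j =>
      (c4 i j).continuousAt.eventually_lt_const (by simp)
  obtain ⟨N, hN, hNo, hφN⟩ := eventually_nhds_iff.mp hev
  have hα : ∀ d, ∃ t : ℝ, pointEval d ∈ N → |t - arg (φ (h k)) / (2 * Real.pi)| < 1 / 8 ∧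
      s d k = ‖s d k‖ * turn t := fun d => by
    by_cases hd : pointEval d ∈ N
    · obtain ⟨p1, p2, p3, -⟩ := hN _ hd
      have q1 : r ≤ ‖s d k‖ := by
        rw [hsρ]
        exact mul_le_mul p1.le (hs d) (inv_nonneg.mpr hM0.le) (h0 _ _)
      have q2 : ‖s d k - φ (h k)‖ ≤ 3 * (κ₀ * r / 8) := by
        have := norm_sub_le_norm_sub_add_norm_sub (s d k) (pointEval d (h k)) (φ (h k))
        have := hh d k
        linarith
      obtain ⟨t, ht⟩ := exists_turn_close hκ0 hκ1 hκ hr0 q1 q2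
      exact ⟨t, fun _ => ht⟩
    · exact ⟨0, fun h => absurd h hd⟩
  choose α hα using hα
  refine ⟨k, N, α, _, hNo, hφN, fun y hy => ⟨?_, (hN y hy).2.2.2⟩, hα⟩
  have := (hN y hy).1
  linarith

theorem exists_branches (hρ : ∀ k, ContDiff ℝ (⊤ : ℕ∞) (ρ k))
    (ha : ∀ k l, ContDiff ℝ (⊤ : ℕ∞) (a k l)) (h0 : ∀ k w, 0 ≤ ρ k w)
    (h1 : ∀ φ, ∑ k, ρ k (evalVec S φ) ^ 2 = 1)
    (hc : ∀ φ j k l, ρ j (evalVec S φ) ≠ 0 → ρ k (evalVec S φ) ≠ 0 → ρ l (evalVec S φ) ≠ 0 →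
      ∃ m : ℤ, a k l (evalVec S φ) - a j l (evalVec S φ) + a j k (evalVec S φ) = m) :
    ∃ (k : MaxIdealSpaceDiskNat → κ) (N : MaxIdealSpaceDiskNat → Set MaxIdealSpaceDiskNat)
      (α : MaxIdealSpaceDiskNat → DiskNat → ℝ) (θ : MaxIdealSpaceDiskNat → ℝ),
      (∀ φ, IsOpen (N φ)) ∧ (∀ φ, φ ∈ N φ) ∧
      (∀ φ, ∀ y ∈ N φ, ρ (k φ) (evalVec S y) ≠ 0 ∧
        ∀ i j, |a i j (evalVec S y) - a i j (evalVec S φ)| < 1 / 8) ∧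
      (∀ φ d, pointEval d ∈ N φ → |α φ d - θ φ| < 1 / 8) ∧
      ∀ φ ψ d, pointEval d ∈ N φ → pointEval d ∈ N ψ →
        ∃ m : ℤ, a (k φ) (k ψ) (evalVec S (pointEval d)) - (α ψ d - α φ d) = m := by
  obtain ⟨M, s, hM, hs, hsh⟩ := exists_section_approx S hρ ha h0 h1 hc
  have hM0 : 0 < M := one_pos.trans_le hM
  have hcoord := fun d => coord_of_bundleProj_eq (fun k => h0 k _) (h1 (pointEval d))
    (hc (pointEval d)) (hs d).1
  choose k N α θ hNo hφN hN hα using exists_branch S (fun k => (hρ k).continuous)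
    (fun k l => (ha k l).continuous) h0 h1 hM (fun d => (hs d).2) (fun d => (hcoord d).1) hsh
  refine ⟨k, N, α, θ, hNo, hφN, hN, fun φ d hd => (hα φ d hd).1, fun φ ψ d hφ hψ => ?_⟩
  have hsd : (‖s d‖ : ℂ) ≠ 0 :=
    Complex.ofReal_ne_zero.mpr ((inv_pos.mpr hM0).trans_le (hs d).2).ne'
  have hk := (hN φ _ hφ).1
  have hl := (hN ψ _ hψ).1
  have e := (hcoord d).2 _ _ hk hl
  rw [(hα φ d hφ).2, (hα ψ d hψ).2, (hcoord d).1, (hcoord d).1] at e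
  have hk' := Complex.ofReal_ne_zero.mpr hk
  have hl' := Complex.ofReal_ne_zero.mpr hl
  have e2 : turn (a (k φ) (k ψ) (evalVec S (pointEval d)) + α φ d) = turn (α ψ d) := by
    rw [turn_add]
    refine mul_left_cancel₀ (mul_ne_zero (mul_ne_zero hk' hl') hsd) ?_
    push_cast at e
    linear_combination -e
  obtain ⟨m, hm⟩ := turn_eq_turn_iff.mp e2
  exact ⟨m, by linarith⟩

end Branches

section Cech

theorem round_eq_of_abs_sub_lt {r : ℝ} {m : ℤ} (h : |(m : ℝ) - r| < 1 / 2) : round r = m := by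
  have h1 := abs_sub_round r
  have h2 : |((m - round r : ℤ) : ℝ)| < 1 := by
    push_cast
    have := abs_add_le ((m : ℝ) - r) (r - round r)
    rw [sub_add_sub_cancel] at this
    linarith
  have h3 : |m - round r| < 1 := by exact_mod_cast h2
  have := Int.abs_lt_one_iff.mp h3
  omega

/-- Every open cover of the maximal ideal space has a refinement pulled back from finitely many
coordinates. -/
theorem exists_finite_refinement {ι : Type} {U : ι → Set MaxIdealSpaceDiskNat}
    (hU : ∀ i, IsOpen (U i)) (hUX : (⋃ i, U i) = Set.univ) :
    ∃ (S : Finset HinfDiskNat) (t : Finset MaxIdealSpaceDiskNat)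
      (W : t → Set (EuclideanSpace ℂ S)) (τ : t → ι), (∀ k, IsOpen (W k)) ∧
      (∀ φ, ∃ k, evalVec S φ ∈ W k) ∧ ∀ k φ, evalVec S φ ∈ W k → φ ∈ U (τ k) := by
  classical
  have hx : ∀ x : MaxIdealSpaceDiskNat, ∃ i, x ∈ U i := fun x =>
    mem_iUnion.mp (hUX ▸ mem_univ x)
  choose i hi using hx
  choose T ε hε hT using fun x => exists_finset_of_mem_nhds ((hU (i x)).mem_nhds (hi x))
  have hO : ∀ x, {y : MaxIdealSpaceDiskNat | ∀ f ∈ T x, ‖y f - x f‖ < ε x} ∈ 𝓝 x := fun x => by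
    have : ∀ᶠ y in 𝓝 x, ∀ f ∈ T x, ‖y f - x f‖ < ε x :=
      (Filter.eventually_all_finset (T x)).mpr fun f _ =>
        ((continuous_character_apply f).sub continuous_const).norm.continuousAt.eventually_lt_const
          (by simpa using hε x)
    exact this
  obtain ⟨t, -, ht⟩ := isCompact_univ.elim_nhds_subcover _ fun x _ => hO x
  refine ⟨t.biUnion T, t, fun k => {w | ∀ f : t.biUnion T, (f : HinfDiskNat) ∈ T k →
    ‖w f - (k : MaxIdealSpaceDiskNat) (f : HinfDiskNat)‖ < ε k}, fun k => i k, fun k => ?_,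
    fun φ => ?_, fun k φ h => hT k φ fun f hf =>
      h ⟨f, Finset.mem_biUnion.mpr ⟨k, k.2, hf⟩⟩ hf⟩
  · simp only [ofPred_forall]
    refine isOpen_iInter_of_finite fun f => isOpen_iInter_of_finite fun _ => ?_
    exact isOpen_lt (((EuclideanSpace.proj f : EuclideanSpace ℂ _ →L[ℂ] ℂ).continuous.sub
      continuous_const).norm) continuous_const
  · obtain ⟨x, hxt, hφ⟩ := mem_iUnion₂.mp (ht (mem_univ φ))
    exact ⟨⟨x, hxt⟩, fun f hf => hφ f hf⟩

/-- Averaging a cocycle over a partition of unity. -/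
theorem sum_cocycle {κ : Type*} [Fintype κ] {ρ : κ → ℝ} {C : κ → κ → κ → ℤ} (h1 : ∑ i, ρ i ^ 2 = 1)
    {j k l : κ} (hC : ∀ i, ρ i ≠ 0 → C j k l - C i k l + C i j l - C i j k = 0) :
    ∑ i, ρ i ^ 2 * (C i k l : ℝ) - ∑ i, ρ i ^ 2 * (C i j l : ℝ) + ∑ i, ρ i ^ 2 * (C i j k : ℝ) =
      C j k l := by
  rw [← Finset.sum_sub_distrib, ← Finset.sum_add_distrib]
  conv_rhs => rw [← one_mul (C j k l : ℝ), ← h1, Finset.sum_mul]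
  refine Finset.sum_congr rfl fun i _ => ?_
  rcases eq_or_ne (ρ i) 0 with h | h
  · simp [h]
  · have e : (C j k l : ℝ) - C i k l + C i j l - C i j k = 0 := by exact_mod_cast hC i h
    linear_combination -(ρ i ^ 2) * e

end Cech

/-- The second Čech cohomology group `H²(𝔐(H^∞(𝔻 × ℕ)), ℤ)` is trivial. -/
theorem cechH2_trivial_maxIdealSpace_diskNat : CechH2Trivial MaxIdealSpaceDiskNat := by
  intro ι U hU hUX c hc
  classical
  obtain ⟨S, t, W, τ, hW, hcov, hWU⟩ := exists_finite_refinement hU hUX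
  obtain ⟨ρ, hρ, h0, hρW, h1⟩ := exists_contDiff_sum_sq_eq_one
    (isCompact_range (continuous_evalVec S)) hW fun w hw => by
      obtain ⟨φ, rfl⟩ := hw
      exact mem_iUnion.mpr (hcov φ)
  have h1' : ∀ φ, ∑ k, ρ k (evalVec S φ) ^ 2 = 1 := fun φ => h1 _ ⟨φ, rfl⟩
  set a : t → t → EuclideanSpace ℂ S → ℝ := fun k l w =>
    ∑ i, ρ i w ^ 2 * (c (τ i) (τ k) (τ l) : ℝ) with ha
  have has : ∀ k l, ContDiff ℝ (⊤ : ℕ∞) (a k l) := fun k l =>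
    ContDiff.sum fun i _ => ((hρ i).pow 2).mul contDiff_const
  have hmem : ∀ k φ, ρ k (evalVec S φ) ≠ 0 → φ ∈ U (τ k) := fun k φ h => hWU k φ (hρW k _ h)
  have hac : ∀ φ j k l, ρ j (evalVec S φ) ≠ 0 → ρ k (evalVec S φ) ≠ 0 → ρ l (evalVec S φ) ≠ 0 →
      a k l (evalVec S φ) - a j l (evalVec S φ) + a j k (evalVec S φ) =
        c (τ j) (τ k) (τ l) := fun φ j k l hj hk hl =>
    sum_cocycle (C := fun i j k => c (τ i) (τ j) (τ k)) (h1' φ) fun i hi =>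
      hc _ _ _ _ ⟨φ, ⟨⟨hmem i φ hi, hmem j φ hj⟩, hmem k φ hk⟩, hmem l φ hl⟩
  obtain ⟨k, N, α, θ, hNo, hφN, hN, hα, hinteg⟩ := exists_branches S hρ has h0 h1'
    fun φ j k l hj hk hl => ⟨_, hac φ j k l hj hk hl⟩
  refine ⟨MaxIdealSpaceDiskNat, N, fun φ => τ (k φ), hNo,
    eq_univ_of_forall fun φ => mem_iUnion.mpr ⟨φ, hφN φ⟩,
    fun φ y hy => hmem _ y (hN φ y hy).1,
    fun φ ψ => round (a (k φ) (k ψ) (evalVec S φ) - (θ ψ - θ φ)), fun φ ψ χ hne => ?_⟩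
  have hb : ∀ φ ψ d, pointEval d ∈ N φ → pointEval d ∈ N ψ →
      ((round (a (k φ) (k ψ) (evalVec S φ) - (θ ψ - θ φ)) : ℤ) : ℝ) =
        a (k φ) (k ψ) (evalVec S (pointEval d)) - (α ψ d - α φ d) := fun φ ψ d hφ hψ => by
    obtain ⟨m, hm⟩ := hinteg φ ψ d hφ hψ
    have q1 := abs_lt.mp ((hN φ _ hφ).2 (k φ) (k ψ))
    have q2 := abs_lt.mp (hα φ d hφ)
    have q3 := abs_lt.mp (hα ψ d hψ)
    rw [round_eq_of_abs_sub_lt (m := m), hm]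
    rw [← hm, abs_lt]
    constructor <;> linarith [q1.1, q1.2, q2.1, q2.2, q3.1, q3.2]
  obtain ⟨d, ⟨hφ, hψ⟩, hχ⟩ := exists_pointEval_mem (((hNo φ).inter (hNo ψ)).inter (hNo χ)) hne
  have e := hac (pointEval d) (k φ) (k ψ) (k χ) (hN φ _ hφ).1 (hN ψ _ hψ).1 (hN χ _ hχ).1
  have : ((c (τ (k φ)) (τ (k ψ)) (τ (k χ)) : ℤ) : ℝ) =
      ((round (a (k ψ) (k χ) (evalVec S ψ) - (θ χ - θ ψ)) -
        round (a (k φ) (k χ) (evalVec S φ) - (θ χ - θ φ)) +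
        round (a (k φ) (k ψ) (evalVec S φ) - (θ ψ - θ φ)) : ℤ) : ℝ) := by
    push_cast
    rw [hb ψ χ d hψ hχ, hb φ χ d hφ hχ, hb φ ψ d hφ hψ, ← e]
    ring
  exact_mod_cast this

end
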